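/- arXiv:2110.06008 — 2 statements merged into one kernel-verified Lean document; each statement's English description precedes it below -/
import Mathlib

section
/- For every α > 0 and every y > √3/2: f_α(y) < f_α(√3/2) and g_α(y) < g_α(√3/2). That is, on the boundary line x = 1/2 of the fundamental domain, both the shifted lattice theta function θ_{1/2,y}(a(y);α) and the charged lattice theta function θ̂_{1/2,y}(a(y);α), evaluated at the circumcenter shift, are maximized over y ≥ √3/2 precisely at y = √3/2 (the hexagonal lattice). -/
/-- First coordinate of the circumcenter shift on the line `x = 1/2`. -/
noncomputable def a1 (y : ℝ) : ℝ := 1 / 4 + 1 / (16 * y ^ 2)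

/-- Second coordinate of the circumcenter shift on the line `x = 1/2`. -/
noncomputable def a2 (y : ℝ) : ℝ := 1 / 2 - 1 / (8 * y ^ 2)

/-- `f_α(y) = θ_{1/2,y}(a(y);α)`, the shifted theta function on the line `x = 1/2`. -/
noncomputable def fTheta (α y : ℝ) : ℝ :=
  ∑' p : ℤ × ℤ,
    Real.exp (-(Real.pi * α / y) *
      (((p.1 : ℝ) + a1 y) ^ 2 + ((p.1 : ℝ) + a1 y) * ((p.2 : ℝ) + a2 y) +
        (1 / 4 + y ^ 2) * ((p.2 : ℝ) + a2 y) ^ 2))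

/-- `g_α(y) = θ̂_{1/2,y}(a(y);α)`, the charged theta function on the line `x = 1/2`. -/
noncomputable def gTheta (α y : ℝ) : ℝ :=
  ∑' p : ℤ × ℤ,
    Real.exp (-(Real.pi * α / y) *
      ((p.1 : ℝ) ^ 2 + (p.1 : ℝ) * (p.2 : ℝ) + (1 / 4 + y ^ 2) * (p.2 : ℝ) ^ 2)) *
    Real.cos (2 * Real.pi * ((p.1 : ℝ) * a2 y - (p.2 : ℝ) * a1 y))

namespace CircumcenterTheta

open Real

/-- A lower bound for `exp (a / b)` that is checked on `b`-th powers. -/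
theorem le_exp_div {c : ℝ} (a b : ℕ) (hb : b ≠ 0) (h : c ^ b ≤ 2.7182818283 ^ a) :
    c ≤ exp (a / b) := by
  have hb' : (b : ℝ) ≠ 0 := by exact_mod_cast hb
  refine le_of_pow_le_pow_left₀ hb (exp_pos _).le ?_
  rw [← exp_nat_mul, mul_div_cancel₀ _ hb', ← mul_one (a : ℝ), exp_nat_mul]
  exact h.trans (pow_le_pow_left₀ (by norm_num) exp_one_gt_d9.le a)

/-- An upper bound for `exp (-t)` from a lower bound for `t`. -/
theorem exp_neg_le {t c : ℝ} (a b : ℕ) (hb : b ≠ 0) (hc : 0 < c) (ht : (a : ℝ) / b ≤ t)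
    (h : c⁻¹ ^ b ≤ 2.7182818283 ^ a) : exp (-t) ≤ c := by
  rw [exp_neg, inv_le_comm₀ (exp_pos _) hc]
  exact (le_exp_div a b hb h).trans (exp_le_exp.2 ht)

theorem hasSum_pow_natAbs {r : ℝ} (h0 : 0 ≤ r) (h1 : r < 1) :
    HasSum (fun k : ℤ => r ^ k.natAbs) ((1 + r) / (1 - r)) := by
  have h := hasSum_geometric_of_lt_one h0 h1
  have h' : HasSum (fun n : ℕ => r ^ (-((n : ℤ) + 1)).natAbs) (r * (1 - r)⁻¹) := by
    have e : (fun n : ℕ => r ^ (-((n : ℤ) + 1)).natAbs) = fun n : ℕ => r * r ^ n := by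
      funext n
      rw [show (-((n : ℤ) + 1)).natAbs = n + 1 by omega, pow_succ']
    rw [e]
    exact h.mul_left r
  have := HasSum.of_nat_of_neg_add_one (f := fun k : ℤ => r ^ k.natAbs) (by simpa using h) h'
  convert this using 1
  have : 1 - r ≠ 0 := by linarith
  field_simp

theorem hasSum_pow_natAbs_mul {r s : ℝ} (h0 : 0 ≤ r) (h1 : r < 1) (h0' : 0 ≤ s) (h1' : s < 1) :
    HasSum (fun v : ℤ × ℤ => r ^ v.1.natAbs * s ^ v.2.natAbs)
      ((1 + r) / (1 - r) * ((1 + s) / (1 - s))) := by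
  have hr := hasSum_pow_natAbs h0 h1
  have hs := hasSum_pow_natAbs h0' h1'
  have hrs : Summable fun v : ℤ × ℤ => r ^ v.1.natAbs * s ^ v.2.natAbs :=
    Summable.mul_of_nonneg (f := fun k : ℤ => r ^ k.natAbs) (g := fun k : ℤ => s ^ k.natAbs)
      hr.summable hs.summable (fun _ => pow_nonneg h0 _) (fun _ => pow_nonneg h0' _)
  have h := HasSum.mul hr hs hrs
  exact h

/-- Domination of a lattice sum by a finite part and a geometric tail. -/
theorem summable_and_tsum_le {F : ℤ × ℤ → ℝ} (hF : ∀ v, 0 ≤ F v) (B : Finset (ℤ × ℤ)) {C r : ℝ}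
    (hC : 0 ≤ C) (h0 : 0 ≤ r) (h1 : r < 1)
    (h : ∀ v ∉ B, F v ≤ C * (r ^ v.1.natAbs * r ^ v.2.natAbs)) :
    Summable F ∧ ∑' v, F v ≤ ∑ v ∈ B, F v + C * ((1 + r) / (1 - r) * ((1 + r) / (1 - r))) := by
  have hG := (hasSum_pow_natAbs_mul h0 h1 h0 h1).mul_left C
  have hB : HasSum (fun v => if v ∈ B then F v else 0) (∑ v ∈ B, F v) := by
    rw [← Finset.sum_congr rfl (fun v hv => if_pos hv : ∀ v ∈ B, (if v ∈ B then F v else 0) = F v)]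
    exact hasSum_sum_of_ne_finset_zero fun v hv => if_neg hv
  have hH := hB.add hG
  have hle : ∀ v, F v ≤ (if v ∈ B then F v else 0) + C * (r ^ v.1.natAbs * r ^ v.2.natAbs) := by
    intro v
    by_cases hv : v ∈ B
    · simp only [hv, if_true]
      have : 0 ≤ C * (r ^ v.1.natAbs * r ^ v.2.natAbs) := by positivity
      linarith
    · simpa [hv] using h v hv
  have hs : Summable F := Summable.of_nonneg_of_le hF hle hH.summable
  exact ⟨hs, (hs.tsum_le_tsum hle hH.summable).trans hH.tsum_eq.le⟩

/-- A lattice sum vanishes if its terms cancel along the orbits of an order three symmetry. -/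
theorem tsum_eq_zero_of_orbit {h : ℤ × ℤ → ℝ} (e : ℤ × ℤ ≃ ℤ × ℤ) (hs : Summable h)
    (h0 : ∀ v, h v + h (e v) + h (e (e v)) = 0) : ∑' v, h v = 0 := by
  have h1 : ∑' v, h (e v) = ∑' v, h v := e.tsum_eq h
  have h2 : ∑' v, h (e (e v)) = ∑' v, h v := (e.tsum_eq fun v => h (e v)).trans h1
  have s1 : Summable fun v => h (e v) := e.summable_iff.2 hs
  have s2 : Summable fun v => h (e (e v)) := e.summable_iff.2 s1
  have := (hs.add s1).tsum_add s2
  rw [hs.tsum_add s1, h1, h2] at this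
  simp only [h0, tsum_zero] at this
  linarith

/-- The numerical constant `√3 / 2`, the height of the equilateral triangle. -/
theorem sqrt_three_div_two_bounds : 0.866 < √3 / 2 ∧ √3 / 2 < 0.8661 ∧ (√3 / 2) ^ 2 = 3 / 4 := by
  have h : √3 ^ 2 = 3 := Real.sq_sqrt (by norm_num)
  have h' : 0 ≤ √3 := Real.sqrt_nonneg 3
  refine ⟨?_, ?_, by rw [div_pow, h]; norm_num⟩ <;> nlinarith

/-- Second order remainder of the exponential. -/
theorem exp_neg_sub_le (t : ℝ) : exp (-t) - 1 + t ≤ t ^ 2 / 2 * max 1 (exp (-t)) := by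
  rcases le_total 0 t with ht | ht
  · have h1 := quadratic_le_exp_of_nonneg ht
    have h2 : exp (-t) ≤ 1 - t + t ^ 2 / 2 := by
      rw [exp_neg, inv_le_iff_one_le_mul₀ (exp_pos _)]
      have h3 : 0 ≤ 1 - t + t ^ 2 / 2 := by nlinarith [sq_nonneg (t - 1)]
      nlinarith [mul_le_mul_of_nonneg_left h1 h3, sq_nonneg (t ^ 2)]
    have h3 := mul_le_mul_of_nonneg_left (le_max_left 1 (exp (-t))) (by positivity : 0 ≤ t ^ 2 / 2)
    linarith
  · have hmono : MonotoneOn (fun s : ℝ => s ^ 2 / 2 * exp s - exp s + 1 + s) (Set.Ici 0) := by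
      have hd : ∀ s : ℝ, HasDerivAt (fun s : ℝ => s ^ 2 / 2 * exp s - exp s + 1 + s)
          (1 - exp s * (1 - s - s ^ 2 / 2)) s := by
        intro s
        have h1 : HasDerivAt (fun s : ℝ => s ^ 2 / 2) s s := by
          simpa using (hasDerivAt_pow 2 s).div_const 2
        exact ((((h1.mul (Real.hasDerivAt_exp s)).sub (Real.hasDerivAt_exp s)).add_const 1).add
          (hasDerivAt_id s)).congr_deriv (by ring)
      refine monotoneOn_of_deriv_nonneg (convex_Ici 0) (fun s _ => (hd s).continuousAt.continuousWithinAt)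
        (fun s _ => (hd s).differentiableAt.differentiableWithinAt) fun s hs => ?_
      rw [(hd s).deriv]
      have h1 : 1 - s - s ^ 2 / 2 ≤ exp (-s) := by nlinarith [add_one_le_exp (-s), sq_nonneg s]
      have h2 := mul_le_mul_of_nonneg_left h1 (exp_pos s).le
      rw [← exp_add, add_neg_cancel, exp_zero] at h2
      linarith
    have h0 : (0 : ℝ) ≤ -t := by linarith
    have := hmono (Set.mem_Ici.2 le_rfl) (Set.mem_Ici.2 h0) h0
    simp only [exp_zero] at this
    have h3 := mul_le_mul_of_nonneg_left (le_max_right 1 (exp (-t))) (by positivity : 0 ≤ t ^ 2 / 2)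
    nlinarith

theorem exp_neg_sub_nonneg (t : ℝ) : 0 ≤ exp (-t) - 1 + t := by
  linarith [add_one_le_exp (-t)]

theorem summable_exp_neg_sq {c : ℝ} (hc : 0 < c) (x : ℝ) :
    Summable fun k : ℤ => exp (-(c * (k + x) ^ 2)) := by
  have hr := (hasSum_pow_natAbs (exp_pos (-c)).le (by simpa using hc)).summable.mul_left
    (exp (c * (|x| + 1 / 4)))
  refine Summable.of_nonneg_of_le (fun _ => (exp_pos _).le) (fun k => ?_) hr
  rw [← exp_nat_mul, ← exp_add, exp_le_exp, Nat.cast_natAbs, Int.cast_abs]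
  have h1 : |(k : ℝ)| ≤ |(k : ℝ) + x| + |x| := by
    have := abs_sub ((k : ℝ) + x) x
    simpa using this
  have h2 : |(k : ℝ) + x| ≤ (k + x) ^ 2 + 1 / 4 := by
    rw [← sq_abs]
    nlinarith [sq_nonneg (|(k : ℝ) + x| - 1 / 2)]
  nlinarith

theorem cexp_mul_I_of_int (n : ℤ) : Complex.exp (π * n * Complex.I) = (cos (π * n) : ℝ) := by
  rw [show (π * n * Complex.I : ℂ) = ((π * n : ℝ) : ℂ) * Complex.I by push_cast; ring,
    Complex.exp_mul_I, ← Complex.ofReal_cos, ← Complex.ofReal_sin, mul_comm π (n : ℝ),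
    sin_int_mul_pi]
  simp

theorem ofReal_sqrt_eq_cpow {s : ℝ} (hs : 0 ≤ s) : ((s : ℂ) ^ (1 / 2 : ℂ)) = (√s : ℝ) := by
  rw [Real.sqrt_eq_rpow, Complex.ofReal_cpow hs]
  norm_num

/-- Poisson summation for a Gaussian centred at a half-integer. -/
theorem tsum_gaussian_half_int {s : ℝ} (hs : 0 < s) (n : ℤ) :
    ∑' k : ℤ, exp (-(π / s * (k + n / 2) ^ 2)) =
      √s * ∑' m : ℤ, exp (-(π * s * m ^ 2)) * cos (π * (m * n)) := by
  have h := Complex.tsum_exp_neg_quadratic (a := s) (by simpa using hs) (Complex.I * n / 2)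
  have hsq : ((√s : ℝ) : ℂ) ≠ 0 := by exact_mod_cast (Real.sqrt_pos.2 hs).ne'
  rw [ofReal_sqrt_eq_cpow hs.le, ← (Equiv.addRight n).tsum_eq fun k : ℤ =>
    Complex.exp (-π / s * (k + Complex.I * (Complex.I * n / 2)) ^ 2), one_div_mul_eq_div,
    eq_div_iff hsq, mul_comm] at h
  apply Complex.ofReal_injective
  rw [Complex.ofReal_tsum, Complex.ofReal_mul, Complex.ofReal_tsum]
  convert h.symm using 1
  · refine tsum_congr fun k => ?_
    rw [Complex.ofReal_exp]
    congr 1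
    rw [Equiv.coe_addRight]
    push_cast
    rw [show Complex.I * (Complex.I * (n : ℂ) / 2) = Complex.I ^ 2 * n / 2 by ring, Complex.I_sq]
    ring
  · congr 1
    refine tsum_congr fun m => ?_
    have e := cexp_mul_I_of_int (m * n)
    rw [show π * ((m * n : ℤ) : ℝ) = π * (m * n) by push_cast; ring] at e
    rw [Complex.ofReal_mul, ← e, Complex.ofReal_exp, ← Complex.exp_add]
    congr 1
    push_cast
    ring

/-- Poisson summation for a Gaussian with a character, centred at a half-integer. -/
theorem tsum_gaussian_mul_cos {s : ℝ} (hs : 0 < s) (c : ℝ) (m : ℤ) :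
    ∑' k : ℤ, exp (-(π / s * (k + m / 2) ^ 2)) * cos (2 * π * (k * c - m * ((1 - c) / 2))) =
      √s * ∑' l : ℤ, exp (-(π * s * (l + c) ^ 2)) * cos (π * (m * (l + 1))) := by
  have hs' : (s : ℂ) ≠ 0 := by exact_mod_cast hs.ne'
  have h := Complex.tsum_exp_neg_quadratic (a := ((1 / s : ℝ) : ℂ)) (by simpa using hs)
    (-m / (2 * s) + Complex.I * c)
  have hsq : ((√s : ℝ) : ℂ) ≠ 0 := by exact_mod_cast (Real.sqrt_pos.2 hs).ne'
  rw [ofReal_sqrt_eq_cpow (by positivity), ← (Equiv.neg ℤ).tsum_eq fun n : ℤ =>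
    Complex.exp (-π / ((1 / s : ℝ) : ℂ) *
      (n + Complex.I * (-m / (2 * s) + Complex.I * c)) ^ 2)] at h
  have hE (k : ℤ) : Complex.exp (-π * m ^ 2 / (4 * s) -
        π * (1 - c) * m * Complex.I) * Complex.exp (-π * ((1 / s : ℝ) : ℂ) * k ^ 2 + 2 * π *
        (-m / (2 * s) + Complex.I * c) * k) =
      Complex.exp (((-(π / s * (k + m / 2) ^ 2) : ℝ) : ℂ) +
        ((2 * π * (k * c - m * ((1 - c) / 2)) : ℝ) : ℂ) * Complex.I) := by
    rw [← Complex.exp_add]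
    congr 1
    push_cast
    field_simp
    ring
  have hL (k : ℤ) : exp (-(π / s * (k + m / 2) ^ 2)) *
      cos (2 * π * (k * c - m * ((1 - c) / 2))) = (Complex.exp (-π * m ^ 2 / (4 * s) -
        π * (1 - c) * m * Complex.I) * Complex.exp (-π * ((1 / s : ℝ) : ℂ) * k ^ 2 + 2 * π *
        (-m / (2 * s) + Complex.I * c) * k)).re := by
    rw [hE, Complex.exp_add, ← Complex.ofReal_exp, Complex.re_ofReal_mul,
      Complex.exp_ofReal_mul_I_re]
  have hR (l : ℤ) : ((exp (-(π * s * (l + c) ^ 2)) * cos (π * (m * (l + 1))) : ℝ) : ℂ) =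
      Complex.exp (-π * m ^ 2 / (4 * s) - π * (1 - c) * m * Complex.I) *
        Complex.exp (-π / ((1 / s : ℝ) : ℂ) * (((Equiv.neg ℤ l : ℤ) : ℂ) +
          Complex.I * (-m / (2 * s) + Complex.I * c)) ^ 2) := by
    have e := cexp_mul_I_of_int (-(m * (l + 1)))
    rw [show π * ((-(m * (l + 1)) : ℤ) : ℝ) = -(π * (m * (l + 1))) by push_cast; ring,
      cos_neg] at e
    rw [Complex.ofReal_mul, ← e, Complex.ofReal_exp, ← Complex.exp_add, ← Complex.exp_add,
      Equiv.neg_apply]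
    congr 1
    rw [show Complex.I * (-(m : ℂ) / (2 * s) + Complex.I * c) =
      -Complex.I * m / (2 * s) + Complex.I ^ 2 * c by ring, Complex.I_sq]
    push_cast
    field_simp
    ring_nf
    rw [Complex.I_sq]
    ring
  rw [tsum_congr hL]
  have hsum : Summable fun k : ℤ => Complex.exp (-π * m ^ 2 / (4 * s) -
        π * (1 - c) * m * Complex.I) * Complex.exp (-π * ((1 / s : ℝ) : ℂ) * k ^ 2 + 2 * π *
        (-m / (2 * s) + Complex.I * c) * k) := by
    refine Summable.of_norm ?_
    convert summable_exp_neg_sq (c := π / s) (by positivity) (m / 2) using 2 with k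
    rw [hE, Complex.norm_exp, Complex.add_re, Complex.ofReal_re, Complex.re_ofReal_mul,
      Complex.I_re, mul_zero, add_zero]
  rw [← Complex.re_tsum hsum, tsum_mul_left, h, ← Complex.ofReal_re (√s * _), Complex.ofReal_mul,
    Complex.ofReal_tsum, tsum_congr hR, tsum_mul_left, mul_left_comm]
  congr 2
  rw [Real.sqrt_div zero_le_one, Real.sqrt_one]
  push_cast
  rw [one_div_one_div]

theorem a1_eq (y : ℝ) : a1 y = (1 - a2 y) / 2 := by
  unfold a1 a2; ring

theorem tsum_prod_swap {F : ℤ × ℤ → ℝ} (h : Summable F) :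
    ∑' v, F v = ∑' l, ∑' k, F (k, l) := by
  rw [← (Equiv.prodComm ℤ ℤ).tsum_eq F]
  exact Summable.tsum_prod ((Equiv.prodComm ℤ ℤ).summable_iff.2 h)

/-- Summability of Gaussians over a shifted lattice in the fundamental domain. -/
theorem summable_exp_neg_quadratic {c y : ℝ} (hc : 0 < c) (hy : √3 / 2 ≤ y) (a b : ℝ) :
    Summable fun p : ℤ × ℤ => exp (-(c * ((p.1 + a) ^ 2 + (p.1 + a) * (p.2 + b) +
      (1 / 4 + y ^ 2) * (p.2 + b) ^ 2))) := by
  have h := Summable.mul_of_nonneg (summable_exp_neg_sq (half_pos hc) a)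
    (summable_exp_neg_sq (half_pos hc) b) (fun _ => (exp_pos _).le) fun _ => (exp_pos _).le
  refine Summable.of_nonneg_of_le (fun _ => (exp_pos _).le) (fun p => ?_) h
  rw [← exp_add, exp_le_exp]
  have h1 : 3 / 4 ≤ y ^ 2 := by
    obtain ⟨-, -, h⟩ := sqrt_three_div_two_bounds
    rw [← h]
    gcongr
  have h2 : 0 ≤ c * (((p.1 + a) + (p.2 + b)) ^ 2 / 2 + (y ^ 2 - 3 / 4) * (p.2 + b) ^ 2) := by
    have := mul_nonneg (sub_nonneg.2 h1) (sq_nonneg (p.2 + b))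
    positivity
  linarith

theorem summable_dual {s t : ℝ} (hs : 0 < s) (ht : 0 < t) (c : ℝ) :
    Summable fun v : ℤ × ℤ => exp (-(π * s * (v.1 + c) ^ 2)) *
      (exp (-(π * t * v.2 ^ 2)) * cos (π * (v.2 * (v.1 + 1)))) := by
  have h := Summable.mul_of_nonneg (summable_exp_neg_sq (mul_pos pi_pos hs) c)
    (summable_exp_neg_sq (mul_pos pi_pos ht) 0) (fun _ => (exp_pos _).le) fun _ => (exp_pos _).le
  refine Summable.of_norm_bounded h fun v => ?_
  rw [norm_mul, norm_mul, norm_of_nonneg (exp_pos _).le, norm_of_nonneg (exp_pos _).le, add_zero]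
  gcongr
  exact mul_le_of_le_one_right (exp_pos _).le (abs_cos_le_one _)

theorem fTheta_eq_dual {α y : ℝ} (hα : 0 < α) (hy : √3 / 2 ≤ y) :
    fTheta α y = √(y / α) * ∑' v : ℤ × ℤ, exp (-(π * (α * y) * (v.1 + a2 y) ^ 2)) *
      (exp (-(π * (y / α) * v.2 ^ 2)) * cos (π * (v.2 * (v.1 + 1)))) := by
  have hy0 : 0 < y := lt_of_lt_of_le (by positivity) hy
  have hs := summable_exp_neg_quadratic (c := π * α / y) (by positivity) hy (a1 y) (a2 y)
  simp only [← neg_mul] at hs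
  rw [fTheta, tsum_prod_swap hs,
    (summable_dual (by positivity) (by positivity) _).tsum_prod, ← tsum_mul_left]
  refine tsum_congr fun l => ?_
  have h := tsum_gaussian_half_int (s := y / α) (by positivity) (l + 1)
  dsimp only
  rw [tsum_mul_left, mul_left_comm]
  push_cast at h
  rw [← h, ← tsum_mul_left]
  refine tsum_congr fun k => ?_
  rw [← exp_add]
  congr 1
  rw [a1_eq]
  field_simp
  ring

theorem gTheta_eq_dual {β y : ℝ} (hβ : 0 < β) (hy : √3 / 2 ≤ y) :
    gTheta β y = √(y / β) * ∑' v : ℤ × ℤ, exp (-(π * (y / β) * (v.1 + a2 y) ^ 2)) *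
      (exp (-(π * (β * y) * v.2 ^ 2)) * cos (π * (v.2 * (v.1 + 1)))) := by
  have hy0 : 0 < y := lt_of_lt_of_le (by positivity) hy
  have hs : Summable fun p : ℤ × ℤ => exp (-(π * β / y) * ((p.1 : ℝ) ^ 2 + (p.1 : ℝ) * (p.2 : ℝ) +
      (1 / 4 + y ^ 2) * (p.2 : ℝ) ^ 2)) * cos (2 * π * ((p.1 : ℝ) * a2 y - (p.2 : ℝ) * a1 y)) := by
    have h := summable_exp_neg_quadratic (c := π * β / y) (by positivity) hy 0 0
    simp only [← neg_mul, add_zero] at h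
    refine Summable.of_norm_bounded h fun p => ?_
    rw [norm_mul, norm_of_nonneg (exp_pos _).le]
    exact mul_le_of_le_one_right (exp_pos _).le (abs_cos_le_one _)
  have hd := summable_dual (s := y / β) (t := β * y) (by positivity) (by positivity) (a2 y)
  rw [gTheta, tsum_prod_swap hs, tsum_prod_swap hd, ← tsum_mul_left]
  refine tsum_congr fun m => ?_
  have h := tsum_gaussian_mul_cos (s := y / β) (by positivity) (a2 y) m
  rw [← a1_eq] at h
  have e (l : ℤ) : exp (-(π * (y / β) * (l + a2 y) ^ 2)) *
      (exp (-(π * (β * y) * m ^ 2)) * cos (π * (m * (l + 1)))) =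
      exp (-(π * (β * y) * m ^ 2)) * (exp (-(π * (y / β) * (l + a2 y) ^ 2)) *
      cos (π * (m * (l + 1)))) := by ring
  rw [tsum_congr e, tsum_mul_left, mul_left_comm, ← h, ← tsum_mul_left]
  refine tsum_congr fun k => ?_
  rw [← mul_assoc, ← exp_add]
  congr 2
  field_simp
  ring

theorem fTheta_eq_gTheta {α y : ℝ} (hα : 0 < α) (hy : √3 / 2 ≤ y) :
    fTheta α y = 1 / α * gTheta (1 / α) y := by
  have hy0 : 0 < y := lt_of_lt_of_le (by positivity) hy
  rw [fTheta_eq_dual hα hy, gTheta_eq_dual (one_div_pos.2 hα) hy]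
  have e : √(y / (1 / α)) = α * √(y / α) := by
    rw [show y / (1 / α) = α ^ 2 * (y / α) by field_simp, sqrt_mul (sq_nonneg α), sqrt_sq hα.le]
  rw [e, mul_assoc α, ← mul_assoc (1 / α) α, one_div_mul_cancel hα.ne', one_mul]
  simp only [div_div_eq_mul_div, div_one, mul_comm y α, one_div_mul_eq_div]

/-- The maximality statements for parameters at least one imply them for all parameters. -/
theorem lt_of_lt_of_one_le
    (hf : ∀ α y, 1 ≤ α → √3 / 2 < y → fTheta α y < fTheta α (√3 / 2))
    (hg : ∀ β y, 1 ≤ β → √3 / 2 < y → gTheta β y < gTheta β (√3 / 2))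
    {α y : ℝ} (hα : 0 < α) (hy : √3 / 2 < y) :
    fTheta α y < fTheta α (√3 / 2) ∧ gTheta α y < gTheta α (√3 / 2) := by
  rcases le_total 1 α with h | h
  · exact ⟨hf α y h hy, hg α y h hy⟩
  · have h1 : 1 ≤ 1 / α := by rwa [le_div_iff₀ hα, one_mul]
    have hα' : 0 < 1 / α := by positivity
    refine ⟨?_, ?_⟩
    · rw [fTheta_eq_gTheta hα hy.le, fTheta_eq_gTheta hα le_rfl]
      exact mul_lt_mul_of_pos_left (hg _ y h1 hy) hα'
    · have := hf _ y h1 hy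
      rw [fTheta_eq_gTheta hα' hy.le, fTheta_eq_gTheta hα' le_rfl, one_div_one_div] at this
      exact lt_of_mul_lt_mul_left this hα.le

/-- The quadratic form of the hexagonal lattice centred at a circumcenter, normalised to have
minimum zero on the lattice. -/
def shiftedForm (v : ℤ × ℤ) : ℤ := v.1 ^ 2 + v.1 * v.2 + v.2 ^ 2 + v.1 + v.2

/-- The traceless part of the second coordinate form with respect to `shiftedForm`. -/
def shiftedWeight (v : ℤ × ℤ) : ℤ := 3 * (v.2 * (v.2 + 1)) - 2 * shiftedForm v

/-- The rotation of order three about the circumcenter. -/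
def shiftedRotation : ℤ × ℤ ≃ ℤ × ℤ where
  toFun v := (-v.1 - v.2 - 1, v.1)
  invFun v := (v.2, -v.1 - v.2 - 1)
  left_inv v := Prod.ext rfl (by dsimp only; ring)
  right_inv v := Prod.ext (by dsimp only; ring) rfl

theorem shiftedForm_rotation (v : ℤ × ℤ) : shiftedForm (shiftedRotation v) = shiftedForm v := by
  simp only [shiftedForm, shiftedRotation, Equiv.coe_fn_mk]; ring

theorem shiftedWeight_rotation (v : ℤ × ℤ) : shiftedWeight v + shiftedWeight (shiftedRotation v) +
    shiftedWeight (shiftedRotation (shiftedRotation v)) = 0 := by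
  simp only [shiftedWeight, shiftedForm, shiftedRotation, Equiv.coe_fn_mk]; ring

theorem mul_add_one_nonneg (n : ℤ) : 0 ≤ n * (n + 1) := by
  rcases le_or_gt 0 n with h | h
  · positivity
  · nlinarith

theorem two_mul_abs_le_mul_add_one (n : ℤ) : 2 * |n| - 2 ≤ n * (n + 1) := by
  rcases le_or_gt 0 n with h | h
  · rw [abs_of_nonneg h]
    nlinarith [sq_nonneg (2 * n - 1)]
  · rw [abs_of_neg h]
    obtain h1 | h1 : n = -1 ∨ n ≤ -2 := by omega
    · simp [h1]
    · nlinarith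

theorem two_mul_shiftedForm (v : ℤ × ℤ) : 2 * shiftedForm v = v.1 * (v.1 + 1) + v.2 * (v.2 + 1) +
    (v.1 + v.2) * (v.1 + v.2 + 1) := by
  unfold shiftedForm; ring

theorem shiftedForm_nonneg (v : ℤ × ℤ) : 0 ≤ shiftedForm v := by
  linarith [two_mul_shiftedForm v, mul_add_one_nonneg v.1, mul_add_one_nonneg v.2,
    mul_add_one_nonneg (v.1 + v.2)]

theorem neg_two_mul_le_shiftedWeight (v : ℤ × ℤ) : -2 * shiftedForm v ≤ shiftedWeight v := by
  unfold shiftedWeight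
  linarith [mul_add_one_nonneg v.2]

theorem shiftedWeight_le (v : ℤ × ℤ) : shiftedWeight v ≤ 4 * shiftedForm v := by
  unfold shiftedWeight
  linarith [two_mul_shiftedForm v, mul_add_one_nonneg v.1, mul_add_one_nonneg (v.1 + v.2)]

theorem abs_add_abs_le_shiftedForm {v : ℤ × ℤ}
    (hv : v ∉ Finset.Icc (-4 : ℤ) 4 ×ˢ Finset.Icc (-4 : ℤ) 4) :
    |v.1| + |v.2| + 4 ≤ shiftedForm v := by
  have key (n : ℤ) (hn : ¬(-4 ≤ n ∧ n ≤ 4)) : 2 * |n| + 10 ≤ n * (n + 1) := by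
    rcases le_or_gt 0 n with h | h
    · rw [abs_of_nonneg h]
      nlinarith [show 5 ≤ n by omega]
    · rw [abs_of_neg h]
      nlinarith [show n ≤ -5 by omega]
  have h1 := two_mul_abs_le_mul_add_one v.1
  have h2 := two_mul_abs_le_mul_add_one v.2
  have h3 := two_mul_shiftedForm v
  have h4 := mul_add_one_nonneg (v.1 + v.2)
  rw [Finset.mem_product, Finset.mem_Icc, Finset.mem_Icc, not_and_or] at hv
  rcases hv with h | h <;> linarith [key _ h]

theorem sq_le_two_pow {n : ℕ} (hn : 4 ≤ n) : n ^ 2 ≤ 2 ^ n := by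
  induction n, hn using Nat.le_induction with
  | base => norm_num
  | succ n hn ih => rw [pow_succ 2]; nlinarith

theorem shiftedWeight_sq_sum {X : ℝ} (h0 : 0 ≤ X) (h1 : 2 * X < 1) :
    Summable (fun v => (shiftedWeight v : ℝ) ^ 2 * X ^ (shiftedForm v).toNat) ∧
    ∑' v, (shiftedWeight v : ℝ) ^ 2 * X ^ (shiftedForm v).toNat ≤
      ∑ v ∈ Finset.Icc (-4 : ℤ) 4 ×ˢ Finset.Icc (-4 : ℤ) 4,
        (shiftedWeight v : ℝ) ^ 2 * X ^ (shiftedForm v).toNat +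
      16 * (2 * X) ^ 4 * ((1 + 2 * X) / (1 - 2 * X) * ((1 + 2 * X) / (1 - 2 * X))) := by
  refine summable_and_tsum_le (fun v => by positivity) _ (by positivity) (by positivity) h1
    fun v hv => ?_
  have h := abs_add_abs_le_shiftedForm hv
  rw [Int.abs_eq_natAbs, Int.abs_eq_natAbs] at h
  have h4 : 4 ≤ shiftedForm v := by omega
  obtain ⟨n, hn⟩ := Int.eq_ofNat_of_zero_le (shiftedForm_nonneg v)
  have hW : (shiftedWeight v : ℝ) ^ 2 ≤ 16 * 2 ^ n := by
    have hw : shiftedWeight v ^ 2 ≤ 16 * (n : ℤ) ^ 2 := by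
      have := neg_two_mul_le_shiftedWeight v
      have := shiftedWeight_le v
      rw [hn] at *
      nlinarith
    have hn' : (n : ℝ) ^ 2 ≤ 2 ^ n := by
      exact_mod_cast sq_le_two_pow (n := n) (by omega)
    have : (shiftedWeight v : ℝ) ^ 2 ≤ 16 * (n : ℝ) ^ 2 := by exact_mod_cast hw
    linarith
  rw [hn, Int.toNat_natCast]
  calc (shiftedWeight v : ℝ) ^ 2 * X ^ n ≤ 16 * 2 ^ n * X ^ n := by gcongr
    _ = 16 * (2 * X) ^ n := by rw [mul_pow]; ring
    _ ≤ 16 * (2 * X) ^ (4 + (v.1.natAbs + v.2.natAbs)) := by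
      gcongr ?_ * ?_
      exact pow_le_pow_of_le_one (by positivity) h1.le (by omega)
    _ = _ := by rw [pow_add, pow_add]; ring

theorem summable_shiftedWeight_sq {X : ℝ} (h0 : 0 ≤ X) (h1 : X ≤ 0.0652) :
    Summable fun v => (shiftedWeight v : ℝ) ^ 2 * X ^ (shiftedForm v).toNat :=
  (shiftedWeight_sq_sum h0 (by linarith)).1

theorem tsum_shiftedWeight_sq_le :
    ∑' v, (shiftedWeight v : ℝ) ^ 2 * (0.0652 : ℝ) ^ (shiftedForm v).toNat ≤ 1.785 := by
  have h : ∑ v ∈ Finset.Icc (-4 : ℤ) 4 ×ˢ Finset.Icc (-4 : ℤ) 4,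
        (shiftedWeight v : ℚ) ^ 2 * (0.0652 : ℚ) ^ (shiftedForm v).toNat ≤ 1.776 := by
    decide +kernel
  rw [← Rat.cast_le (K := ℝ)] at h
  push_cast at h
  refine (shiftedWeight_sq_sum (by norm_num) (by norm_num)).2.trans ?_
  norm_num at h ⊢
  linarith

theorem tsum_shiftedWeight_sq_le' :
    ∑' v, (shiftedWeight v : ℝ) ^ 2 * (0.052 : ℝ) ^ (shiftedForm v).toNat ≤ 1.42 := by
  have h : ∑ v ∈ Finset.Icc (-4 : ℤ) 4 ×ˢ Finset.Icc (-4 : ℤ) 4,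
        (shiftedWeight v : ℚ) ^ 2 * (0.052 : ℚ) ^ (shiftedForm v).toNat ≤ 1.41 := by
    decide +kernel
  rw [← Rat.cast_le (K := ℝ)] at h
  push_cast at h
  refine (shiftedWeight_sq_sum (by norm_num) (by norm_num)).2.trans ?_
  norm_num at h ⊢
  linarith

/-- The terms of `fTheta`, normalised to have maximum one. -/
noncomputable def shiftedTerm (α y : ℝ) (v : ℤ × ℤ) : ℝ :=
  exp (-(π * α / y * (shiftedForm v + (shiftedWeight v + 2 * shiftedForm v) / 3 * (y ^ 2 - 3 / 4))))

/-- The squared circumradius of the lattice with parameter `1 / 2 + i y`, normalised to have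
covolume one. -/
noncomputable def circumradiusSq (y : ℝ) : ℝ := y / 4 + 1 / (8 * y) + 1 / (64 * y ^ 3)

theorem exp_mul_shiftedTerm {α y : ℝ} (hy : 0 < y) (v : ℤ × ℤ) :
    exp (-(π * α * circumradiusSq y)) * shiftedTerm α y v =
      exp (-(π * α / y) * (((v.1 : ℝ) + a1 y) ^ 2 + ((v.1 : ℝ) + a1 y) * ((v.2 : ℝ) + a2 y) +
        (1 / 4 + y ^ 2) * ((v.2 : ℝ) + a2 y) ^ 2)) := by
  rw [shiftedTerm, ← exp_add]
  congr 1
  unfold circumradiusSq a1 a2 shiftedWeight shiftedForm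
  push_cast
  field_simp
  ring

theorem summable_shiftedTerm {α y : ℝ} (hα : 0 < α) (hy : √3 / 2 ≤ y) :
    Summable (shiftedTerm α y) := by
  have hy0 : 0 < y := lt_of_lt_of_le (by positivity) hy
  have h := summable_exp_neg_quadratic (c := π * α / y) (by positivity) hy (a1 y) (a2 y)
  simp only [← neg_mul, ← exp_mul_shiftedTerm hy0] at h
  exact (summable_mul_left_iff (exp_pos _).ne').1 h

theorem fTheta_eq {α y : ℝ} (hy : 0 < y) :
    fTheta α y = exp (-(π * α * circumradiusSq y)) * ∑' v, shiftedTerm α y v := by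
  rw [← tsum_mul_left, fTheta]
  exact tsum_congr fun v => (exp_mul_shiftedTerm hy v).symm

theorem three_le_tsum_shiftedTerm {α y : ℝ} (hα : 0 < α) (hy : √3 / 2 ≤ y) :
    3 ≤ ∑' v, shiftedTerm α y v := by
  have h := (summable_shiftedTerm hα hy).sum_le_tsum {(0, 0), (-1, 0), (0, -1)}
    fun v _ => (exp_pos _).le
  refine le_trans (le_of_eq ?_) h
  rw [Finset.sum_insert (by decide), Finset.sum_insert (by decide), Finset.sum_singleton]
  norm_num [shiftedTerm, shiftedForm, shiftedWeight]

theorem circumradiusSq_sub {y y₀ : ℝ} (hy : 0 < y) (hy₀ : 0 < y₀) (h : y₀ ^ 2 = 3 / 4) :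
    circumradiusSq y - circumradiusSq y₀ =
      (y - y₀) ^ 2 * (12 * y ^ 2 + 2 / y₀ * y + 1) / (48 * y ^ 3) := by
  have e : 1 / y₀ = 4 / 3 * y₀ := by field_simp; linarith
  have e3 : 1 / (64 * y₀ ^ 3) = (4 / 3 * y₀) ^ 3 / 64 := by rw [← e]; field_simp
  have e1 : 1 / (8 * y₀) = (4 / 3 * y₀) / 8 := by rw [← e]; field_simp
  have e2 : 2 / y₀ = 2 * (4 / 3 * y₀) := by rw [← e]; field_simp
  unfold circumradiusSq
  rw [e1, e2, e3, show (4 / 3 * y₀) ^ 3 = 64 / 27 * (y₀ ^ 2 * y₀) by ring, h]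
  field_simp
  ring_nf
  have h3 : y₀ ^ 3 = 3 / 4 * y₀ := by rw [pow_succ, h]
  simp only [h, h3]
  ring

theorem exp_natCast_mul_le {t X : ℝ} (h : exp (-t) ≤ X) {q : ℤ} (hq : 0 ≤ q) :
    exp (-(t * q)) ≤ X ^ q.toNat := by
  obtain ⟨n, rfl⟩ := Int.eq_ofNat_of_zero_le hq
  rw [Int.toNat_natCast, Int.cast_natCast, mul_comm, ← mul_neg, exp_nat_mul]
  gcongr

/-- Second order expansion of the terms of `fTheta` about the hexagonal point. -/
theorem shiftedTerm_le {α y y₀ : ℝ} (hα : 0 < α) (hy₀ : 0 < y₀) (h : y₀ ^ 2 = 3 / 4)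
    (hy : y₀ ≤ y) (v : ℤ × ℤ) :
    shiftedTerm α y v ≤ shiftedTerm α y₀ v -
      π * α * (y - y₀) / (2 * y * y₀) * (shiftedWeight v * shiftedTerm α y₀ v) +
      (π * α * (y - y₀) / (2 * y * y₀)) ^ 2 / 2 *
        ((shiftedWeight v : ℝ) ^ 2 * exp (-(π * α / y * shiftedForm v))) := by
  have hy' : 0 < y := hy₀.trans_le hy
  set s := π * α * (y - y₀) / (2 * y * y₀) with hs
  have hq : (0 : ℝ) ≤ shiftedForm v := by exact_mod_cast shiftedForm_nonneg v
  have hW : -2 * (shiftedForm v : ℝ) ≤ shiftedWeight v := by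
    exact_mod_cast neg_two_mul_le_shiftedWeight v
  have hs0 : 0 ≤ s := div_nonneg (mul_nonneg (by positivity) (sub_nonneg.2 hy)) (by positivity)
  set q : ℝ := (shiftedForm v : ℝ)
  set W : ℝ := (shiftedWeight v : ℝ)
  have h0 : shiftedTerm α y₀ v = exp (-(π * α / y₀ * q)) := by
    rw [shiftedTerm, h, sub_self, mul_zero, add_zero]
  have hsq : 2 * s * q = π * α / y₀ * q - π * α / y * q := by
    rw [hs]; field_simp
  have h1 : shiftedTerm α y v ≤ exp (-(π * α / y₀ * q)) * exp (-(s * W)) := by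
    rw [shiftedTerm, ← exp_add, exp_le_exp]
    have e : π * α / y * (q + (W + 2 * q) / 3 * (y ^ 2 - 3 / 4)) -
        (π * α / y₀ * q + s * W) = (W + 2 * q) / 3 * (π * α * (y - y₀) ^ 2 / y) := by
      rw [hs]
      field_simp
      linear_combination (32 * q * y - 16 * q * y₀ + 16 * W * y - 8 * W * y₀) * h
    have : 0 ≤ (W + 2 * q) / 3 * (π * α * (y - y₀) ^ 2 / y) :=
      mul_nonneg (by linarith) (by positivity)
    linarith
  have h2 := mul_le_mul_of_nonneg_left (exp_neg_sub_le (s * W)) (exp_pos (-(π * α / y₀ * q))).le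
  have h3 : exp (-(π * α / y₀ * q)) * max 1 (exp (-(s * W))) ≤ exp (-(π * α / y * q)) := by
    rw [mul_max_of_nonneg _ _ (exp_pos _).le, ← exp_add, mul_one]
    refine max_le (exp_le_exp.2 ?_) (exp_le_exp.2 ?_)
    · nlinarith
    · nlinarith
  have h4 := mul_le_mul_of_nonneg_left h3 (show 0 ≤ (s * W) ^ 2 / 2 by positivity)
  rw [h0]
  linarith

theorem mul_shiftedWeight_sq_mul_exp_le {α y X : ℝ} (hα : 1 ≤ α) (hy : 0 < y) (hy3 : y ≤ 3)
    (hX : exp (-(π / y)) ≤ X) (v : ℤ × ℤ) :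
    α * ((shiftedWeight v : ℝ) ^ 2 * exp (-(π * α / y * shiftedForm v))) ≤
      (shiftedWeight v : ℝ) ^ 2 * X ^ (shiftedForm v).toNat := by
  rw [mul_left_comm]
  rcases (shiftedForm_nonneg v).eq_or_lt with h | h
  · have h1 := neg_two_mul_le_shiftedWeight v
    have h2 := shiftedWeight_le v
    rw [show shiftedWeight v = 0 by omega]
    simp
  · have hq : (1 : ℝ) ≤ shiftedForm v := by exact_mod_cast h
    refine mul_le_mul_of_nonneg_left (le_trans ?_ (exp_natCast_mul_le hX h.le)) (sq_nonneg _)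
    have h1 : 1 ≤ π / y := by
      rw [le_div_iff₀ hy]
      linarith [pi_gt_three]
    have h2 : α ≤ exp (α - 1) := by linarith [add_one_le_exp (α - 1)]
    calc α * exp (-(π * α / y * shiftedForm v))
        ≤ exp (α - 1) * exp (-(π * α / y * shiftedForm v)) := by gcongr
      _ ≤ exp (-(π / y * shiftedForm v)) := by
        rw [← exp_add, exp_le_exp]
        have : α - 1 ≤ (α - 1) * (π / y * shiftedForm v) :=
          le_mul_of_one_le_right (by linarith) (one_le_mul_of_one_le_of_one_le h1 hq)
        have e : π * α / y * shiftedForm v = π / y * shiftedForm v +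
          (α - 1) * (π / y * shiftedForm v) := by ring
        linarith

theorem tsum_shiftedWeight_mul {α y₀ : ℝ} (h : y₀ ^ 2 = 3 / 4)
    (hs : Summable fun v => (shiftedWeight v : ℝ) * shiftedTerm α y₀ v) :
    ∑' v, (shiftedWeight v : ℝ) * shiftedTerm α y₀ v = 0 := by
  refine tsum_eq_zero_of_orbit shiftedRotation hs fun v => ?_
  have hw : (shiftedWeight v : ℝ) + shiftedWeight (shiftedRotation v) +
    shiftedWeight (shiftedRotation (shiftedRotation v)) = 0 := by
    exact_mod_cast shiftedWeight_rotation v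
  simp only [shiftedTerm, h, sub_self, mul_zero, add_zero, shiftedForm_rotation, ← add_mul]
  rw [hw, zero_mul]

/-- A weighted second moment bound implies maximality of the hexagonal point for `fTheta`. -/
theorem fTheta_lt_of_secondMoment_le {α y X K : ℝ} (hα : 1 ≤ α) (hy : √3 / 2 < y) (hy3 : y ≤ 3)
    (hX : exp (-(π / y)) ≤ X)
    (hs : Summable fun v => (shiftedWeight v : ℝ) ^ 2 * X ^ (shiftedForm v).toNat)
    (hK : ∑' v, (shiftedWeight v : ℝ) ^ 2 * X ^ (shiftedForm v).toNat ≤ K)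
    (h : π * K ≤ 3 / 8 * (12 * y + 2 / (√3 / 2) + 1 / y)) :
    fTheta α y < fTheta α (√3 / 2) := by
  obtain ⟨h₀, -, hsq⟩ := sqrt_three_div_two_bounds
  have hα0 : 0 < α := by linarith
  have hS := summable_shiftedTerm hα0 hy.le
  have hS₀ := summable_shiftedTerm hα0 (le_refl (√3 / 2))
  have h3 := three_le_tsum_shiftedTerm hα0 (le_refl (√3 / 2))
  set y₀ := √3 / 2
  have hy₀ : 0 < y₀ := by linarith
  have hy0 : 0 < y := by linarith
  have hE (v : ℤ × ℤ) : (shiftedWeight v : ℝ) ^ 2 * exp (-(π * α / y * shiftedForm v)) ≤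
      1 / α * ((shiftedWeight v : ℝ) ^ 2 * X ^ (shiftedForm v).toNat) := by
    rw [one_div, le_inv_mul_iff₀ hα0]
    exact mul_shiftedWeight_sq_mul_exp_le hα hy0 hy3 hX v
  have hWs : Summable fun v => (shiftedWeight v : ℝ) * shiftedTerm α y₀ v := by
    refine Summable.of_norm_bounded (hS₀.add (hs.mul_left (1 / α))) fun v => ?_
    have hp : 0 < shiftedTerm α y₀ v := exp_pos _
    have hle : shiftedTerm α y₀ v ≤ exp (-(π * α / y * shiftedForm v)) := by
      rw [shiftedTerm, hsq, sub_self, mul_zero, add_zero, exp_le_exp, neg_le_neg_iff]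
      have hq : (0 : ℝ) ≤ shiftedForm v := by exact_mod_cast shiftedForm_nonneg v
      gcongr
    have hm := mul_le_mul_of_nonneg_left hle (sq_nonneg (shiftedWeight v : ℝ))
    have h1 : |(shiftedWeight v : ℝ)| ≤ 1 + (shiftedWeight v : ℝ) ^ 2 := by
      rw [← sq_abs]
      nlinarith [sq_nonneg (|(shiftedWeight v : ℝ)| - 1)]
    rw [norm_mul, norm_of_nonneg hp.le, norm_eq_abs]
    nlinarith [hE v, mul_le_mul_of_nonneg_right h1 hp.le]
  set s := π * α * (y - y₀) / (2 * y * y₀) with hs_def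
  have hT (v : ℤ × ℤ) : shiftedTerm α y v ≤ shiftedTerm α y₀ v -
      s * (shiftedWeight v * shiftedTerm α y₀ v) +
      s ^ 2 / (2 * α) * ((shiftedWeight v : ℝ) ^ 2 * X ^ (shiftedForm v).toNat) := by
    refine (shiftedTerm_le hα0 hy₀ hsq hy.le v).trans ?_
    have := mul_le_mul_of_nonneg_left (hE v) (show 0 ≤ s ^ 2 / 2 by positivity)
    rw [← mul_assoc _ (1 / α), show s ^ 2 / 2 * (1 / α) = s ^ 2 / (2 * α) by field_simp] at this
    linarith
  have hle := hS.tsum_le_tsum hT ((hS₀.sub (hWs.mul_left s)).add (hs.mul_left _))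
  rw [(hS₀.sub (hWs.mul_left s)).tsum_add (hs.mul_left _), hS₀.tsum_sub (hWs.mul_left s),
    tsum_mul_left, tsum_mul_left, tsum_shiftedWeight_mul hsq hWs, mul_zero, sub_zero] at hle
  have hr := circumradiusSq_sub hy0 hy₀ hsq
  set D := circumradiusSq y - circumradiusSq y₀ with hD
  have hD0 : 0 < D := by
    rw [hr]
    have := sub_pos.2 hy
    positivity
  have hmain : s ^ 2 / (2 * α) * K ≤ 3 * (π * α * D) := by
    have e1 : s ^ 2 / (2 * α) * K = π * α * (y - y₀) ^ 2 / (6 * y ^ 2) * (π * K) := by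
      rw [hs_def, div_pow, show (2 * y * y₀) ^ 2 = 3 * y ^ 2 by rw [mul_pow, hsq]; ring]
      field_simp
      ring
    have e2 : 3 * (π * α * D) = π * α * (y - y₀) ^ 2 / (6 * y ^ 2) *
        (3 / 8 * (12 * y + 2 / y₀ + 1 / y)) := by
      rw [hr]
      field_simp
      ring
    rw [e1, e2]
    gcongr
  have hle' : ∑' v, shiftedTerm α y v ≤ (∑' v, shiftedTerm α y₀ v) * (1 + π * α * D) := by
    have := mul_le_mul_of_nonneg_left hK (show 0 ≤ s ^ 2 / (2 * α) by positivity)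
    have := mul_le_mul_of_nonneg_right h3 (show 0 ≤ π * α * D by positivity)
    linarith
  have hexp : 1 + π * α * D < exp (π * α * D) := by
    linarith [add_one_lt_exp (show π * α * D ≠ 0 by positivity)]
  rw [fTheta_eq hy0, fTheta_eq hy₀]
  calc _ ≤ exp (-(π * α * circumradiusSq y)) *
        ((∑' v, shiftedTerm α y₀ v) * (1 + π * α * D)) := by gcongr
    _ < exp (-(π * α * circumradiusSq y)) *
        ((∑' v, shiftedTerm α y₀ v) * exp (π * α * D)) := by gcongr
    _ = exp (-(π * α * circumradiusSq y)) * exp (π * α * D) * ∑' v, shiftedTerm α y₀ v := by ring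
    _ = _ := by
      rw [← exp_add, hD]
      congr 2
      ring

theorem fTheta_lt_of_le {α y : ℝ} (hα : 1 ≤ α) (hy : √3 / 2 < y) (hy1 : y ≤ 1.15) :
    fTheta α y < fTheta α (√3 / 2) := by
  obtain ⟨h₀, h₀', -⟩ := sqrt_three_div_two_bounds
  have hy0 : 0 < y := by linarith
  have hpi := pi_gt_d4
  have hpi' := pi_lt_d4
  have h2 : 2.3 ≤ 2 / (√3 / 2) := by
    rw [le_div_iff₀ (by linarith)]; linarith
  rcases le_total y 1.05 with h | h
  · refine fTheta_lt_of_secondMoment_le hα hy (by linarith) (X := 0.052) ?_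
      (summable_shiftedWeight_sq (by norm_num) (by norm_num)) tsum_shiftedWeight_sq_le' ?_
    · refine exp_neg_le 74 25 (by norm_num) (by norm_num) ?_ (by norm_num)
      rw [le_div_iff₀ hy0]
      linarith
    · have : 0 < 1 / y := by positivity
      linarith
  · refine fTheta_lt_of_secondMoment_le hα hy (by linarith) (X := 0.0652) ?_
      (summable_shiftedWeight_sq (by norm_num) (by norm_num)) tsum_shiftedWeight_sq_le ?_
    · refine exp_neg_le 71 26 (by norm_num) (by norm_num) ?_ (by norm_num)
      rw [le_div_iff₀ hy0]
      push_cast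
      linarith
    · have : 0.8 ≤ 1 / y := by
        rw [le_div_iff₀ hy0]
        linarith
      linarith

theorem tsum_int_le_of_geometric_two {F : ℤ → ℝ} (hF : Summable F) {A A' r : ℝ} (h0 : 0 ≤ r)
    (h1 : r < 1) (hA : ∀ n : ℕ, F (n + 2) ≤ A * r ^ n)
    (hA' : ∀ n : ℕ, F (-(n + 2)) ≤ A' * r ^ n) :
    ∑' k, F k ≤ F 0 + F 1 + F (-1) + (A + A') * (1 / (1 - r)) := by
  have hp : Summable fun n : ℕ => F n := hF.comp_injective Nat.cast_injective
  have hn : Summable fun n : ℕ => F (-((n : ℤ) + 1)) :=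
    hF.comp_injective fun a b h => by simpa using h
  have hp' := (summable_nat_add_iff 1).2 hp
  have hg : HasSum (fun n : ℕ => r ^ n) (1 / (1 - r)) := by
    simpa using hasSum_geometric_of_lt_one h0 h1
  rw [tsum_of_nat_of_neg_add_one hp hn, hp.tsum_eq_zero_add, hn.tsum_eq_zero_add,
    hp'.tsum_eq_zero_add]
  have i1 := ((summable_nat_add_iff 1).2 hp').tsum_le_tsum
    (g := fun n : ℕ => A * r ^ n) (fun n => by simpa [add_assoc] using hA n)
    (hg.mul_left A).summable
  have i2 := ((summable_nat_add_iff 1).2 hn).tsum_le_tsum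
    (g := fun n : ℕ => A' * r ^ n)
    (fun n => by
      have := hA' n
      rwa [show -(((n + 1 : ℕ) : ℤ) + 1) = -(n + 2) by push_cast; ring])
    (hg.mul_left A').summable
  rw [(hg.mul_left A).tsum_eq] at i1
  rw [(hg.mul_left A').tsum_eq] at i2
  norm_num [add_assoc] at i1 i2 ⊢
  linarith

theorem tsum_int_le_of_geometric {F : ℤ → ℝ} (hF : Summable F) {A A' r : ℝ} (h0 : 0 ≤ r)
    (h1 : r < 1) (hA : ∀ n : ℕ, F (n + 1) ≤ A * r ^ (n + 1))
    (hA' : ∀ n : ℕ, F (-(n + 2)) ≤ A' * r ^ (n + 1)) :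
    ∑' k, F k ≤ F 0 + F (-1) + (A + A') * (r / (1 - r)) := by
  refine (tsum_int_le_of_geometric_two hF (A := A * r ^ 2) (A' := A' * r) h0 h1
    (fun n => ?_) fun n => ?_).trans ?_
  · have := hA (n + 1)
    push_cast at this
    rw [add_assoc, one_add_one_eq_two] at this
    exact this.trans (le_of_eq (by ring))
  · exact (hA' n).trans (le_of_eq (by ring))
  · have h := hA 0
    have e : (A * r ^ 2 + A' * r) * (1 / (1 - r)) = (A + A') * (r / (1 - r)) - A * r := by
      have : 1 - r ≠ 0 := by linarith
      field_simp
      ring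
    norm_num at h
    linarith

theorem summable_exp_neg_mul_int {c : ℝ} (hc : 0 < c) (x : ℝ) :
    Summable fun k : ℤ => exp (-(c * (k * (k + x)))) := by
  refine ((summable_exp_neg_sq hc (x / 2)).mul_left (exp (c * (x / 2) ^ 2))).congr fun k => ?_
  rw [← exp_add]
  congr 1
  ring

theorem tsum_exp_neg_sq_le {c : ℝ} (hc : 0 < c) :
    ∑' k : ℤ, exp (-(c * k ^ 2)) ≤ 1 + 2 * (exp (-c) / (1 - exp (-c))) := by
  have hx : exp (-c) < 1 := by simpa using hc
  have hs := summable_exp_neg_sq hc 0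
  simp only [add_zero] at hs
  refine (tsum_int_le_of_geometric hs (A := 1) (A' := exp (-c)) (exp_pos _).le hx
    (fun n => ?_) fun n => ?_).trans (le_of_eq ?_)
  · rw [one_mul, ← exp_nat_mul, exp_le_exp]
    push_cast
    linarith [mul_nonneg hc.le (Nat.cast_nonneg n : (0 : ℝ) ≤ n),
      mul_nonneg hc.le (sq_nonneg (n : ℝ))]
  · rw [← exp_nat_mul, ← exp_add, exp_le_exp]
    push_cast
    linarith [mul_nonneg hc.le (Nat.cast_nonneg n : (0 : ℝ) ≤ n),
      mul_nonneg hc.le (sq_nonneg (n : ℝ))]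
  · have : 1 - exp (-c) ≠ 0 := by linarith
    norm_num
    field_simp
    ring

theorem tsum_exp_neg_mul_add_one_le {c : ℝ} (hc : 0 < c) :
    ∑' k : ℤ, exp (-(c * (k * (k + 1)))) ≤
      2 + 2 * (exp (-c) ^ 2 / (1 - exp (-c) ^ 2)) := by
  have hx : exp (-c) < 1 := by simpa using hc
  refine (tsum_int_le_of_geometric (summable_exp_neg_mul_int hc 1) (A := 1) (A' := 1)
    (by positivity) (pow_lt_one₀ (exp_pos _).le hx two_ne_zero)
    (fun n => ?_) fun n => ?_).trans (le_of_eq ?_)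
  · rw [one_mul, ← pow_mul, ← exp_nat_mul, exp_le_exp]
    push_cast
    linarith [mul_nonneg hc.le (Nat.cast_nonneg n : (0 : ℝ) ≤ n),
      mul_nonneg hc.le (sq_nonneg (n : ℝ))]
  · rw [one_mul, ← pow_mul, ← exp_nat_mul, exp_le_exp]
    push_cast
    linarith [mul_nonneg hc.le (Nat.cast_nonneg n : (0 : ℝ) ≤ n),
      mul_nonneg hc.le (sq_nonneg (n : ℝ))]
  · norm_num

theorem tsum_shiftedTerm_row_even {y : ℝ} (hy : 0 < y) (j : ℤ) :
    ∑' k : ℤ, shiftedTerm 1 y (k, 2 * j) ≤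
      exp (-(π * (y - 1 / (4 * y)) * (2 * j * (2 * j + 1)))) *
        ∑' k : ℤ, exp (-(π / y * (k * (k + 1)))) := by
  have hs := summable_exp_neg_mul_int (c := π / y) (by positivity) 1
  rw [← (Equiv.addRight j).tsum_eq fun k : ℤ => exp (-(π / y * (k * (k + 1)))), ← tsum_mul_left]
  have e (k : ℤ) : shiftedTerm 1 y (k, 2 * j) = exp (-(π * (y - 1 / (4 * y)) *
      (2 * j * (2 * j + 1)))) * exp (-(π / y * ((k + j) * (k + j + 1)))) *
      exp (-(π * j ^ 2 / y)) := by
    rw [shiftedTerm, ← exp_add, ← exp_add]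
    congr 1
    unfold shiftedWeight shiftedForm
    push_cast
    field_simp
    ring
  have hle (k : ℤ) : shiftedTerm 1 y (k, 2 * j) ≤ exp (-(π * (y - 1 / (4 * y)) *
      (2 * j * (2 * j + 1)))) * exp (-(π / y * (((Equiv.addRight j k : ℤ) : ℝ) *
        ((Equiv.addRight j k : ℤ) + 1)))) := by
    rw [e, Equiv.coe_addRight]
    push_cast
    refine mul_le_of_le_one_right (by positivity) (exp_le_one_iff.2 ?_)
    rw [neg_nonpos]
    positivity
  have hs' := ((Equiv.addRight j).summable_iff.2 hs).mul_left
    (exp (-(π * (y - 1 / (4 * y)) * (2 * j * (2 * j + 1)))))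
  exact (Summable.of_nonneg_of_le (fun k => (exp_pos _).le) hle hs').tsum_le_tsum hle hs'

theorem tsum_shiftedTerm_row_odd {y : ℝ} (hy : 0 < y) (j : ℤ) :
    ∑' k : ℤ, shiftedTerm 1 y (k, 2 * j + 1) ≤
      exp (-(π * (y - 1 / (4 * y)) * ((2 * j + 1) * (2 * j + 2)))) *
        ∑' k : ℤ, exp (-(π / y * k ^ 2)) := by
  have hs := summable_exp_neg_sq (c := π / y) (by positivity) 0
  simp only [add_zero] at hs
  rw [← (Equiv.addRight (j + 1)).tsum_eq fun k : ℤ => exp (-(π / y * k ^ 2)), ← tsum_mul_left]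
  have e (k : ℤ) : shiftedTerm 1 y (k, 2 * j + 1) = exp (-(π * (y - 1 / (4 * y)) *
      ((2 * j + 1) * (2 * j + 2)))) * exp (-(π / y * (k + (j + 1)) ^ 2)) *
      exp (-(π * (j * (j + 1)) / y)) := by
    rw [shiftedTerm, ← exp_add, ← exp_add]
    congr 1
    unfold shiftedWeight shiftedForm
    push_cast
    field_simp
    ring
  have hle (k : ℤ) : shiftedTerm 1 y (k, 2 * j + 1) ≤ exp (-(π * (y - 1 / (4 * y)) *
      ((2 * j + 1) * (2 * j + 2)))) *
        exp (-(π / y * ((Equiv.addRight (j + 1) k : ℤ) : ℝ) ^ 2)) := by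
    rw [e, Equiv.coe_addRight]
    push_cast
    refine mul_le_of_le_one_right (by positivity) (exp_le_one_iff.2 ?_)
    have : (0 : ℝ) ≤ j * (j + 1) := by exact_mod_cast mul_add_one_nonneg j
    rw [neg_nonpos]
    positivity
  have hs' := ((Equiv.addRight (j + 1)).summable_iff.2 hs).mul_left
    (exp (-(π * (y - 1 / (4 * y)) * ((2 * j + 1) * (2 * j + 2)))))
  exact (Summable.of_nonneg_of_le (fun k => (exp_pos _).le) hle hs').tsum_le_tsum hle hs'

theorem tsum_shiftedTerm_row_le {y : ℝ} (hy : 0 < y) (l : ℤ) :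
    ∑' k : ℤ, shiftedTerm 1 y (k, l) ≤ exp (-(π * (y - 1 / (4 * y)) * (l * (l + 1)))) *
      (∑' k : ℤ, exp (-(π / y * k ^ 2)) + ∑' k : ℤ, exp (-(π / y * (k * (k + 1))))) := by
  have p1 : 0 ≤ ∑' k : ℤ, exp (-(π / y * k ^ 2)) := tsum_nonneg fun k => (exp_pos _).le
  have p2 : 0 ≤ ∑' k : ℤ, exp (-(π / y * (k * (k + 1)))) := tsum_nonneg fun k => (exp_pos _).le
  obtain ⟨j, rfl | rfl⟩ := l.even_or_odd'
  · refine (tsum_shiftedTerm_row_even hy j).trans ?_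
    push_cast
    gcongr
    linarith
  · refine (tsum_shiftedTerm_row_odd hy j).trans ?_
    push_cast
    rw [add_assoc (2 * (j : ℝ)), one_add_one_eq_two]
    gcongr
    linarith

theorem tsum_shiftedTerm_one_le {y : ℝ} (hy : 1.15 ≤ y) :
    ∑' v, shiftedTerm 1 y v ≤ (3 + 2 * (exp (-(π / y)) / (1 - exp (-(π / y)))) +
      2 * (exp (-(π / y)) ^ 2 / (1 - exp (-(π / y)) ^ 2))) * 1.0058 := by
  have hy0 : 0 < y := by linarith
  obtain ⟨-, h₀, -⟩ := sqrt_three_div_two_bounds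
  have hS := summable_shiftedTerm one_pos (by linarith : √3 / 2 ≤ y)
  have hR0 := tsum_exp_neg_sq_le (c := π / y) (by positivity)
  have hR1 := tsum_exp_neg_mul_add_one_le (c := π / y) (by positivity)
  have hr0 := tsum_shiftedTerm_row_even hy0 0
  have hr1 := tsum_shiftedTerm_row_odd hy0 (-1)
  have hrow := tsum_shiftedTerm_row_le hy0
  have p1 : 0 ≤ ∑' k : ℤ, exp (-(π / y * k ^ 2)) := tsum_nonneg fun k => (exp_pos _).le
  have p2 : 0 ≤ ∑' k : ℤ, exp (-(π / y * (k * (k + 1)))) := tsum_nonneg fun k => (exp_pos _).le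
  rw [tsum_prod_swap hS]
  set R := ∑' k : ℤ, exp (-(π / y * k ^ 2)) + ∑' k : ℤ, exp (-(π / y * (k * (k + 1))))
  have hR : 0 ≤ R := add_nonneg p1 p2
  set c := π * (y - 1 / (4 * y)) with hc
  have hy4 : 1 / (4 * y) ≤ 0.2174 := by
    rw [div_le_iff₀ (by positivity)]
    linarith
  have hc0 : 2.9297 ≤ c := by nlinarith [pi_gt_d4]
  have hE : exp (-(2 * c)) ≤ 0.00286 :=
    exp_neg_le 41 7 (by norm_num) (by norm_num) (by push_cast; linarith) (by norm_num)
  have hEp := exp_pos (-(2 * c))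
  have hS' : Summable fun l : ℤ => ∑' k : ℤ, shiftedTerm 1 y (k, l) :=
    ((Equiv.prodComm ℤ ℤ).summable_iff.2 hS).prod
  have hle := tsum_int_le_of_geometric hS' (A := R) (A' := R) hEp.le (by linarith)
    (fun n => ?_) fun n => ?_
  · have hg : exp (-(2 * c)) / (1 - exp (-(2 * c))) ≤ 0.0029 := by
      rw [div_le_iff₀ (by linarith)]
      linarith
    have := mul_le_mul_of_nonneg_left hg (by linarith : 0 ≤ R + R)
    norm_num at hr0 hr1
    linarith
  · rw [mul_comm]
    refine (hrow _).trans (mul_le_mul_of_nonneg_right ?_ hR)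
    rw [← exp_nat_mul, exp_le_exp]
    push_cast
    have hn : (0 : ℝ) ≤ n := Nat.cast_nonneg n
    have : 0 ≤ c * ((n : ℝ) * (n + 1)) := by positivity
    linarith
  · rw [mul_comm]
    refine (hrow _).trans (mul_le_mul_of_nonneg_right ?_ hR)
    rw [← exp_nat_mul, exp_le_exp]
    push_cast
    have hn : (0 : ℝ) ≤ n := Nat.cast_nonneg n
    have : 0 ≤ c * ((n : ℝ) * (n + 1)) := by positivity
    linarith

theorem circumradiusSq_le {a y : ℝ} (ha : 1 ≤ a) (h : a ≤ y) :
    circumradiusSq a ≤ circumradiusSq y := by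
  have ha0 : 0 < a := by linarith
  have hy0 : 0 < y := by linarith
  have e : circumradiusSq y - circumradiusSq a = (y - a) *
      (1 / 4 - 1 / 8 * (1 / y * (1 / a)) - 1 / 64 * (1 / y * (1 / a)) *
        ((1 / y) ^ 2 + 1 / y * (1 / a) + (1 / a) ^ 2)) := by
    unfold circumradiusSq
    field_simp
    ring
  have h1 : 1 / a ≤ 1 := (div_le_one ha0).2 ha
  have h2 : 1 / y ≤ 1 := (div_le_one hy0).2 (by linarith)
  have p1 : 0 < 1 / a := by positivity
  have p2 : 0 < 1 / y := by positivity
  generalize 1 / a = t at *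
  generalize 1 / y = u at *
  have hut : u * t ≤ 1 := by nlinarith
  have hu2 : u ^ 2 + u * t + t ^ 2 ≤ 3 := by nlinarith
  have hp : (u * t) * (u ^ 2 + u * t + t ^ 2) ≤ 1 * 3 := by gcongr
  have : 0 ≤ (y - a) * (1 / 4 - 1 / 8 * (u * t) - 1 / 64 * (u * t) *
      (u ^ 2 + u * t + t ^ 2)) := mul_nonneg (by linarith) (by linarith)
  linarith

theorem circumradiusSq_hexagonal_le : circumradiusSq (√3 / 2) ≤ 0.38494 := by
  obtain ⟨h₀, h₀', h⟩ := sqrt_three_div_two_bounds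
  generalize √3 / 2 = y at *
  have e : circumradiusSq y = 4 / 9 * y := by
    unfold circumradiusSq
    have h4 : y ^ 4 = 9 / 16 := by rw [show y ^ 4 = (y ^ 2) ^ 2 by ring, h]; norm_num
    field_simp
    ring_nf
    rw [h, h4]
    norm_num
  rw [e]
  linarith

theorem fTheta_lt_of_tsum_lt {α y : ℝ} (hα : 1 ≤ α) (hy : √3 / 2 < y)
    (h : ∑' v, shiftedTerm 1 y v < 3 * exp (π * (circumradiusSq y - circumradiusSq (√3 / 2)))) :
    fTheta α y < fTheta α (√3 / 2) := by
  obtain ⟨h₀, -, hsq⟩ := sqrt_three_div_two_bounds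
  have hα0 : 0 < α := by linarith
  have h3 := three_le_tsum_shiftedTerm hα0 (le_refl (√3 / 2))
  have hS := summable_shiftedTerm hα0 hy.le
  have hS1 := summable_shiftedTerm one_pos hy.le
  set y₀ := √3 / 2
  have hy0 : 0 < y := by linarith
  have hy₀ : 0 < y₀ := by linarith
  have hD0 : 0 ≤ circumradiusSq y - circumradiusSq y₀ := by
    rw [circumradiusSq_sub hy0 hy₀ hsq]
    positivity
  have hT (v : ℤ × ℤ) : shiftedTerm α y v ≤ shiftedTerm 1 y v := by
    have hq : (0 : ℝ) ≤ shiftedForm v := by exact_mod_cast shiftedForm_nonneg v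
    have hW : -2 * (shiftedForm v : ℝ) ≤ shiftedWeight v := by
      exact_mod_cast neg_two_mul_le_shiftedWeight v
    have hz : 0 ≤ y ^ 2 - 3 / 4 := by
      rw [← hsq, sub_nonneg]
      gcongr
    have hnn : 0 ≤ (shiftedForm v : ℝ) +
        (shiftedWeight v + 2 * shiftedForm v) / 3 * (y ^ 2 - 3 / 4) :=
      add_nonneg hq (mul_nonneg (by linarith) hz)
    unfold shiftedTerm
    gcongr
  rw [fTheta_eq hy0, fTheta_eq hy₀]
  calc _ ≤ exp (-(π * α * circumradiusSq y₀)) *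
        exp (-(π * (circumradiusSq y - circumradiusSq y₀))) * ∑' v, shiftedTerm 1 y v := by
        rw [← exp_add]
        refine mul_le_mul (exp_le_exp.2 ?_) (hS.tsum_le_tsum hT hS1)
          (tsum_nonneg fun v => (exp_pos _).le) (exp_pos _).le
        have := mul_le_mul_of_nonneg_right hα (mul_nonneg pi_pos.le hD0)
        linarith
    _ < exp (-(π * α * circumradiusSq y₀)) *
        exp (-(π * (circumradiusSq y - circumradiusSq y₀))) *
        (3 * exp (π * (circumradiusSq y - circumradiusSq y₀))) := by gcongr
    _ = exp (-(π * α * circumradiusSq y₀)) * 3 := by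
      rw [exp_neg (π * (_ - _))]
      field_simp
    _ ≤ _ := by gcongr

theorem three_mul_le_exp {ρ : ℝ} (h : 0 ≤ ρ) : 3 * (1 + ρ + ρ ^ 2 / 2) ≤ 3 * exp ρ := by
  linarith [quadratic_le_exp_of_nonneg h]

theorem tsum_shiftedTerm_lt_of_mem {a X y ρ : ℝ} (ha : 1.15 ≤ a) (hay : a ≤ y)
    (hX : exp (-(π / y)) ≤ X) (hX1 : X < 1) (hρ : 0 ≤ ρ)
    (hρ' : ρ ≤ 3.1415 * (a / 4 + 1 / (8 * a) + 1 / (64 * a ^ 3) - 0.38494))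
    (h : (3 + 2 * (X / (1 - X)) + 2 * (X ^ 2 / (1 - X ^ 2))) * 1.0058 <
      3 * (1 + ρ + ρ ^ 2 / 2)) :
    ∑' v, shiftedTerm 1 y v < 3 * exp (π * (circumradiusSq y - circumradiusSq (√3 / 2))) := by
  have hx := exp_pos (-(π / y))
  have hX0 : 0 ≤ X := hx.le.trans hX
  have h1 : 0 < 1 - X ^ 2 := by nlinarith
  have hle : (3 + 2 * (exp (-(π / y)) / (1 - exp (-(π / y)))) +
      2 * (exp (-(π / y)) ^ 2 / (1 - exp (-(π / y)) ^ 2))) * 1.0058 ≤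
      (3 + 2 * (X / (1 - X)) + 2 * (X ^ 2 / (1 - X ^ 2))) * 1.0058 := by
    have := sub_pos.2 hX1
    gcongr
  have hr := circumradiusSq_le (by linarith) hay
  have h0 := circumradiusSq_hexagonal_le
  have hρ2 : ρ ≤ π * (circumradiusSq y - circumradiusSq (√3 / 2)) := by
    refine hρ'.trans (mul_le_mul pi_gt_d4.le (by unfold circumradiusSq at *; linarith) ?_ pi_pos.le)
    by_contra hneg
    push Not at hneg
    nlinarith
  calc _ ≤ _ := tsum_shiftedTerm_one_le (by linarith)
    _ ≤ _ := hle
    _ < _ := h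
    _ ≤ _ := three_mul_le_exp hρ
    _ ≤ _ := by gcongr

theorem tsum_shiftedTerm_lt_of_three_le {y : ℝ} (hy : 3 ≤ y) :
    ∑' v, shiftedTerm 1 y v < 3 * exp (π * (circumradiusSq y - circumradiusSq (√3 / 2))) := by
  have hy0 : 0 < y := by linarith
  have key {c : ℝ} (hc : 0 < c) : exp (-c) / (1 - exp (-c)) ≤ 1 / c := by
    have h1 : exp (-c) < 1 := by simpa using hc
    rw [div_le_div_iff₀ (by linarith) hc]
    have h2 : (c + 1) * exp (-c) ≤ 1 := by
      have := mul_le_mul_of_nonneg_right (add_one_le_exp c) (exp_pos (-c)).le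
      rwa [← exp_add, add_neg_cancel, exp_zero] at this
    linarith
  have k1 := key (div_pos pi_pos hy0)
  have k2 := key (mul_pos two_pos (div_pos pi_pos hy0))
  have e : exp (-(2 * (π / y))) = exp (-(π / y)) ^ 2 := by
    rw [← exp_nat_mul]
    push_cast
    ring_nf
  rw [e] at k2
  have hpi := pi_gt_d4
  have p1 : 1 / (π / y) ≤ 0.3184 * y := by
    rw [one_div_div, div_le_iff₀ pi_pos]
    nlinarith
  have p2 : 1 / (2 * (π / y)) = 1 / (π / y) / 2 := by field_simp
  have hr : y / 4 - 0.38494 ≤ circumradiusSq y - circumradiusSq (√3 / 2) := by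
    have h0 := circumradiusSq_hexagonal_le
    have : y / 4 ≤ circumradiusSq y := by
      have : 0 ≤ 1 / (8 * y) + 1 / (64 * y ^ 3) := by positivity
      unfold circumradiusSq
      linarith
    linarith
  have h1 := add_one_le_exp (π * (circumradiusSq y - circumradiusSq (√3 / 2)))
  have h2 : 3.1415 * (y / 4 - 0.38494) ≤
      π * (circumradiusSq y - circumradiusSq (√3 / 2)) := by gcongr; linarith
  have := tsum_shiftedTerm_one_le (y := y) (by linarith)
  linarith

theorem fTheta_lt {α y : ℝ} (hα : 1 ≤ α) (hy : √3 / 2 < y) :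
    fTheta α y < fTheta α (√3 / 2) := by
  rcases le_total y 1.15 with h | h
  · exact fTheta_lt_of_le hα hy h
  refine fTheta_lt_of_tsum_lt hα hy ?_
  have hy0 : 0 < y := by linarith
  have hpi := pi_gt_d4
  rcases le_total 3 y with h3 | h3
  · exact tsum_shiftedTerm_lt_of_three_le h3
  rcases le_total y 1.23 with h1 | h1
  · refine tsum_shiftedTerm_lt_of_mem (a := 1.15) (X := 0.0779) (ρ := 0.0676) le_rfl h
      (exp_neg_le 120 47 (by norm_num) (by norm_num) ?_ (by norm_num)) (by norm_num)
      (by norm_num) (by norm_num) (by norm_num)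
    rw [le_div_iff₀ hy0]
    push_cast
    linarith
  rcases le_total y 1.45 with h2 | h2
  · refine tsum_shiftedTerm_lt_of_mem (a := 1.23) (X := 0.115) (ρ := 0.102) (by norm_num) h1
      (exp_neg_le 106 49 (by norm_num) (by norm_num) ?_ (by norm_num)) (by norm_num)
      (by norm_num) (by norm_num) (by norm_num)
    rw [le_div_iff₀ hy0]
    push_cast
    linarith
  rcases le_total y 2 with h4 | h4
  · refine tsum_shiftedTerm_lt_of_mem (a := 1.45) (X := 0.21) (ρ := 0.21) (by norm_num) h2
      (exp_neg_le 25 16 (by norm_num) (by norm_num) ?_ (by norm_num)) (by norm_num)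
      (by norm_num) (by norm_num) (by norm_num)
    rw [le_div_iff₀ hy0]
    push_cast
    linarith
  · refine tsum_shiftedTerm_lt_of_mem (a := 2) (X := 0.36) (ρ := 0.5) (by norm_num) h4
      (exp_neg_le 31 30 (by norm_num) (by norm_num) ?_ (by norm_num)) (by norm_num)
      (by norm_num) (by norm_num) (by norm_num)
    rw [le_div_iff₀ hy0]
    push_cast
    linarith

/-- The quadratic form of the hexagonal lattice. -/
def hexForm (v : ℤ × ℤ) : ℤ := v.1 ^ 2 + v.1 * v.2 + v.2 ^ 2

/-- The rotation of order three of the hexagonal lattice. -/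
def hexRotation : ℤ × ℤ ≃ ℤ × ℤ where
  toFun v := (-v.1 - v.2, v.1)
  invFun v := (v.2, -v.1 - v.2)
  left_inv v := Prod.ext rfl (by dsimp only; ring)
  right_inv v := Prod.ext (by dsimp only; ring) rfl

theorem hexForm_rotation (v : ℤ × ℤ) : hexForm (hexRotation v) = hexForm v := by
  simp only [hexForm, hexRotation, Equiv.coe_fn_mk]; ring

theorem hexForm_nonneg (v : ℤ × ℤ) : 0 ≤ hexForm v := by
  unfold hexForm
  nlinarith [sq_nonneg (2 * v.1 + v.2), sq_nonneg v.2]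

theorem abs_add_abs_le_hexForm {v : ℤ × ℤ}
    (hv : v ∉ Finset.Icc (-4 : ℤ) 4 ×ˢ Finset.Icc (-4 : ℤ) 4) :
    |v.1| + |v.2| + 7 ≤ hexForm v := by
  have key (n : ℤ) (hn : ¬(-4 ≤ n ∧ n ≤ 4)) : 2 * |n| + 15 ≤ n ^ 2 := by
    rw [← sq_abs]
    have : 5 ≤ |n| := by
      rw [← abs_le] at hn
      omega
    nlinarith
  have h0 (n : ℤ) : 2 * |n| - 1 ≤ n ^ 2 := by
    rw [← sq_abs]
    nlinarith [sq_nonneg (|n| - 1)]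
  have h1 := h0 v.1
  have h2 := h0 v.2
  have h3 : 2 * hexForm v = v.1 ^ 2 + v.2 ^ 2 + (v.1 + v.2) ^ 2 := by unfold hexForm; ring
  have h4 := sq_nonneg (v.1 + v.2)
  rw [Finset.mem_product, Finset.mem_Icc, Finset.mem_Icc, not_and_or] at hv
  rcases hv with h | h <;> linarith [key _ h]

theorem tsum_hexForm_pow_le {x : ℝ} (h0 : 0 ≤ x) (h1 : x ≤ 0.21) :
    Summable (fun v => if 3 ≤ hexForm v then x ^ (hexForm v).toNat else 0) ∧
    ∑' v, (if 3 ≤ hexForm v then x ^ (hexForm v).toNat else 0) ≤ 7.5 * x ^ 3 := by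
  have hX : Summable (fun v => if 3 ≤ hexForm v then (0.21 : ℝ) ^ ((hexForm v).toNat - 3) else 0) ∧
      ∑' v, (if 3 ≤ hexForm v then (0.21 : ℝ) ^ ((hexForm v).toNat - 3) else 0) ≤
      ∑ v ∈ Finset.Icc (-4 : ℤ) 4 ×ˢ Finset.Icc (-4 : ℤ) 4,
        (if 3 ≤ hexForm v then (0.21 : ℝ) ^ ((hexForm v).toNat - 3) else 0) +
      0.21 ^ 4 * ((1 + 0.21) / (1 - 0.21) * ((1 + 0.21) / (1 - 0.21))) := by
    refine summable_and_tsum_le (fun v => by positivity) _ (by positivity) (by norm_num)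
      (by norm_num) fun v hv => ?_
    have h := abs_add_abs_le_hexForm hv
    rw [Int.abs_eq_natAbs, Int.abs_eq_natAbs] at h
    rw [if_pos (by omega), ← pow_add, ← pow_add]
    exact pow_le_pow_of_le_one (by norm_num) (by norm_num) (by omega)
  have hB : ∑ v ∈ Finset.Icc (-4 : ℤ) 4 ×ˢ Finset.Icc (-4 : ℤ) 4,
        (if 3 ≤ hexForm v then (0.21 : ℚ) ^ ((hexForm v).toNat - 3) else 0) ≤ 7.4 := by
    decide +kernel
  rw [← Rat.cast_le (K := ℝ)] at hB
  simp only [Rat.cast_sum, apply_ite (Rat.cast : ℚ → ℝ)] at hB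
  push_cast at hB
  have hle (v : ℤ × ℤ) : (if 3 ≤ hexForm v then x ^ (hexForm v).toNat else 0) ≤
      x ^ 3 * if 3 ≤ hexForm v then (0.21 : ℝ) ^ ((hexForm v).toNat - 3) else 0 := by
    split_ifs with h
    · calc x ^ (hexForm v).toNat = x ^ 3 * x ^ ((hexForm v).toNat - 3) := by
            rw [← pow_add]; congr 1; omega
        _ ≤ _ := by gcongr
    · simp
  have hs := Summable.of_nonneg_of_le (fun v => by positivity) hle (hX.1.mul_left (x ^ 3))
  refine ⟨hs, (hs.tsum_le_tsum hle (hX.1.mul_left (x ^ 3))).trans ?_⟩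
  rw [tsum_mul_left, mul_comm (7.5 : ℝ)]
  refine mul_le_mul_of_nonneg_left (hX.2.trans ?_) (by positivity)
  norm_num at hB ⊢
  linarith

theorem tsum_hexForm_sq_mul_pow_le {x : ℝ} (h0 : 0 ≤ x) (h1 : x ≤ 0.0433) :
    Summable (fun v => if 3 ≤ hexForm v then (hexForm v : ℝ) ^ 2 * x ^ (hexForm v).toNat else 0) ∧
    ∑' v, (if 3 ≤ hexForm v then (hexForm v : ℝ) ^ 2 * x ^ (hexForm v).toNat else 0) ≤
      58.3 * x ^ 3 := by
  have hX : Summable (fun v => if 3 ≤ hexForm v then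
        (hexForm v : ℝ) ^ 2 * (0.0433 : ℝ) ^ ((hexForm v).toNat - 3) else 0) ∧
      ∑' v, (if 3 ≤ hexForm v then
        (hexForm v : ℝ) ^ 2 * (0.0433 : ℝ) ^ ((hexForm v).toNat - 3) else 0) ≤
      ∑ v ∈ Finset.Icc (-4 : ℤ) 4 ×ˢ Finset.Icc (-4 : ℤ) 4, (if 3 ≤ hexForm v then
        (hexForm v : ℝ) ^ 2 * (0.0433 : ℝ) ^ ((hexForm v).toNat - 3) else 0) +
      8 * 0.0866 ^ 4 * ((1 + 0.0866) / (1 - 0.0866) * ((1 + 0.0866) / (1 - 0.0866))) := by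
    refine summable_and_tsum_le (fun v => by positivity) _ (by positivity) (by norm_num)
      (by norm_num) fun v hv => ?_
    have h := abs_add_abs_le_hexForm hv
    rw [Int.abs_eq_natAbs, Int.abs_eq_natAbs] at h
    obtain ⟨n, hn⟩ := Int.eq_ofNat_of_zero_le (hexForm_nonneg v)
    rw [if_pos (by omega), hn, Int.toNat_natCast, Int.cast_natCast]
    have h2 : (n : ℝ) ^ 2 ≤ 2 ^ n := by
      exact_mod_cast sq_le_two_pow (n := n) (by omega)
    calc (n : ℝ) ^ 2 * 0.0433 ^ (n - 3) ≤ 2 ^ n * 0.0433 ^ (n - 3) := by gcongr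
      _ = 8 * 0.0866 ^ (n - 3) := by
        rw [show (2 : ℝ) ^ n = 8 * 2 ^ (n - 3) by
          rw [show (8 : ℝ) = 2 ^ 3 by norm_num, ← pow_add]; congr 1; omega, mul_assoc, ← mul_pow]
        norm_num
      _ ≤ 8 * 0.0866 ^ (4 + (v.1.natAbs + v.2.natAbs)) := by
        gcongr ?_ * ?_
        exact pow_le_pow_of_le_one (by norm_num) (by norm_num) (by omega)
      _ = _ := by rw [pow_add, pow_add]; ring
  have hB : ∑ v ∈ Finset.Icc (-4 : ℤ) 4 ×ˢ Finset.Icc (-4 : ℤ) 4, (if 3 ≤ hexForm v then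
        (hexForm v : ℚ) ^ 2 * (0.0433 : ℚ) ^ ((hexForm v).toNat - 3) else 0) ≤ 58.2 := by
    decide +kernel
  rw [← Rat.cast_le (K := ℝ)] at hB
  simp only [Rat.cast_sum, apply_ite (Rat.cast : ℚ → ℝ)] at hB
  push_cast at hB
  have hle (v : ℤ × ℤ) :
      (if 3 ≤ hexForm v then (hexForm v : ℝ) ^ 2 * x ^ (hexForm v).toNat else 0) ≤
      x ^ 3 * if 3 ≤ hexForm v then
        (hexForm v : ℝ) ^ 2 * (0.0433 : ℝ) ^ ((hexForm v).toNat - 3) else 0 := by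
    split_ifs with h
    · calc (hexForm v : ℝ) ^ 2 * x ^ (hexForm v).toNat =
            x ^ 3 * ((hexForm v : ℝ) ^ 2 * x ^ ((hexForm v).toNat - 3)) := by
            rw [mul_left_comm, ← pow_add]; congr 2; omega
        _ ≤ _ := by gcongr
    · simp
  have hs := Summable.of_nonneg_of_le (fun v => by positivity) hle (hX.1.mul_left (x ^ 3))
  refine ⟨hs, (hs.tsum_le_tsum hle (hX.1.mul_left (x ^ 3))).trans ?_⟩
  rw [tsum_mul_left, mul_comm (58.3 : ℝ)]
  refine mul_le_mul_of_nonneg_left (hX.2.trans ?_) (by positivity)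
  norm_num at hB ⊢
  linarith

/-- The general term of the series defining `gTheta`. -/
noncomputable def chargedTerm (β y : ℝ) (v : ℤ × ℤ) : ℝ :=
  exp (-(π * β / y) * ((v.1 : ℝ) ^ 2 + (v.1 : ℝ) * (v.2 : ℝ) + (1 / 4 + y ^ 2) * (v.2 : ℝ) ^ 2)) *
    cos (2 * π * ((v.1 : ℝ) * a2 y - (v.2 : ℝ) * a1 y))

/-- The contribution, with opposite sign, of the six shortest nonzero vectors to `gTheta`. -/
noncomputable def chargedShell (β y : ℝ) : ℝ :=
  2 * exp (-(π * β / y)) * cos (2 * (π / (8 * y ^ 2))) +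
    4 * exp (-(π * β * (y + 1 / (4 * y)))) * sin (π / (8 * y ^ 2))

/-- The contribution of the remaining long vectors to `gTheta`. -/
noncomputable def chargedTail (β y : ℝ) : ℝ :=
  ∑' v, if 3 ≤ hexForm v then chargedTerm β y v else 0

theorem summable_chargedTerm {β y : ℝ} (hβ : 0 < β) (hy : √3 / 2 ≤ y) :
    Summable (chargedTerm β y) := by
  have hy0 : 0 < y := lt_of_lt_of_le (by positivity) hy
  have h := summable_exp_neg_quadratic (c := π * β / y) (by positivity) hy 0 0
  simp only [← neg_mul, add_zero] at h
  refine Summable.of_norm_bounded h fun p => ?_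
  rw [chargedTerm, norm_mul, norm_of_nonneg (exp_pos _).le]
  exact mul_le_of_le_one_right (exp_pos _).le (abs_cos_le_one _)

theorem mem_of_hexForm_lt_three {v : ℤ × ℤ} (h : hexForm v < 3) :
    v ∈ ({(0, 0), (1, 0), (-1, 0), (0, 1), (0, -1), (1, -1), (-1, 1)} : Finset (ℤ × ℤ)) := by
  obtain ⟨k, l⟩ := v
  simp only [hexForm] at h
  have h1 : k ≤ 1 := by nlinarith [sq_nonneg (2 * l + k)]
  have h2 : -1 ≤ k := by nlinarith [sq_nonneg (2 * l + k)]
  have h3 : l ≤ 1 := by nlinarith [sq_nonneg (2 * k + l)]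
  have h4 : -1 ≤ l := by nlinarith [sq_nonneg (2 * k + l)]
  interval_cases k <;> interval_cases l <;> simp at h ⊢

theorem hexForm_lt_three {v : ℤ × ℤ}
    (h : v ∈ ({(0, 0), (1, 0), (-1, 0), (0, 1), (0, -1), (1, -1), (-1, 1)} : Finset (ℤ × ℤ))) :
    ¬ 3 ≤ hexForm v := by
  revert v; decide

theorem chargedTerm_short_sum (β : ℝ) {y : ℝ} (hy : 0 < y) :
    ∑ v ∈ ({(0, 0), (1, 0), (-1, 0), (0, 1), (0, -1), (1, -1), (-1, 1)} : Finset (ℤ × ℤ)),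
      chargedTerm β y v = 1 - chargedShell β y := by
  have c1 : cos (2 * π * a2 y) = -cos (2 * (π / (8 * y ^ 2))) := by
    rw [← cos_pi_sub]; congr 1; unfold a2; ring
  have c2 : cos (2 * π * a1 y) = -sin (π / (8 * y ^ 2)) := by
    rw [← cos_add_pi_div_two, a1_eq]; congr 1; unfold a2; ring
  have c3 : cos (2 * π * (a2 y + a1 y)) = -sin (π / (8 * y ^ 2)) := by
    rw [← cos_pi_div_two_sub, ← cos_add_pi, a1_eq]; congr 1; unfold a2; ring
  have e : π * β * (y + 1 / (4 * y)) = π * β / y * (1 / 4 + y ^ 2) := by field_simp; ring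
  have h (t c u C : ℝ) (ht : t = u) (hc : cos c = C) : exp t * cos c = exp u * C := by rw [ht, hc]
  have h0 : chargedTerm β y (0, 0) = 1 := by simp [chargedTerm]
  have h1 : chargedTerm β y (1, 0) = exp (-(π * β / y)) * -cos (2 * (π / (8 * y ^ 2))) :=
    h _ _ _ _ (by simp) (by rw [← c1]; congr 1; simp)
  have h2 : chargedTerm β y (-1, 0) = exp (-(π * β / y)) * -cos (2 * (π / (8 * y ^ 2))) :=
    h _ _ _ _ (by simp) (by rw [← c1, ← cos_neg]; congr 1; simp)
  have h3 : chargedTerm β y (0, 1) =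
      exp (-(π * β * (y + 1 / (4 * y)))) * -sin (π / (8 * y ^ 2)) :=
    h _ _ _ _ (by rw [e]; simp) (by rw [← c2, ← cos_neg]; congr 1; simp)
  have h4 : chargedTerm β y (0, -1) =
      exp (-(π * β * (y + 1 / (4 * y)))) * -sin (π / (8 * y ^ 2)) :=
    h _ _ _ _ (by rw [e]; simp) (by rw [← c2]; congr 1; simp)
  have h5 : chargedTerm β y (1, -1) =
      exp (-(π * β * (y + 1 / (4 * y)))) * -sin (π / (8 * y ^ 2)) :=
    h _ _ _ _ (by rw [e]; push_cast; ring) (by rw [← c3]; congr 1; push_cast; ring)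
  have h6 : chargedTerm β y (-1, 1) =
      exp (-(π * β * (y + 1 / (4 * y)))) * -sin (π / (8 * y ^ 2)) :=
    h _ _ _ _ (by rw [e]; push_cast; ring) (by rw [← c3, ← cos_neg]; congr 1; push_cast; ring)
  repeat rw [Finset.sum_insert (by decide)]
  rw [Finset.sum_singleton, h0, h1, h2, h3, h4, h5, h6, chargedShell]
  ring

theorem summable_chargedTail {β y : ℝ} (hβ : 0 < β) (hy : √3 / 2 ≤ y) :
    Summable fun v => if 3 ≤ hexForm v then chargedTerm β y v else 0 := by
  refine Summable.of_norm_bounded (summable_chargedTerm hβ hy).norm fun v => ?_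
  split_ifs
  · rfl
  · simp

theorem gTheta_eq_shell {β y : ℝ} (hβ : 0 < β) (hy : √3 / 2 ≤ y) :
    gTheta β y = 1 - chargedShell β y + chargedTail β y := by
  have hy0 : 0 < y := lt_of_lt_of_le (by positivity) hy
  have h : ∑' v, (chargedTerm β y v - if 3 ≤ hexForm v then chargedTerm β y v else 0) =
      1 - chargedShell β y := by
    rw [tsum_eq_sum fun v hv => ?_, ← chargedTerm_short_sum β hy0]
    · refine Finset.sum_congr rfl fun v hv => ?_
      rw [if_neg (hexForm_lt_three hv), sub_zero]
    · rw [if_pos (not_lt.1 fun h => hv (mem_of_hexForm_lt_three h)), sub_self]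
  rw [(summable_chargedTerm hβ hy).tsum_sub (summable_chargedTail hβ hy)] at h
  rw [← h, chargedTail, sub_add_cancel]
  rfl

theorem abs_chargedTerm_le {β y : ℝ} (hβ : 0 < β) (hy : √3 / 2 ≤ y) (v : ℤ × ℤ) :
    |chargedTerm β y v| ≤ exp (-(π * β / y)) ^ (hexForm v).toNat := by
  have hy0 : 0 < y := lt_of_lt_of_le (by positivity) hy
  refine le_trans ?_ (exp_natCast_mul_le le_rfl (hexForm_nonneg v))
  rw [chargedTerm, abs_mul, abs_of_pos (exp_pos _)]
  refine (mul_le_of_le_one_right (exp_pos _).le (abs_cos_le_one _)).trans ?_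
  rw [exp_le_exp, neg_mul, neg_le_neg_iff]
  refine mul_le_mul_of_nonneg_left ?_ (by positivity)
  have h1 : 3 / 4 ≤ y ^ 2 := by
    obtain ⟨-, -, h⟩ := sqrt_three_div_two_bounds
    rw [← h]
    gcongr
  have := mul_nonneg (sub_nonneg.2 h1) (sq_nonneg (v.2 : ℝ))
  unfold hexForm
  push_cast
  linarith

theorem abs_chargedTail_le {β y : ℝ} (hβ : 0 < β) (hy : √3 / 2 ≤ y)
    (h : exp (-(π * β / y)) ≤ 0.21) :
    |chargedTail β y| ≤ 7.5 * exp (-(π * β / y)) ^ 3 := by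
  obtain ⟨h1, h2⟩ := tsum_hexForm_pow_le (exp_pos _).le h
  refine le_trans ?_ h2
  rw [← norm_eq_abs]
  refine tsum_of_norm_bounded h1.hasSum fun v => ?_
  split_ifs
  · exact abs_chargedTerm_le hβ hy v
  · simp

theorem chargedShell_hexagonal (β : ℝ) :
    chargedShell β (√3 / 2) = 3 * exp (-(π * β / (√3 / 2))) := by
  obtain ⟨h, -, hsq⟩ := sqrt_three_div_two_bounds
  generalize √3 / 2 = y at *
  have hy : 0 < y := by linarith
  have e : π * β * (y + 1 / (4 * y)) = π * β / y := by
    field_simp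
    rw [hsq]
    norm_num
  rw [chargedShell, e, hsq, show π / (8 * (3 / 4)) = π / 6 by ring,
    show 2 * (π / 6) = π / 3 by ring, cos_pi_div_three, sin_pi_div_six]
  ring

theorem exp_hexagonal_le {β : ℝ} (hβ : 1 ≤ β) : exp (-(π * β / (√3 / 2))) ≤ 0.0266 := by
  obtain ⟨h, h', -⟩ := sqrt_three_div_two_bounds
  generalize √3 / 2 = y at *
  refine exp_neg_le 243 67 (by norm_num) (by norm_num) ?_ (by norm_num)
  rw [le_div_iff₀ (by linarith)]
  have := pi_gt_d6
  push_cast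
  nlinarith

theorem one_sub_le_gTheta_hexagonal {β : ℝ} (hβ : 1 ≤ β) :
    1 - 3.006 * exp (-(π * β / (√3 / 2))) ≤ gTheta β (√3 / 2) := by
  have hp := exp_hexagonal_le hβ
  have h := abs_chargedTail_le (by linarith) le_rfl (hp.trans (by norm_num))
  rw [gTheta_eq_shell (by linarith) le_rfl, chargedShell_hexagonal]
  have h0 := exp_pos (-(π * β / (√3 / 2)))
  generalize exp (-(π * β / (√3 / 2))) = p at *
  have := neg_le_of_abs_le h
  have h2 : p ^ 3 ≤ p * 0.0266 ^ 2 := by rw [pow_succ']; gcongr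
  linarith

theorem hasDerivAt_chargedShell (β : ℝ) {y : ℝ} (hy : 0 < y) :
    HasDerivAt (chargedShell β) (2 * exp (-(π * β / y)) *
      (π * β / y ^ 2 * (1 - 2 * sin (π / (8 * y ^ 2)) ^ 2 - exp (-(π * β * ((4 * y ^ 2 - 3) / (4 * y)))) *
        sin (π / (8 * y ^ 2)) * (4 * y ^ 2 - 1) / 2) +
      π / (2 * y ^ 3) * cos (π / (8 * y ^ 2)) * (2 * sin (π / (8 * y ^ 2)) -
        exp (-(π * β * ((4 * y ^ 2 - 3) / (4 * y))))))) y := by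
  have hφ : HasDerivAt (fun y : ℝ => π / (8 * y ^ 2)) (-(π / (4 * y ^ 3))) y := by
    refine ((hasDerivAt_const y π).div ((hasDerivAt_pow 2 y).const_mul 8)
      (by positivity)).congr_deriv ?_
    field_simp
    ring
  have hx : HasDerivAt (fun y : ℝ => -(π * β / y)) (π * β / y ^ 2) y := by
    refine ((hasDerivAt_const y (π * β)).div (hasDerivAt_id y) hy.ne').neg.congr_deriv ?_
    simp only [id]
    field_simp
    ring
  have hr : HasDerivAt (fun y : ℝ => -(π * β * (y + 1 / (4 * y))))
      (-(π * β * (1 - 1 / (4 * y ^ 2)))) y := by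
    refine (((hasDerivAt_id y).add ((hasDerivAt_const y (1 : ℝ)).div
      ((hasDerivAt_id y).const_mul 4) (by simpa using hy.ne'))).const_mul (π * β)).neg.congr_deriv ?_
    simp only [id]
    field_simp
    ring
  have e : exp (-(π * β * (y + 1 / (4 * y)))) =
      exp (-(π * β / y)) * exp (-(π * β * ((4 * y ^ 2 - 3) / (4 * y)))) := by
    rw [← exp_add]
    congr 1
    field_simp
    ring
  refine (((hx.exp.const_mul 2).mul (hφ.const_mul 2).cos).add
    ((hr.exp.const_mul 4).mul hφ.sin)).congr_deriv ?_
  rw [e, sin_two_mul, cos_two_mul', cos_sq']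
  field_simp
  ring

theorem sin_bounds {y : ℝ} (h₀ : √3 / 2 ≤ y) (h₁ : y ≤ 1.1) :
    sin (π / (8 * y ^ 2)) ≤ 1 / 2 - 0.0936 * (4 * y ^ 2 - 3) ∧
    1 - 0.3024 * (4 * y ^ 2 - 3) - 0.0153 * (4 * y ^ 2 - 3) ^ 2 ≤ 2 * sin (π / (8 * y ^ 2)) := by
  obtain ⟨hr, hr', hsq⟩ := sqrt_three_div_two_bounds
  have hw0 : 0 ≤ 4 * y ^ 2 - 3 := by nlinarith
  have hw1 : 4 * y ^ 2 - 3 ≤ 1.84 := by nlinarith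
  have e : π / (8 * y ^ 2) = π / 6 - π * (4 * y ^ 2 - 3) / (6 * (4 * y ^ 2 - 3 + 3)) := by
    have : y ≠ 0 := by linarith
    field_simp
    ring
  rw [e]
  generalize 4 * y ^ 2 - 3 = w at *
  have hπ := pi_gt_d6
  have hπ' := pi_lt_d6
  have t1 : π * w / (6 * (w + 3)) ≤ 0.17454 * w := by
    rw [div_le_iff₀ (by linarith)]
    nlinarith [mul_nonneg hw0 (sub_nonneg.2 hπ'.le), mul_nonneg hw0 hw0]
  have t2 : 0.10818 * w ≤ π * w / (6 * (w + 3)) := by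
    rw [le_div_iff₀ (by linarith)]
    nlinarith [mul_nonneg hw0 (sub_nonneg.2 hπ.le), mul_nonneg hw0 (sub_nonneg.2 hw1)]
  have t3 : π * w / (6 * (w + 3)) ≤ 1 := by linarith
  have t0 : 0 ≤ π * w / (6 * (w + 3)) := by positivity
  generalize π * w / (6 * (w + 3)) = t at *
  rw [sin_sub, sin_pi_div_six, cos_pi_div_six]
  have hc := cos_bound (x := t) (by rwa [abs_of_nonneg t0])
  rw [abs_of_nonneg t0] at hc
  have hc1 := (abs_le.1 hc).2
  have hc2 := one_sub_sq_div_two_le_cos (x := t)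
  have hs1 := sin_le t0
  have hs2 : t - t ^ 3 / 4 ≤ sin t := by
    rcases t0.eq_or_lt with h | h
    · simp [← h]
    · linarith [sin_gt_sub_cube h, pow_pos h 3]
  have hs0 : 0 ≤ sin t := sin_nonneg_of_nonneg_of_le_pi t0 (by linarith)
  generalize √3 / 2 = r at *
  have p3 : t ^ 3 ≤ t ^ 2 := pow_le_pow_of_le_one t0 t3 (by norm_num)
  have p4 : t ^ 4 ≤ t ^ 2 := pow_le_pow_of_le_one t0 t3 (by norm_num)
  have q2 : t ^ 2 ≤ (0.17454 * w) ^ 2 := by gcongr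
  constructor
  · have : 0.866 * (t - t ^ 3 / 4) ≤ r * sin t := by
      calc 0.866 * (t - t ^ 3 / 4) ≤ 0.866 * sin t := by gcongr
        _ ≤ _ := by gcongr
    linarith
  · have : r * sin t ≤ 0.8661 * t := by gcongr
    linarith

theorem div_four_le_of_sin_le {w s ρ : ℝ} (hw0 : 0 ≤ w) (hw1 : w ≤ 1.84) (hs : 0 ≤ s)
    (s1 : s ≤ 1 / 2 - 0.0936 * w) (hρ0 : 0 ≤ ρ)
    (hρ : ρ * (1 + 0.7139 * w + 0.2548 * w ^ 2) ≤ 1) :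
    w / 4 ≤ 1 - 2 * s ^ 2 - ρ * s * (w + 2) / 2 := by
  have n1 : s ^ 2 ≤ (1 / 2 - 0.0936 * w) ^ 2 := by gcongr
  have n2 : s * (w + 2) ≤ (1 / 2 - 0.0936 * w) * (w + 2) := by gcongr
  have n3 : (1 / 2 - 0.0936 * w) * (w + 2) / 2 ≤
      (1 + 0.7139 * w + 0.2548 * w ^ 2) * (1 / 2 - 0.0628 * w - 0.01753 * w ^ 2) := by
    have : 0 ≤ w * (0.29 - 0.04 * w ^ 2 - 0.005 * w ^ 3) := by
      refine mul_nonneg hw0 ?_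
      have : w ^ 2 ≤ 1.84 ^ 2 := by gcongr
      have : w ^ 3 ≤ 1.84 ^ 3 := by gcongr
      linarith
    nlinarith [pow_nonneg hw0 2, pow_nonneg hw0 3, pow_nonneg hw0 4]
  have n4 : 0 ≤ 1 / 2 - 0.0628 * w - 0.01753 * w ^ 2 := by nlinarith
  have n5 : ρ * (s * (w + 2) / 2) ≤ 1 / 2 - 0.0628 * w - 0.01753 * w ^ 2 := by
    calc ρ * (s * (w + 2) / 2) ≤ ρ * ((1 + 0.7139 * w + 0.2548 * w ^ 2) *
          (1 / 2 - 0.0628 * w - 0.01753 * w ^ 2)) := by gcongr; linarith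
      _ = ρ * (1 + 0.7139 * w + 0.2548 * w ^ 2) *
          (1 / 2 - 0.0628 * w - 0.01753 * w ^ 2) := by ring
      _ ≤ _ := mul_le_of_le_one_left n4 hρ
  nlinarith

theorem le_of_mul_le_one {w ρ : ℝ} (hw0 : 0 ≤ w) (hw1 : w ≤ 1.84) (hρ0 : 0 ≤ ρ)
    (hρ : ρ * (1 + 0.7139 * w + 0.2548 * w ^ 2) ≤ 1) :
    ρ ≤ 1 - 0.3024 * w - 0.0153 * w ^ 2 := by
  have n1 : 1 ≤ (1 + 0.7139 * w + 0.2548 * w ^ 2) * (1 - 0.3024 * w - 0.0153 * w ^ 2) := by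
    have : 0 ≤ w * (0.41 - 0.089 * w ^ 2 - 0.004 * w ^ 3) := by
      refine mul_nonneg hw0 ?_
      have : w ^ 2 ≤ 1.84 ^ 2 := by gcongr
      have : w ^ 3 ≤ 1.84 ^ 3 := by gcongr
      linarith
    nlinarith [pow_nonneg hw0 2, pow_nonneg hw0 3, pow_nonneg hw0 4]
  have n2 : 0 ≤ 1 - 0.3024 * w - 0.0153 * w ^ 2 := by nlinarith
  calc ρ = ρ * 1 := (mul_one ρ).symm
    _ ≤ ρ * ((1 + 0.7139 * w + 0.2548 * w ^ 2) * (1 - 0.3024 * w - 0.0153 * w ^ 2)) := by gcongr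
    _ = ρ * (1 + 0.7139 * w + 0.2548 * w ^ 2) * (1 - 0.3024 * w - 0.0153 * w ^ 2) := by ring
    _ ≤ _ := mul_le_of_le_one_left n2 hρ

/-- The shortest vectors favour the hexagonal lattice with a quadratic margin. -/
theorem chargedShell_ge {β y : ℝ} (hβ : 1 ≤ β) (h₀ : √3 / 2 ≤ y) (h₁ : y ≤ 1.1) :
    exp (-(π * β / (√3 / 2))) * (3 + 5 * β * (y - √3 / 2) ^ 2) ≤ chargedShell β y := by
  have key : MonotoneOn (fun y => chargedShell β y -
      exp (-(π * β / (√3 / 2))) * (5 * β * (y - √3 / 2) ^ 2)) (Set.Icc (√3 / 2) 1.1) := by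
    obtain ⟨hr, hr', hsq⟩ := sqrt_three_div_two_bounds
    have hd (x : ℝ) (hx : √3 / 2 ≤ x) := (hasDerivAt_chargedShell β (y := x) (by linarith)).sub
      ((((((hasDerivAt_id x).sub_const (√3 / 2)).pow 2).const_mul (5 * β)).const_mul
        (exp (-(π * β / (√3 / 2))))))
    refine monotoneOn_of_deriv_nonneg (convex_Icc _ _)
      (fun x hx => (hd x hx.1).continuousAt.continuousWithinAt)
      (fun x hx => ((hd x (interior_subset hx).1).differentiableAt).differentiableWithinAt)
      fun x hx => ?_
    obtain ⟨hx0, hx1⟩ := interior_subset hx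
    refine le_of_le_of_eq ?_ (hd x hx0).deriv.symm
    simp only [id, Nat.cast_ofNat, pow_one, mul_one, Nat.add_one_sub_one]
    obtain ⟨s1, s2⟩ := sin_bounds hx0 hx1
    have hπ := pi_gt_d6
    have hπ' := pi_lt_d6
    have hw0 : 0 ≤ 4 * x ^ 2 - 3 := by nlinarith
    have hw1 : 4 * x ^ 2 - 3 ≤ 1.84 := by nlinarith
    have hφ : π / (8 * x ^ 2) ≤ π / 6 := by gcongr; linarith
    have hφ0 : 0 ≤ π / (8 * x ^ 2) := by positivity
    have hc : 0 ≤ cos (π / (8 * x ^ 2)) := cos_nonneg_of_mem_Icc ⟨by linarith, by linarith⟩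
    have hs : 0 ≤ sin (π / (8 * x ^ 2)) := sin_nonneg_of_nonneg_of_le_pi hφ0 (by linarith)
    have hP : exp (-(π * β / (√3 / 2))) ≤ exp (-(π * β / x)) := by
      rw [exp_le_exp, neg_le_neg_iff]; gcongr
    have hρ : exp (-(π * β * ((4 * x ^ 2 - 3) / (4 * x)))) *
        (1 + 0.7139 * (4 * x ^ 2 - 3) + 0.2548 * (4 * x ^ 2 - 3) ^ 2) ≤ 1 := by
      have hu : 0.7139 * (4 * x ^ 2 - 3) ≤ π * β * ((4 * x ^ 2 - 3) / (4 * x)) := by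
        rw [← mul_div_assoc, le_div_iff₀ (by linarith)]
        have : 0.7139 * (4 * x) ≤ π * β := by nlinarith
        nlinarith
      rw [exp_neg, inv_mul_le_iff₀ (exp_pos _), mul_one]
      refine le_trans ?_ (exp_le_exp.2 hu)
      have := quadratic_le_exp_of_nonneg (x := 0.7139 * (4 * x ^ 2 - 3)) (by positivity)
      nlinarith [sq_nonneg (4 * x ^ 2 - 3)]
    have hρ0 := exp_pos (-(π * β * ((4 * x ^ 2 - 3) / (4 * x))))
    generalize exp (-(π * β * ((4 * x ^ 2 - 3) / (4 * x)))) = ρ at *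
    generalize sin (π / (8 * x ^ 2)) = s at *
    generalize cos (π / (8 * x ^ 2)) = c at *
    have hp := exp_pos (-(π * β / (√3 / 2)))
    generalize exp (-(π * β / (√3 / 2))) = p at *
    generalize exp (-(π * β / x)) = P at *
    have B1 : (4 * x ^ 2 - 3) / 4 ≤ 1 - 2 * s ^ 2 - ρ * s * (4 * x ^ 2 - 1) / 2 := by
      have := div_four_le_of_sin_le hw0 hw1 hs s1 hρ0.le hρ
      linarith
    have B2 : ρ ≤ 2 * s := (le_of_mul_le_one hw0 hw1 hρ0.le hρ).trans s2
    have B3 : 1.62 * (x - √3 / 2) ≤ 1 / x ^ 2 * ((4 * x ^ 2 - 3) / 4) := by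
      have hx00 : 0 < x := by linarith
      rw [one_div_mul_eq_div, le_div_iff₀ (by positivity)]
      have e : (4 * x ^ 2 - 3) / 4 = (x - √3 / 2) * (x + √3 / 2) := by linarith
      rw [e, mul_assoc, mul_left_comm]
      refine mul_le_mul_of_nonneg_left ?_ (by linarith)
      nlinarith
    have B4 : 0 ≤ π / (2 * x ^ 3) * c * (2 * s - ρ) :=
      have hx00 : 0 < x := by linarith
      mul_nonneg (mul_nonneg (by positivity) hc) (by linarith)
    have B5 : 5 * β * (x - √3 / 2) ≤ π * β / x ^ 2 *
        (1 - 2 * s ^ 2 - ρ * s * (4 * x ^ 2 - 1) / 2) := by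
      calc 5 * β * (x - √3 / 2) ≤ π * β * (1.62 * (x - √3 / 2)) := by
            have := mul_nonneg (sub_nonneg.2 hx0) (by linarith : 0 ≤ β)
            nlinarith
        _ ≤ π * β * (1 / x ^ 2 * ((4 * x ^ 2 - 3) / 4)) := by gcongr
        _ = π * β / x ^ 2 * ((4 * x ^ 2 - 3) / 4) := by ring
        _ ≤ _ := by gcongr
    have B6 : 0 ≤ 5 * β * (x - √3 / 2) := mul_nonneg (by linarith) (by linarith)
    have B7 : p * (5 * β * (x - √3 / 2)) ≤ P * (π * β / x ^ 2 *
        (1 - 2 * s ^ 2 - ρ * s * (4 * x ^ 2 - 1) / 2) + π / (2 * x ^ 3) * c * (2 * s - ρ)) := by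
      refine mul_le_mul hP (by linarith) B6 (by linarith)
    linarith
  obtain ⟨hr, hr', hsq⟩ := sqrt_three_div_two_bounds
  have := key ⟨le_rfl, by linarith⟩ ⟨h₀, h₁⟩ h₀
  simp only [chargedShell_hexagonal, sub_self] at this
  linarith

theorem abs_sub_sin_le (t : ℝ) : |t - sin t| ≤ t ^ 2 := by
  wlog h : 0 < t generalizing t
  · rcases (not_lt.1 h).eq_or_lt with rfl | h
    · simp
    · have := this (-t) (by linarith)
      rwa [sin_neg, neg_sq, ← neg_add', abs_neg, ← sub_eq_add_neg] at this
  rw [abs_of_nonneg (sub_nonneg.2 (sin_le h.le))]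
  rcases le_total t 6 with h6 | h6
  · have := sin_gt_sub_cube h
    nlinarith [mul_nonneg (sq_nonneg t) (sub_nonneg.2 h6)]
  · nlinarith [neg_one_le_sin t]

theorem exp_neg_mul_cos_sub_le {E X X₁ X₂ M : ℝ} (θ Y : ℝ) (hX : X = X₁ + X₂) (hX₂ : 0 ≤ X₂)
    (hE : exp (-E) ≤ M) (hEX : exp (-(E + X)) ≤ M) :
    exp (-(E + X)) * cos (θ + Y) - exp (-E) * cos θ ≤
      exp (-E) * (-X₁ * cos θ - Y * sin θ) + M * (X ^ 2 + 2 * Y ^ 2 + X₂) := by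
  have h1 : exp (-E) * ((exp (-X) - 1 + X) * cos (θ + Y)) ≤ M * (X ^ 2 / 2) := by
    have h0 := exp_neg_sub_nonneg X
    calc exp (-E) * ((exp (-X) - 1 + X) * cos (θ + Y)) ≤ exp (-E) * (exp (-X) - 1 + X) := by
          gcongr
          exact mul_le_of_le_one_right h0 (cos_le_one _)
      _ ≤ exp (-E) * (X ^ 2 / 2 * max 1 (exp (-X))) := by gcongr; exact exp_neg_sub_le X
      _ = max (exp (-E)) (exp (-(E + X))) * (X ^ 2 / 2) := by
          have := mul_max_of_nonneg 1 (exp (-X)) (exp_pos (-E)).le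
          rw [neg_add, exp_add, mul_left_comm, this, mul_one, mul_comm]
      _ ≤ _ := by gcongr; exact max_le hE hEX
  have h2 : cos (θ + Y) - cos θ + Y * sin θ ≤ 3 / 2 * Y ^ 2 := by
    have a1 := one_sub_sq_div_two_le_cos (x := Y)
    have a2 := abs_sub_sin_le Y
    have a3 : cos θ * (cos Y - 1) ≤ Y ^ 2 / 2 := by
      nlinarith [cos_le_one Y, neg_one_le_cos θ]
    have a4 : sin θ * (Y - sin Y) ≤ Y ^ 2 := by
      refine (le_abs_self _).trans ?_
      rw [abs_mul]
      exact (mul_le_of_le_one_left (abs_nonneg _) (abs_sin_le_one _)).trans a2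
    rw [cos_add]
    linarith
  have h3 : -X * (cos (θ + Y) - cos θ) ≤ X ^ 2 / 2 + Y ^ 2 / 2 := by
    have : |cos (θ + Y) - cos θ| ≤ |Y| := by
      simpa using abs_cos_sub_cos_le (θ + Y) θ
    have h4 : -X * (cos (θ + Y) - cos θ) ≤ |X| * |Y| := by
      refine (le_abs_self _).trans ?_
      rw [abs_mul, abs_neg]
      gcongr
    nlinarith [sq_nonneg (|X| - |Y|), sq_abs X, sq_abs Y]
  have h4 : -X₂ * cos θ ≤ X₂ := by nlinarith [neg_one_le_cos θ]
  have h5 : exp (-E) * ((1 - X) * cos (θ + Y) - cos θ + X₁ * cos θ + Y * sin θ) ≤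
      M * (X ^ 2 / 2 + 2 * Y ^ 2 + X₂) := by
    calc _ ≤ exp (-E) * (X ^ 2 / 2 + 2 * Y ^ 2 + X₂) := by
          refine mul_le_mul_of_nonneg_left ?_ (exp_pos _).le
          rw [hX] at h3 ⊢
          linarith
      _ ≤ _ := by gcongr
  have h6 : exp (-(E + X)) = exp (-E) * exp (-X) := by rw [← exp_add, neg_add]
  rw [h6]
  linarith

/-- The first order term in the expansion of `chargedTerm` about the hexagonal point. -/
noncomputable def chargedLinear (c₁ c₂ x : ℝ) (v : ℤ × ℤ) : ℝ :=
  x ^ (hexForm v).toNat * (c₁ * (3 * v.2 ^ 2 - 2 * hexForm v : ℤ) * cos (2 * π * (v.1 - v.2) / 3) +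
    c₂ * (2 * v.1 + v.2 : ℤ) * sin (2 * π * (v.1 - v.2) / 3))

set_option maxHeartbeats 400000 in
theorem chargedTerm_sub_le {β y : ℝ} (hβ : 1 ≤ β) (hy : √3 / 2 ≤ y) {v : ℤ × ℤ}
    (hv : 3 ≤ hexForm v) : chargedTerm β y v - chargedTerm β (√3 / 2) v ≤
      chargedLinear (-(π * β * (y - √3 / 2) / (2 * y * (√3 / 2))))
        (-(π * (y ^ 2 - 3 / 4) / (6 * y ^ 2))) (exp (-(π * β / (√3 / 2)))) v +
      2.34 * π ^ 2 * β ^ 2 * (y - √3 / 2) ^ 2 *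
        ((hexForm v : ℝ) ^ 2 * exp (-(π * β / y)) ^ (hexForm v).toNat) := by
  obtain ⟨hr, hr', hsq⟩ := sqrt_three_div_two_bounds
  have hM := exp_natCast_mul_le (le_refl (exp (-(π * β / y)))) (q := hexForm v) (by omega)
  have hp : exp (-(π * β / (√3 / 2))) ^ (hexForm v).toNat =
      exp (-(π * β / (√3 / 2) * hexForm v)) := by
    rw [← exp_nat_mul, mul_neg, mul_comm]
    congr 3
    exact_mod_cast Int.toNat_of_nonneg (by omega : 0 ≤ hexForm v)
  have hq : (3 : ℝ) ≤ hexForm v := by exact_mod_cast hv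
  rw [chargedLinear, hp]
  generalize exp (-(π * β / y)) ^ (hexForm v).toNat = M at *
  have hf : (hexForm v : ℝ) = v.1 ^ 2 + v.1 * v.2 + v.2 ^ 2 := by unfold hexForm; push_cast; ring
  unfold chargedTerm
  push_cast
  generalize (hexForm v : ℝ) = q at *
  generalize (v.1 : ℝ) = k at *
  generalize (v.2 : ℝ) = l at *
  generalize √3 / 2 = r at *
  have hr0 : 0 < r := by linarith
  have hy0 : 0 < y := by linarith
  have hl : 3 * l ^ 2 ≤ 4 * q := by nlinarith [sq_nonneg (2 * k + l)]
  have hk : (2 * k + l) ^ 2 ≤ 4 * q := by nlinarith [sq_nonneg l]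
  have hE : exp (-(π * β / r * q)) ≤ M := by
    refine le_trans ?_ hM
    rw [exp_le_exp, neg_le_neg_iff]
    gcongr
  have hδ : 0 ≤ y - r := by linarith
  have hz : y ^ 2 - 3 / 4 = (y - r) * (y + r) := by rw [← hsq]; ring
  have hq0 : 0 ≤ q := by linarith
  have hqδ : 0 ≤ q * (y - r) := mul_nonneg hq0 hδ
  obtain ⟨D, hD⟩ : ∃ D, D = (l ^ 2 * (y ^ 2 - r ^ 2) - 4 / 3 * r * q * (y - r)) / y := ⟨_, rfl⟩
  have hD1 : |D| ≤ 4 / 3 * (q * (y - r)) := by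
    have h1 := mul_le_mul_of_nonneg_right hl (mul_nonneg hδ (by linarith : 0 ≤ y + r))
    have h2 := mul_nonneg (sq_nonneg l) (mul_nonneg hδ (by linarith : 0 ≤ y + r))
    have h3 := mul_nonneg hqδ hδ
    rw [hD, abs_le, le_div_iff₀ hy0, div_le_iff₀ hy0]
    constructor <;> linarith
  have hrinv : 1 / r = 4 / 3 * r := by
    field_simp
    linarith
  have e1 : -(π * β / y) * (k ^ 2 + k * l + (1 / 4 + y ^ 2) * l ^ 2) =
      -(π * β / r * q + π * β * D) := by
    rw [div_eq_mul_one_div (π * β) r, hrinv, hD, hf]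
    field_simp
    linear_combination (16 * (k * l + k ^ 2 + l ^ 2) - 12 * l ^ 2) * hsq
  have e2 : 2 * π * (k * a2 y - l * a1 y) = 2 * π * (k - l) / 3 +
      π * ((y ^ 2 - 3 / 4) / (6 * y ^ 2)) * (2 * k + l) := by
    rw [a1_eq, a2]
    field_simp
    ring
  have e3 : -(π * β / r) * (k ^ 2 + k * l + (1 / 4 + r ^ 2) * l ^ 2) = -(π * β / r * q) := by
    rw [hsq, hf]
    ring
  have e4 : 2 * π * (k * a2 r - l * a1 r) = 2 * π * (k - l) / 3 := by
    rw [a1_eq, a2, hsq]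
    ring
  have e5 : π * β * D = π * β * (y - r) * (3 * l ^ 2 - 2 * q) / (2 * y * r) +
      π * β * (l ^ 2 * (y - r) ^ 2 / y) := by
    have : (3 : ℝ) = 4 * r ^ 2 := by linarith
    rw [hD, show 3 * l ^ 2 - 2 * q = 4 * r ^ 2 * l ^ 2 - 4 * r ^ 2 * 2 / 3 * q by rw [hsq]; ring]
    field_simp
    ring
  have hEX : exp (-(π * β / r * q + π * β * D)) ≤ M := by
    refine le_trans ?_ hM
    rw [exp_le_exp, ← e1, neg_mul, neg_le_neg_iff]
    refine mul_le_mul_of_nonneg_left ?_ (by positivity)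
    have := mul_nonneg (sq_nonneg l) (mul_nonneg hδ (by linarith : 0 ≤ y + r))
    rw [← hz] at this
    linarith
  have key := exp_neg_mul_cos_sub_le (2 * π * (k - l) / 3)
    (π * ((y ^ 2 - 3 / 4) / (6 * y ^ 2)) * (2 * k + l)) e5 (by positivity) hE hEX
  rw [e1, e2, e3, e4]
  have hπ := pi_gt_d6
  have A0 : 0 ≤ π ^ 2 * β ^ 2 * (y - r) ^ 2 * q ^ 2 := by positivity
  have b1 : (π * β * D) ^ 2 ≤ 16 / 9 * (π ^ 2 * β ^ 2 * (y - r) ^ 2 * q ^ 2) := by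
    calc (π * β * D) ^ 2 = π ^ 2 * β ^ 2 * |D| ^ 2 := by rw [sq_abs]; ring
      _ ≤ π ^ 2 * β ^ 2 * (4 / 3 * (q * (y - r))) ^ 2 := by gcongr
      _ = _ := by ring
  have b2 : (π * ((y ^ 2 - 3 / 4) / (6 * y ^ 2)) * (2 * k + l)) ^ 2 ≤
      16 / 81 * (π ^ 2 * β ^ 2 * (y - r) ^ 2 * q ^ 2) := by
    have g0 : 0 ≤ (y ^ 2 - 3 / 4) / (6 * y ^ 2) := by rw [hz]; positivity
    have g1 : (y ^ 2 - 3 / 4) / (6 * y ^ 2) ≤ 4 / 9 * r * (y - r) := by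
      rw [hz, div_le_iff₀ (by positivity)]
      have h : r * r * y ≤ r * y * y := by gcongr
      have h' : r * r * y = 3 / 4 * y := by rw [← sq, hsq]
      calc (y - r) * (y + r) ≤ (y - r) * (4 / 9 * r * (6 * y ^ 2)) := by gcongr; linarith
        _ = _ := by ring
    calc (π * ((y ^ 2 - 3 / 4) / (6 * y ^ 2)) * (2 * k + l)) ^ 2 =
          π ^ 2 * ((y ^ 2 - 3 / 4) / (6 * y ^ 2)) ^ 2 * (2 * k + l) ^ 2 := by ring
      _ ≤ π ^ 2 * (4 / 9 * r * (y - r)) ^ 2 * (4 * q) := by gcongr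
      _ = 16 / 27 * (π ^ 2 * 1 ^ 2 * (y - r) ^ 2 * q) := by
        rw [mul_pow, mul_pow, hsq]; ring
      _ ≤ 16 / 27 * (π ^ 2 * β ^ 2 * (y - r) ^ 2 * (q ^ 2 / 3)) := by
        have h1 : 1 ≤ β ^ 2 := one_le_pow₀ hβ
        have h2 : q ≤ q ^ 2 / 3 := by nlinarith
        gcongr
      _ = _ := by ring
  have b3 : π * β * (l ^ 2 * (y - r) ^ 2 / y) ≤
      0.164 * (π ^ 2 * β ^ 2 * (y - r) ^ 2 * q ^ 2) := by
    have : l ^ 2 / y ≤ 0.164 * 3 * 3.1415 * q := by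
      rw [div_le_iff₀ hy0]
      have := mul_le_mul_of_nonneg_left (hr.le.trans hy) hq0
      linarith
    have c : 1 * 3.1415 * 3 ≤ β * π * q := by gcongr; linarith
    have c' := mul_le_mul_of_nonneg_left c hq0
    calc π * β * (l ^ 2 * (y - r) ^ 2 / y) = π * β * (y - r) ^ 2 * (l ^ 2 / y) := by ring
      _ ≤ π * β * (y - r) ^ 2 * (0.164 * q * (β * π * q)) := by
        refine mul_le_mul_of_nonneg_left ?_ (by positivity)
        linarith
      _ = _ := by ring
  have b4 := mul_le_mul_of_nonneg_left (add_le_add (add_le_add b1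
    (mul_le_mul_of_nonneg_left b2 zero_le_two)) b3) ((exp_pos _).le.trans hE)
  have b5 := mul_nonneg ((exp_pos _).le.trans hE) A0
  refine key.trans (add_le_add (le_of_eq ?_) (b4.trans ?_))
  · ring
  · linarith

theorem phase_hexRotation (v : ℤ × ℤ) :
    2 * π * ((hexRotation v).1 - (hexRotation v).2) / 3 =
      2 * π * (v.1 - v.2) / 3 - v.1 * (2 * π) := by
  simp only [hexRotation, Equiv.coe_fn_mk]
  push_cast
  ring

theorem chargedLinear_orbit (c₁ c₂ x : ℝ) (v : ℤ × ℤ) :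
    chargedLinear c₁ c₂ x v + chargedLinear c₁ c₂ x (hexRotation v) +
      chargedLinear c₁ c₂ x (hexRotation (hexRotation v)) = 0 := by
  simp only [chargedLinear, hexForm_rotation, phase_hexRotation, cos_sub_int_mul_two_pi,
    sin_sub_int_mul_two_pi]
  simp only [hexRotation, Equiv.coe_fn_mk, hexForm]
  push_cast
  ring

theorem abs_chargedLinear_le (c₁ c₂ : ℝ) {x : ℝ} (hx : 0 ≤ x) (v : ℤ × ℤ) :
    |chargedLinear c₁ c₂ x v| ≤
      2 * (|c₁| + |c₂|) * ((hexForm v : ℝ) ^ 2 * x ^ (hexForm v).toNat) := by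
  have hq := hexForm_nonneg v
  have h3 : |3 * v.2 ^ 2 - 2 * hexForm v| ≤ 2 * hexForm v ^ 2 := by
    have h1 : 3 * v.2 ^ 2 ≤ 4 * hexForm v := by
      unfold hexForm; nlinarith [sq_nonneg (2 * v.1 + v.2)]
    have h2 : hexForm v ≤ hexForm v ^ 2 := by nlinarith
    rw [abs_le]
    constructor <;> nlinarith [sq_nonneg v.2]
  have h4 : |2 * v.1 + v.2| ≤ 2 * hexForm v ^ 2 := by
    have h1 : (2 * v.1 + v.2) ^ 2 ≤ 4 * hexForm v := by
      unfold hexForm; nlinarith [sq_nonneg v.2]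
    have h2 : hexForm v ≤ hexForm v ^ 2 := by nlinarith
    refine (abs_le_of_sq_le_sq (b := 2 * hexForm v) (by linarith) (by omega)).trans ?_
    linarith
  have h3' : |((3 * v.2 ^ 2 - 2 * hexForm v : ℤ) : ℝ)| ≤ 2 * (hexForm v : ℝ) ^ 2 := by
    exact_mod_cast h3
  have h4' : |((2 * v.1 + v.2 : ℤ) : ℝ)| ≤ 2 * (hexForm v : ℝ) ^ 2 := by
    exact_mod_cast h4
  rw [chargedLinear, abs_mul, abs_of_nonneg (pow_nonneg hx _)]
  calc x ^ (hexForm v).toNat * _ ≤ x ^ (hexForm v).toNat *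
        (|c₁| * (2 * (hexForm v : ℝ) ^ 2) * 1 + |c₂| * (2 * (hexForm v : ℝ) ^ 2) * 1) := by
        refine mul_le_mul_of_nonneg_left ((abs_add_le _ _).trans ?_) (pow_nonneg hx _)
        simp only [abs_mul]
        gcongr
        · exact abs_cos_le_one _
        · exact abs_sin_le_one _
    _ = _ := by ring

theorem summable_chargedLinear (c₁ c₂ : ℝ) {x : ℝ} (hx : 0 ≤ x) (hx' : x ≤ 0.0433) :
    Summable fun v => if 3 ≤ hexForm v then chargedLinear c₁ c₂ x v else 0 := by
  refine Summable.of_norm_bounded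
    ((tsum_hexForm_sq_mul_pow_le hx hx').1.mul_left (2 * (|c₁| + |c₂|))) fun v => ?_
  split_ifs
  · exact abs_chargedLinear_le c₁ c₂ hx v
  · simp

theorem tsum_chargedLinear (c₁ c₂ : ℝ) {x : ℝ} (hx : 0 ≤ x) (hx' : x ≤ 0.0433) :
    ∑' v, (if 3 ≤ hexForm v then chargedLinear c₁ c₂ x v else 0) = 0 := by
  refine tsum_eq_zero_of_orbit hexRotation (summable_chargedLinear c₁ c₂ hx hx') fun v => ?_
  simp only [hexForm_rotation]
  split_ifs
  · exact chargedLinear_orbit c₁ c₂ x v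
  · simp

theorem chargedTail_sub_le {β y : ℝ} (hβ : 1 ≤ β) (hy : √3 / 2 ≤ y) (hy1 : y ≤ 1) :
    chargedTail β y - chargedTail β (√3 / 2) ≤
      136.43 * π ^ 2 * β ^ 2 * (y - √3 / 2) ^ 2 * exp (-(π * β / y)) ^ 3 := by
  have hr := sqrt_three_div_two_bounds.1
  have hπ := pi_gt_d6
  have hx : exp (-(π * β / y)) ≤ 0.0433 := by
    refine exp_neg_le 157 50 (by norm_num) (by norm_num) ?_ (by norm_num)
    rw [le_div_iff₀ (by linarith)]
    push_cast
    nlinarith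
  have hp : exp (-(π * β / (√3 / 2))) ≤ 0.0433 := (exp_hexagonal_le hβ).trans (by norm_num)
  set c₁ := -(π * β * (y - √3 / 2) / (2 * y * (√3 / 2)))
  set c₂ := -(π * (y ^ 2 - 3 / 4) / (6 * y ^ 2))
  obtain ⟨s2, t2⟩ := tsum_hexForm_sq_mul_pow_le (exp_pos _).le hx
  have s1 := summable_chargedLinear c₁ c₂ (exp_pos _).le hp
  have s3 := s2.mul_left (2.34 * π ^ 2 * β ^ 2 * (y - √3 / 2) ^ 2)
  have sy := summable_chargedTail (by linarith : 0 < β) hy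
  have s0 := summable_chargedTail (by linarith : 0 < β) le_rfl
  have h := (sy.sub s0).tsum_le_tsum (g := fun v =>
    (if 3 ≤ hexForm v then chargedLinear c₁ c₂ (exp (-(π * β / (√3 / 2)))) v else 0) +
      2.34 * π ^ 2 * β ^ 2 * (y - √3 / 2) ^ 2 * (if 3 ≤ hexForm v then
        (hexForm v : ℝ) ^ 2 * exp (-(π * β / y)) ^ (hexForm v).toNat else 0)) (fun v => by
      split_ifs with hv
      · exact chargedTerm_sub_le hβ hy hv
      · simp) (s1.add s3)
  rw [sy.tsum_sub s0, s1.tsum_add s3, tsum_chargedLinear _ _ (exp_pos _).le hp, tsum_mul_left] at h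
  refine h.trans ?_
  have := mul_le_mul_of_nonneg_left t2
    (show 0 ≤ 2.34 * π ^ 2 * β ^ 2 * (y - √3 / 2) ^ 2 by positivity)
  have h0 : 0 ≤ π ^ 2 * β ^ 2 * (y - √3 / 2) ^ 2 * exp (-(π * β / y)) ^ 3 := by positivity
  linarith

theorem gTheta_lt_of_le_one {β y : ℝ} (hβ : 1 ≤ β) (hy : √3 / 2 < y) (hy1 : y ≤ 1) :
    gTheta β y < gTheta β (√3 / 2) := by
  obtain ⟨hr, hr', hsq⟩ := sqrt_three_div_two_bounds
  have hβ0 : 0 < β := by linarith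
  have h1 := chargedShell_ge hβ hy.le (hy1.trans (by norm_num))
  have h2 := chargedTail_sub_le hβ hy.le hy1
  rw [gTheta_eq_shell hβ0 hy.le, gTheta_eq_shell hβ0 le_rfl, chargedShell_hexagonal]
  have hπ := pi_gt_d6
  have hπ' := pi_lt_d6
  have h3 : β * exp (-(π * β / y)) ^ 3 ≤ 0.00305 * exp (-(π * β / (√3 / 2))) := by
    have e : exp (-(π * β / y)) ^ 3 ≤
        exp (-(5.796 * β)) * exp (-(π * β / (√3 / 2))) := by
      rw [← exp_nat_mul, ← exp_add, exp_le_exp]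
      have a1 : π * β ≤ π * β / y := le_div_self (by positivity) (by linarith) hy1
      have a2 : π * β / (√3 / 2) ≤ 1.1548 * (π * β) := by
        rw [div_le_iff₀ (by linarith)]
        nlinarith [mul_pos pi_pos hβ0]
      have a3 : 3.1415 * β ≤ π * β := by gcongr; linarith
      push_cast
      linarith
    have f : β * exp (-(5.796 * β)) ≤ 0.00305 := by
      have f1 : exp (-5.796) ≤ 0.00305 :=
        exp_neg_le 197 34 (by norm_num) (by norm_num) (by norm_num) (by norm_num)
      have f2 : β ≤ exp (β - 1) := by linarith [add_one_le_exp (β - 1)]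
      calc β * exp (-(5.796 * β)) ≤ exp (β - 1) * exp (-(5.796 * β)) := by gcongr
        _ ≤ exp (-5.796) := by rw [← exp_add, exp_le_exp]; linarith
        _ ≤ _ := f1
    calc β * exp (-(π * β / y)) ^ 3 ≤
          β * (exp (-(5.796 * β)) * exp (-(π * β / (√3 / 2)))) := by gcongr
      _ = β * exp (-(5.796 * β)) * exp (-(π * β / (√3 / 2))) := by ring
      _ ≤ _ := by gcongr
  have hp := exp_pos (-(π * β / (√3 / 2)))
  generalize exp (-(π * β / (√3 / 2))) = p at *
  have hδ : 0 < (y - √3 / 2) ^ 2 := pow_pos (by linarith) 2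
  have h4 : 136.43 * π ^ 2 * β ^ 2 * (y - √3 / 2) ^ 2 * exp (-(π * β / y)) ^ 3 ≤
      4.5 * (p * β * (y - √3 / 2) ^ 2) := by
    have hπ2 : π ^ 2 ≤ 9.87 := by nlinarith
    calc _ = 136.43 * π ^ 2 * β * (y - √3 / 2) ^ 2 * (β * exp (-(π * β / y)) ^ 3) := by ring
      _ ≤ 136.43 * 9.87 * β * (y - √3 / 2) ^ 2 * (0.00305 * p) := by gcongr
      _ = 136.43 * 9.87 * 0.00305 * (p * β * (y - √3 / 2) ^ 2) := by ring
      _ ≤ _ := by gcongr; norm_num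
  have h5 : 0 < p * β * (y - √3 / 2) ^ 2 := by positivity
  linarith

theorem exp_neg_div_le {β y b c X : ℝ} (hβ : 1 ≤ β) (hy : 0 < y) (hb : y ≤ b)
    (hc : c * b ≤ 3.1415) (hX : exp (-c) ≤ X) : exp (-(π * β / y)) ≤ X := by
  refine le_trans ?_ hX
  rw [exp_le_exp, neg_le_neg_iff, le_div_iff₀ hy]
  have hπ := pi_gt_d6
  rcases le_total c 0 with h | h
  · nlinarith
  · nlinarith

theorem exp_hexagonal_le_mul {β y a c K : ℝ} (hβ : 1 ≤ β) (ha : 0.87 ≤ a) (hy : a ≤ y)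
    (hc : c ≤ 3.1415 * (1.1546 - 1 / a)) (hK : exp (-c) ≤ K) :
    exp (-(π * β / (√3 / 2))) ≤ K * exp (-(π * β / y)) := by
  obtain ⟨hr, hr', -⟩ := sqrt_three_div_two_bounds
  generalize √3 / 2 = r at *
  have hπ := pi_gt_d6
  refine le_trans ?_ (mul_le_mul_of_nonneg_right hK (exp_pos _).le)
  rw [← exp_add, exp_le_exp, ← neg_add, neg_le_neg_iff]
  have h1 : π * β / y ≤ π * β * (1 / a) := by
    rw [mul_one_div]
    have : 0 < a := by linarith
    gcongr
  have h2 : π * β * 1.1546 ≤ π * β / r := by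
    rw [le_div_iff₀ (by linarith)]
    nlinarith [mul_pos pi_pos (by linarith : 0 < β)]
  have h3 : 1 / a ≤ 1.1546 := by rw [div_le_iff₀ (by linarith)]; linarith
  have h4 : 3.1415 * 1 * (1.1546 - 1 / a) ≤ π * β * (1.1546 - 1 / a) := by
    gcongr
    · linarith
  linarith

theorem gTheta_lt_of_shell {β y : ℝ} (hβ : 1 ≤ β) (hy : √3 / 2 ≤ y)
    (hx : exp (-(π * β / y)) ≤ 0.21)
    (h : 3.006 * exp (-(π * β / (√3 / 2))) + 7.5 * exp (-(π * β / y)) ^ 3 < chargedShell β y) :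
    gTheta β y < gTheta β (√3 / 2) := by
  have h1 := one_sub_le_gTheta_hexagonal hβ
  have h2 := (abs_le.1 (abs_chargedTail_le (by linarith) hy hx)).2
  rw [gTheta_eq_shell (by linarith) hy]
  linarith

theorem gTheta_lt_of_mem_Icc_one {β y : ℝ} (hβ : 1 ≤ β) (hy : 1 ≤ y) (hy1 : y ≤ 1.1) :
    gTheta β y < gTheta β (√3 / 2) := by
  obtain ⟨hr, hr', -⟩ := sqrt_three_div_two_bounds
  have hy0 : √3 / 2 ≤ y := by linarith
  refine gTheta_lt_of_shell hβ hy0 (exp_neg_div_le (c := 2) hβ (by linarith) hy1 (by norm_num)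
    (exp_neg_le 2 1 (by norm_num) (by norm_num) (by norm_num) (by norm_num))) ?_
  refine lt_of_lt_of_le ?_ (chargedShell_ge hβ hy0 hy1)
  have hπ := pi_gt_d6
  have h3 : exp (-(π * β / y)) ^ 3 ≤ 0.0072 * exp (-(π * β / (√3 / 2))) := by
    have f1 : exp (-4.939) ≤ 0.0072 :=
      exp_neg_le 153 31 (by norm_num) (by norm_num) (by norm_num) (by norm_num)
    refine le_trans ?_ (mul_le_mul_of_nonneg_right f1 (exp_pos _).le)
    rw [← exp_nat_mul, ← exp_add, exp_le_exp]
    have a1 : π * β * (1 / 1.1) ≤ π * β / y := by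
      rw [mul_one_div]
      have : 0 < y := by linarith
      gcongr
    have a2 : π * β / (√3 / 2) ≤ 1.1548 * (π * β) := by
      rw [div_le_iff₀ (by linarith)]
      nlinarith [mul_pos pi_pos (by linarith : 0 < β)]
    have a3 : 3.1415 * 1 ≤ π * β := by gcongr; linarith
    push_cast
    linarith
  have hp := exp_pos (-(π * β / (√3 / 2)))
  generalize exp (-(π * β / (√3 / 2))) = p at *
  have hδ : 0.0178 ≤ (y - √3 / 2) ^ 2 := by nlinarith
  have hδ' : 1 * 0.0178 ≤ β * (y - √3 / 2) ^ 2 := by gcongr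
  nlinarith

theorem gTheta_lt_of_cos {β y C X K : ℝ} (hβ : 1 ≤ β) (hy : 1 ≤ y)
    (hX : exp (-(π * β / y)) ≤ X) (hX' : X ≤ 0.21)
    (hK : exp (-(π * β / (√3 / 2))) ≤ K * exp (-(π * β / y)))
    (hC : C ≤ cos (2 * (π / (8 * y ^ 2)))) (h : 3.006 * K + 7.5 * X ^ 2 < 2 * C) :
    gTheta β y < gTheta β (√3 / 2) := by
  have hr := sqrt_three_div_two_bounds.2.1
  refine gTheta_lt_of_shell hβ (by linarith) (hX.trans hX') ?_
  have hs : 0 ≤ sin (π / (8 * y ^ 2)) := by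
    refine sin_nonneg_of_nonneg_of_le_pi (by positivity) (div_le_self pi_pos.le ?_)
    nlinarith
  have hE := mul_nonneg (exp_pos (-(π * β * (y + 1 / (4 * y))))).le hs
  have hx := exp_pos (-(π * β / y))
  unfold chargedShell
  generalize exp (-(π * β / y)) = x at *
  have h3 : x ^ 3 ≤ X ^ 2 * x := by rw [pow_succ]; gcongr
  have h4 := mul_le_mul_of_nonneg_left hC hx.le
  have h5 := mul_lt_mul_of_pos_left h hx
  linarith

theorem le_cos_of_le {y a C : ℝ} (ha : 0 < a) (hy : a ≤ y)
    (hC : C ≤ 1 - (0.7854 / a ^ 2) ^ 2 / 2) : C ≤ cos (2 * (π / (8 * y ^ 2))) := by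
  refine hC.trans (le_trans ?_ (one_sub_sq_div_two_le_cos))
  have h : 2 * (π / (8 * y ^ 2)) ≤ 0.7854 / a ^ 2 := by
    calc 2 * (π / (8 * y ^ 2)) = π / 4 / y ^ 2 := by ring
      _ ≤ π / 4 / a ^ 2 := by gcongr
      _ ≤ _ := by gcongr; linarith [pi_lt_d6]
  have h0 : 0 ≤ 2 * (π / (8 * y ^ 2)) := by positivity
  have : (2 * (π / (8 * y ^ 2))) ^ 2 ≤ (0.7854 / a ^ 2) ^ 2 := by gcongr
  linarith

theorem gTheta_lt_of_le_two {β y : ℝ} (hβ : 1 ≤ β) (hy : √3 / 2 < y) (hy2 : y ≤ 2) :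
    gTheta β y < gTheta β (√3 / 2) := by
  rcases le_total y 1 with h1 | h1
  · exact gTheta_lt_of_le_one hβ hy h1
  rcases le_total y 1.1 with h2 | h2
  · exact gTheta_lt_of_mem_Icc_one hβ h1 h2
  rcases le_total y 1.5 with h3 | h3
  · refine gTheta_lt_of_cos (C := 0.789) (X := 0.124) (K := 0.464) hβ h1
      (exp_neg_div_le (c := 2.094) hβ (by linarith) h3 (by norm_num)
        (exp_neg_le 94 45 (by norm_num) (by norm_num) (by norm_num) (by norm_num))) (by norm_num)
      (exp_hexagonal_le_mul (c := 0.771) hβ (by norm_num) h2 (by norm_num)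
        (exp_neg_le 10 13 (by norm_num) (by norm_num) (by norm_num) (by norm_num)))
      (le_cos_of_le (by norm_num) h2 (by norm_num)) (by norm_num)
  · refine gTheta_lt_of_cos (C := 0.93) (X := 0.21) (K := 0.22) hβ h1
      (exp_neg_div_le (c := 1.57) hβ (by linarith) hy2 (by norm_num)
        (exp_neg_le 47 30 (by norm_num) (by norm_num) (by norm_num) (by norm_num))) (by norm_num)
      (exp_hexagonal_le_mul (c := 1.53) hβ (by norm_num) h3 (by norm_num)
        (exp_neg_le 38 25 (by norm_num) (by norm_num) (by norm_num) (by norm_num)))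
      (le_cos_of_le (by norm_num) h3 (by norm_num)) (by norm_num)

theorem chargedTerm_row_zero {β y : ℝ} (hβ : 0 < β) (hy : √3 / 2 ≤ y) :
    ∑' k, chargedTerm β y (k, 0) ≤ 1 - 2 * exp (-(π * β / y)) * cos (2 * (π / (8 * y ^ 2))) +
      2 * (exp (-(π * β / y)) ^ 4 / (1 - exp (-(π * β / y)))) := by
  have hy0 : 0 < y := lt_of_lt_of_le (by positivity) hy
  have hc : 0 < π * β / y := by positivity
  have hx : exp (-(π * β / y)) < 1 := by simpa using hc
  have c1 : cos (2 * π * a2 y) = -cos (2 * (π / (8 * y ^ 2))) := by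
    rw [← cos_pi_sub]; congr 1; unfold a2; ring
  have h0 : chargedTerm β y (0, 0) = 1 := by simp [chargedTerm]
  have h1 : chargedTerm β y (1, 0) = -(exp (-(π * β / y)) * cos (2 * (π / (8 * y ^ 2)))) := by
    rw [← mul_neg, ← c1, chargedTerm]
    congr 2 <;> simp
  have h2 : chargedTerm β y (-1, 0) = -(exp (-(π * β / y)) * cos (2 * (π / (8 * y ^ 2)))) := by
    rw [← mul_neg, ← c1, ← cos_neg, chargedTerm]
    congr 2 <;> simp
  have hF : Summable fun k => chargedTerm β y (k, 0) :=
    (summable_chargedTerm hβ hy).comp_injective fun a b h => by simpa using h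
  have hb (k : ℤ) (n : ℕ) (h : ((n : ℝ) + 2) ^ 2 = k ^ 2) : chargedTerm β y (k, 0) ≤
      exp (-(π * β / y)) ^ 4 * exp (-(π * β / y)) ^ n := by
    refine (mul_le_of_le_one_right (exp_pos _).le (cos_le_one _)).trans ?_
    rw [← pow_add, ← exp_nat_mul, exp_le_exp]
    have : (n : ℝ) + 4 ≤ k ^ 2 := by nlinarith [n.cast_nonneg (α := ℝ)]
    have := mul_le_mul_of_nonneg_left this hc.le
    push_cast
    linarith
  refine (tsum_int_le_of_geometric_two hF (exp_pos _).le hx (fun n => hb _ n (by push_cast; ring))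
    fun n => hb _ n (by push_cast; ring)).trans (le_of_eq ?_)
  rw [h0, h1, h2]
  ring

theorem chargedTerm_row_le {β y : ℝ} (hβ : 0 < β) (hy : √3 / 2 ≤ y) (l : ℤ) :
    ∑' k, chargedTerm β y (k, l) ≤ exp (-(π * β * (y - 1 / (4 * y)) * l ^ 2)) *
      (1 + 2 * (exp (-(π * β / (2 * y))) / (1 - exp (-(π * β / (2 * y)))))) := by
  have hy0 : 0 < y := lt_of_lt_of_le (by positivity) hy
  have hF : Summable fun k => chargedTerm β y (k, l) :=
    (summable_chargedTerm hβ hy).comp_injective fun a b h => by simpa using h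
  have hc : 0 < π * β / (2 * y) := by positivity
  have hs : Summable fun k : ℤ => exp (-(π * β / (2 * y) * (k : ℝ) ^ 2)) := by
    simpa using summable_exp_neg_sq hc 0
  refine le_trans ?_ (mul_le_mul_of_nonneg_left (tsum_exp_neg_sq_le hc) (exp_pos _).le)
  rw [← tsum_mul_left]
  refine hF.tsum_le_tsum (fun k => ?_) (hs.mul_left _)
  refine (mul_le_of_le_one_right (exp_pos _).le (cos_le_one _)).trans ?_
  rw [← exp_add, exp_le_exp]
  have e : π * β * (y - 1 / (4 * y)) * l ^ 2 + π * β / (2 * y) * (k : ℝ) ^ 2 +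
      π * β / (2 * y) * ((k : ℝ) + l) ^ 2 =
      π * β / y * ((k : ℝ) ^ 2 + k * l + (1 / 4 + y ^ 2) * (l : ℝ) ^ 2) := by
    field_simp
    ring
  have : 0 ≤ π * β / (2 * y) * ((k : ℝ) + l) ^ 2 := by positivity
  dsimp only
  linarith

theorem gTheta_le_of_two_le {β y : ℝ} (hβ : 1 ≤ β) (hy : 2 ≤ y) (hyβ : y ≤ 4 * β) :
    gTheta β y ≤ 1 - 1.4 * exp (-(π * β / y)) := by
  have hr := sqrt_three_div_two_bounds.2.1
  have hy' : √3 / 2 ≤ y := by linarith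
  have hβ0 : 0 < β := by linarith
  have hy0 : 0 < y := by linarith
  have hπ := pi_gt_d6
  have hs := summable_chargedTerm hβ0 hy'
  have hπy : 3.141592 / 4 ≤ π * β / y := by
    rw [le_div_iff₀ hy0]
    nlinarith
  have hx : exp (-(π * β / y)) ≤ 0.457 :=
    exp_neg_le 47 60 (by norm_num) (by norm_num) (by push_cast; linarith) (by norm_num)
  have hx2 : exp (-(π * β / (2 * y))) ≤ 0.68 := by
    refine exp_neg_le 7 18 (by norm_num) (by norm_num) ?_ (by norm_num)
    rw [mul_comm 2 y, ← div_div]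
    push_cast
    linarith
  have hM : 1 + 2 * (exp (-(π * β / (2 * y))) / (1 - exp (-(π * β / (2 * y))))) ≤ 5.25 := by
    have : exp (-(π * β / (2 * y))) / (1 - exp (-(π * β / (2 * y)))) ≤ 2.125 := by
      rw [div_le_iff₀ (by linarith)]
      linarith
    linarith
  obtain ⟨E, hE⟩ : ∃ E, E = exp (-(π * β * (y - 1 / (4 * y)))) := ⟨_, rfl⟩
  have hE0 : 0 < E := hE ▸ exp_pos _
  have hEx : E ≤ 0.0136 * exp (-(π * β / y)) := by
    have f : exp (-4.3) ≤ 0.0136 :=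
      exp_neg_le 43 10 (by norm_num) (by norm_num) (by norm_num) (by norm_num)
    refine le_trans ?_ (mul_le_mul_of_nonneg_right f (exp_pos _).le)
    rw [hE, ← exp_add, exp_le_exp]
    have h1 : 1.375 ≤ y - 1 / (4 * y) - 1 / y := by
      have : y - 1 / (4 * y) - 1 / y = y - 5 / (4 * y) := by field_simp; ring
      rw [this, le_sub_comm, div_le_iff₀ (by positivity)]
      nlinarith
    have h2 : 3.1415 * 1 * 1.375 ≤ π * β * (y - 1 / (4 * y) - 1 / y) := by
      gcongr
      linarith
    have h3 : π * β / y = π * β * (1 / y) := by ring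
    linarith
  have hE1 : E ≤ 0.0063 := by linarith
  have hrow (l : ℤ) : ∑' k, chargedTerm β y (k, l) ≤ 5.25 * E ^ (l.natAbs) := by
    refine (chargedTerm_row_le hβ0 hy' l).trans ?_
    rw [mul_comm]
    refine mul_le_mul hM ?_ (exp_pos _).le (by norm_num)
    rw [hE, ← exp_nat_mul, exp_le_exp]
    have h1 : (l.natAbs : ℝ) ≤ (l : ℝ) ^ 2 := by
      rw [Nat.cast_natAbs]
      exact_mod_cast Int.natCast_natAbs l ▸ Int.natAbs_le_self_sq l
    have h2 : 0 ≤ π * β * (y - 1 / (4 * y)) := by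
      have : 1 / (4 * y) ≤ 1 := by rw [div_le_one (by positivity)]; linarith
      exact mul_nonneg (by positivity) (by linarith)
    nlinarith
  have hsr : Summable fun l => ∑' k, chargedTerm β y (k, l) :=
    ((Equiv.prodComm ℤ ℤ).summable_iff.2 hs).prod
  have key := tsum_int_le_of_geometric hsr (A := 5.25) (A' := 5.25 * E) hE0.le
    (by linarith) (fun n => hrow _) (fun n => (hrow _).trans (le_of_eq (by
      rw [Int.natAbs_neg]
      norm_cast
      ring)))
  have h0 := chargedTerm_row_zero hβ0 hy'
  have h1 := hrow (-1)
  rw [← tsum_prod_swap hs] at key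
  have hcos : 0.98 ≤ cos (2 * (π / (8 * y ^ 2))) := le_cos_of_le (by norm_num) hy (by norm_num)
  have hx0 := exp_pos (-(π * β / y))
  have hg : gTheta β y = ∑' v, chargedTerm β y v := rfl
  rw [hg]
  generalize exp (-(π * β / y)) = x at *
  have q1 : x ^ 4 / (1 - x) ≤ 0.176 * x := by
    rw [div_le_iff₀ (by linarith)]
    have : x ^ 3 ≤ 0.457 ^ 3 := by gcongr
    nlinarith
  have q2 : E / (1 - E) ≤ 0.0138 * x := by
    rw [div_le_iff₀ (by linarith)]
    nlinarith
  have q3 : (5.25 + 5.25 * E) * (E / (1 - E)) ≤ (5.25 + 5.25 * 0.0063) * (0.0138 * x) :=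
    mul_le_mul (by linarith) q2 (div_nonneg hE0.le (by linarith)) (by norm_num)
  have q4 := mul_le_mul_of_nonneg_left hcos hx0.le
  norm_num at h1
  linarith

theorem exp_neg_pi_mul_le {u : ℝ} (hu : 4 ≤ u) : exp (-(π * u)) ≤ 0.001 := by
  have hπ := pi_gt_d6
  exact exp_neg_le 12 1 (by norm_num) (by norm_num) (by push_cast; nlinarith) (by norm_num)

theorem tsum_exp_neg_shift_sq_le {s a : ℝ} (hs : 4 ≤ s) (ha : 0.492 ≤ a) (ha' : a ≤ 1 / 2) :
    ∑' l : ℤ, exp (-(π * s * (l + a) ^ 2)) ≤ 2.01 * exp (-(0.76 * s)) := by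
  have hπ := pi_gt_d6
  have s1 := summable_exp_neg_sq (c := π * s) (by positivity) a
  have hb (l : ℤ) (n : ℕ) (h : 0.242 + (n : ℝ) ≤ (l + a) ^ 2) :
      exp (-(π * s * (l + a) ^ 2)) ≤ exp (-(0.76 * s)) * exp (-(π * s)) ^ n := by
    rw [← exp_nat_mul, ← exp_add, exp_le_exp]
    have h1 := mul_le_mul_of_nonneg_left h (show 0 ≤ π * s by positivity)
    have h2 : 3.1415 * s ≤ π * s := by gcongr; linarith
    linarith
  have hsm := exp_neg_pi_mul_le hs
  have h0 := hb 0 0 (by push_cast; nlinarith)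
  have h1 := hb (-1) 0 (by push_cast; nlinarith)
  refine (tsum_int_le_of_geometric s1 (exp_pos (-(π * s))).le (by linarith)
    (fun n => hb _ (n + 1) (by push_cast; nlinarith [n.cast_nonneg (α := ℝ)]))
    (fun n => hb _ (n + 1) (by push_cast; nlinarith [n.cast_nonneg (α := ℝ)]))).trans ?_
  have : exp (-(π * s)) / (1 - exp (-(π * s))) ≤ 0.005 := by
    rw [div_le_iff₀ (by linarith)]
    linarith
  have := mul_le_mul_of_nonneg_left this (exp_pos (-(0.76 * s))).le
  rw [pow_zero, mul_one] at h0 h1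
  linarith

theorem mul_exp_neg_le {s : ℝ} (hs : 4 ≤ s) : s * exp (-(0.76 * s)) ≤ 0.2 := by
  have h1 : s ≤ 4 * exp ((s - 4) / 4) := by linarith [add_one_le_exp ((s - 4) / 4)]
  have h2 : exp (-3) ≤ 0.05 :=
    exp_neg_le 3 1 (by norm_num) (by norm_num) (by norm_num) (by norm_num)
  calc s * exp (-(0.76 * s)) ≤ 4 * exp ((s - 4) / 4) * exp (-(0.76 * s)) := by gcongr
    _ ≤ 4 * exp (-3) := by
      rw [mul_assoc, ← exp_add]
      gcongr
      linarith
    _ ≤ _ := by linarith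

theorem gTheta_le_of_four_mul_le {β y : ℝ} (hβ : 1 ≤ β) (hy : 4 * β ≤ y) :
    gTheta β y ≤ 0.9 := by
  have hr := sqrt_three_div_two_bounds.2.1
  have hβ0 : 0 < β := by linarith
  have hy0 : 0 < y := by linarith
  have hs : 4 ≤ y / β := by rwa [le_div_iff₀ hβ0]
  have ht : 4 ≤ β * y := by nlinarith
  have hπ := pi_gt_d6
  rw [gTheta_eq_dual hβ0 (by linarith)]
  have hd := summable_dual (s := y / β) (t := β * y) (by linarith) (by linarith) (a2 y)
  have ha : 0.492 ≤ a2 y ∧ a2 y ≤ 1 / 2 := by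
    have h1 : 1 / (8 * y ^ 2) ≤ 0.008 := by
      rw [div_le_iff₀ (by positivity)]
      nlinarith
    have h2 : 0 ≤ 1 / (8 * y ^ 2) := by positivity
    unfold a2
    constructor <;> linarith
  generalize y / β = s at *
  generalize β * y = t at *
  generalize a2 y = a at *
  have s1 := summable_exp_neg_sq (c := π * s) (by positivity) a
  have s2 : Summable fun m : ℤ => exp (-(π * t * (m : ℝ) ^ 2)) := by
    simpa using summable_exp_neg_sq (c := π * t) (by positivity) 0
  have hpr : ∑' v : ℤ × ℤ, exp (-(π * s * (v.1 + a) ^ 2)) *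
      (exp (-(π * t * v.2 ^ 2)) * cos (π * (v.2 * (v.1 + 1)))) ≤
      (∑' l : ℤ, exp (-(π * s * (l + a) ^ 2))) * ∑' m : ℤ, exp (-(π * t * (m : ℝ) ^ 2)) := by
    rw [tsum_mul_tsum_of_summable_norm s1.norm s2.norm]
    refine hd.tsum_le_tsum (fun v => ?_) (summable_mul_of_summable_norm s1.norm s2.norm)
    gcongr
    exact mul_le_of_le_one_right (exp_pos _).le (cos_le_one _)
  have b2 : ∑' m : ℤ, exp (-(π * t * (m : ℝ) ^ 2)) ≤ 1.01 := by
    refine (tsum_exp_neg_sq_le (by positivity)).trans ?_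
    have := exp_neg_pi_mul_le ht
    have : exp (-(π * t)) / (1 - exp (-(π * t))) ≤ 0.005 := by
      rw [div_le_iff₀ (by linarith)]
      linarith
    linarith
  have b1 := tsum_exp_neg_shift_sq_le hs ha.1 ha.2
  have b0 : √s ≤ s / 2 := by
    rw [sqrt_le_left (by linarith)]
    nlinarith
  have b3 := mul_exp_neg_le hs
  calc _ ≤ s / 2 * ((2.01 * exp (-(0.76 * s))) * 1.01) :=
        (mul_le_mul_of_nonneg_left (hpr.trans (mul_le_mul b1 b2
          (tsum_nonneg fun _ => (exp_pos _).le) (by positivity))) (sqrt_nonneg s)).trans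
          (mul_le_mul_of_nonneg_right b0 (by positivity))
    _ = 2.01 * 1.01 / 2 * (s * exp (-(0.76 * s))) := by ring
    _ ≤ _ := by linarith

theorem gTheta_lt {β y : ℝ} (hβ : 1 ≤ β) (hy : √3 / 2 < y) : gTheta β y < gTheta β (√3 / 2) := by
  rcases le_total y 2 with h2 | h2
  · exact gTheta_lt_of_le_two hβ hy h2
  refine lt_of_lt_of_le ?_ (one_sub_le_gTheta_hexagonal hβ)
  rcases le_total y (4 * β) with h | h
  · have h1 := gTheta_le_of_two_le hβ h2 h
    have h3 := exp_hexagonal_le_mul (y := y) (a := 2) (c := 2) (K := 0.14) hβ (by norm_num) h2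
      (by norm_num) (exp_neg_le 2 1 (by norm_num) (by norm_num) (by norm_num) (by norm_num))
    have := exp_pos (-(π * β / y))
    linarith
  · have h1 := gTheta_le_of_four_mul_le hβ h
    have h3 := exp_hexagonal_le hβ
    linarith

end CircumcenterTheta

/-- Second Main Lemma: for every `α > 0`, both `f_α` and `g_α` are strictly maximized on
`[√3/2, ∞)` at `y = √3/2` (the hexagonal lattice). -/
theorem second_main_lemma (α : ℝ) (hα : 0 < α) (y : ℝ) (hy : Real.sqrt 3 / 2 < y) :
    fTheta α y < fTheta α (Real.sqrt 3 / 2) ∧ gTheta α y < gTheta α (Real.sqrt 3 / 2) :=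
  CircumcenterTheta.lt_of_lt_of_one_le (fun _ _ => CircumcenterTheta.fTheta_lt)
    (fun _ _ => CircumcenterTheta.gTheta_lt) hα hy
end

section
/- For every α ≥ 1 and every y ≥ √3/2: f_α(y) ≤ f_α(√3/2). That is, max_{y ≥ √3/2} f_α(y) = f_α(√3/2). -/
/-- The triangular number `n (n + 1) / 2`, for an integer `n`. -/
def tri (n : ℤ) : ℕ := (n * (n + 1) / 2).toNat

lemma two_mul_tri (n : ℤ) : 2 * (tri n : ℤ) = n * (n + 1) := by
  have h0 : 0 ≤ n * (n + 1) := by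
    rcases le_or_gt 0 n with h | h <;> nlinarith
  have h2 : (2 : ℤ) ∣ n * (n + 1) := (Int.even_mul_succ_self n).two_dvd
  unfold tri
  rw [Int.toNat_of_nonneg (by omega)]
  omega

lemma tri_real (n : ℤ) : (tri n : ℝ) = n * (n + 1) / 2 := by
  have h : (2 * (tri n : ℤ) : ℝ) = ((n * (n + 1) : ℤ) : ℝ) := by
    exact_mod_cast congrArg (Int.cast : ℤ → ℝ) (two_mul_tri n)
  push_cast at h
  linarith

lemma tri_neg_sub_one (n : ℤ) : tri (-1 - n) = tri n := by
  have h1 := two_mul_tri (-1 - n)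
  have h2 := two_mul_tri n
  have : (-1 - n) * (-1 - n + 1) = n * (n + 1) := by ring
  omega

/-- The weight of a lattice point, invariant under the threefold rotation `rot`. -/
def wt (p : ℤ × ℤ) : ℕ := tri p.1 + tri p.2 + tri (p.1 + p.2)

lemma wt_int (p : ℤ × ℤ) :
    (wt p : ℤ) = p.1 ^ 2 + p.1 * p.2 + p.2 ^ 2 + p.1 + p.2 := by
  have h1 := two_mul_tri p.1
  have h2 := two_mul_tri p.2
  have h3 := two_mul_tri (p.1 + p.2)
  unfold wt
  push_cast
  nlinarith

/-- The rotation of order three about the circumcenter, acting on lattice indices. -/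
def rot : ℤ × ℤ ≃ ℤ × ℤ where
  toFun p := (p.2, -1 - (p.1 + p.2))
  invFun p := (-1 - (p.1 + p.2), p.1)
  left_inv p := by ext <;> simp only <;> ring
  right_inv p := by ext <;> simp only <;> ring

lemma tri_rot_snd (p : ℤ × ℤ) : tri (rot p).2 = tri (p.1 + p.2) := tri_neg_sub_one _

lemma tri_rot_add (p : ℤ × ℤ) : tri ((rot p).1 + (rot p).2) = tri p.1 := by
  rw [← tri_neg_sub_one p.1]
  congr 1
  simp only [rot, Equiv.coe_fn_mk]
  ring

lemma wt_rot (p : ℤ × ℤ) : wt (rot p) = wt p := by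
  have h1 : tri (rot p).1 = tri p.2 := rfl
  unfold wt
  rw [tri_rot_snd, tri_rot_add, h1]
  ring

lemma abs_add_abs_le_wt (p : ℤ × ℤ) : |p.1| + |p.2| ≤ wt p + 1 := by
  rw [wt_int]
  obtain ⟨k, l⟩ := p
  dsimp only
  rcases abs_cases k with ⟨h1, h2⟩ | ⟨h1, h2⟩ <;> rcases abs_cases l with ⟨h3, h4⟩ | ⟨h3, h4⟩ <;>
    rw [h1, h3]
  · nlinarith [mul_nonneg h2 h4]
  · rcases le_or_gt k 0 with h | h
    · nlinarith [sq_nonneg (l+1)]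
    · have : 0 ≤ (k + l) * (k + l + 1) := by
        rcases le_or_gt 0 (k + l) with h | h <;> nlinarith
      nlinarith [mul_nonneg (by linarith : 0 ≤ k - 1) (by linarith : 0 ≤ -1 - l)]
  · rcases le_or_gt l 0 with h | h
    · nlinarith [sq_nonneg (k+1)]
    · have : 0 ≤ (k + l) * (k + l + 1) := by
        rcases le_or_gt 0 (k + l) with h | h <;> nlinarith
      nlinarith [mul_nonneg (by linarith : 0 ≤ l - 1) (by linarith : 0 ≤ -1 - k)]
  · nlinarith [mul_nonneg (by linarith : 0 ≤ -1-k) (by linarith : 0 ≤ -1 - l), sq_nonneg (k+l+1)]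

/-- The summand of the normalised theta series. -/
noncomputable def term (a b : ℝ) (p : ℤ × ℤ) : ℝ :=
  a ^ tri p.2 * b ^ (tri p.1 + tri (p.1 + p.2))

lemma fTheta_eq (α y : ℝ) (hy : 0 < y) :
    fTheta α y = Real.exp (-(Real.pi * α * (y / 4 + 1 / (8 * y) + 1 / (64 * y ^ 3)))) *
      ∑' p, term (Real.exp (-(2 * Real.pi * α * (y - 1 / (4 * y)))))
        (Real.exp (-(Real.pi * α / y))) p := by
  unfold fTheta
  rw [← tsum_mul_left]
  congr 1
  ext p
  unfold term
  rw [← Real.exp_nat_mul, ← Real.exp_nat_mul, ← Real.exp_add, ← Real.exp_add]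
  congr 1
  push_cast
  rw [tri_real, tri_real, tri_real]
  unfold a1 a2
  push_cast
  field_simp
  ring

lemma hasSum_pow_natAbs {r : ℝ} (h0 : 0 ≤ r) (h1 : r < 1) :
    HasSum (fun n : ℤ => r ^ n.natAbs) ((1 + r) / (1 - r)) := by
  have h := HasSum.of_nat_of_neg_add_one (f := fun n : ℤ => r ^ n.natAbs)
    (by simpa using hasSum_geometric_of_lt_one h0 h1)
    (m' := r * (1 - r)⁻¹) (by
      have := (hasSum_geometric_of_lt_one h0 h1).mul_left r
      refine this.congr_fun fun n => ?_
      rw [← pow_succ']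
      congr 1)
  convert h using 1
  field_simp

lemma hasSum_pow_natAbs_add {r : ℝ} (h0 : 0 ≤ r) (h1 : r < 1) :
    HasSum (fun p : ℤ × ℤ => r ^ (p.1.natAbs + p.2.natAbs)) (((1 + r) / (1 - r)) ^ 2) := by
  have h := hasSum_pow_natAbs h0 h1
  have hs : Summable (fun n : ℤ => r ^ n.natAbs) := h.summable
  have := h.mul h (hs.mul_of_nonneg hs (fun _ => by positivity) (fun _ => by positivity))
  simpa [pow_add, sq] using this

lemma summable_pow_wt {r : ℝ} (h0 : 0 ≤ r) (h1 : r < 1) :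
    Summable (fun p => r ^ wt p) := by
  obtain ⟨q, hq, hq1⟩ := exists_between (max_lt h1 one_pos)
  have hq0 : 0 < q := (le_max_right _ _).trans_lt hq
  refine Summable.of_nonneg_of_le (fun _ => by positivity) (fun p => ?_)
    ((hasSum_pow_natAbs_add hq0.le hq1).summable.mul_left q⁻¹)
  have h2 : p.1.natAbs + p.2.natAbs ≤ wt p + 1 := by
    have := abs_add_abs_le_wt p
    rw [Int.abs_eq_natAbs, Int.abs_eq_natAbs] at this
    omega
  calc r ^ wt p ≤ q ^ wt p := pow_le_pow_left₀ h0 ((le_max_left _ _).trans hq.le) _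
    _ = q⁻¹ * q ^ (wt p + 1) := by rw [pow_succ]; field_simp
    _ ≤ _ := mul_le_mul_of_nonneg_left (pow_le_pow_of_le_one hq0.le hq1.le h2) (by positivity)

lemma term_le_pow_wt {a b r : ℝ} (ha : 0 ≤ a) (hb : 0 ≤ b) (har : a ≤ r) (hbr : b ≤ r)
    (p : ℤ × ℤ) : term a b p ≤ r ^ wt p := by
  have : r ^ wt p = r ^ tri p.2 * r ^ (tri p.1 + tri (p.1 + p.2)) := by
    rw [← pow_add]; congr 1; unfold wt; ring
  rw [this]
  have hr : 0 ≤ r := ha.trans har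
  unfold term
  gcongr

lemma summable_term {a b : ℝ} (ha : 0 ≤ a) (ha1 : a < 1) (hb : 0 ≤ b) (hb1 : b < 1) :
    Summable (term a b) :=
  Summable.of_nonneg_of_le (fun _ => by unfold term; positivity)
    (term_le_pow_wt ha hb (le_max_left _ _) (le_max_right _ _))
    (summable_pow_wt (ha.trans (le_max_left _ _)) (max_lt ha1 hb1))

lemma hasSum_pow_wt_mul_dev {E : ℝ} (h0 : 0 ≤ E) (h1 : 2 * E < 1) :
    HasSum (fun p => E ^ wt p * ((wt p : ℝ) - 3 * tri p.2)) 0 := by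
  have hS : Summable (fun p : ℤ × ℤ => E ^ wt p * (tri p.2 : ℝ)) := by
    refine Summable.of_nonneg_of_le (fun _ => by positivity) (fun p => ?_)
      (summable_pow_wt (by positivity : 0 ≤ 2 * E) h1)
    have h2 : (tri p.2 : ℝ) ≤ 2 ^ wt p := by
      have : tri p.2 ≤ wt p := by unfold wt; omega
      exact_mod_cast this.trans Nat.lt_two_pow_self.le
    rw [mul_pow, mul_comm]
    gcongr
  obtain ⟨s, hs⟩ := hS
  have hs1 := (Equiv.hasSum_iff rot).2 hs
  have hs2 := (Equiv.hasSum_iff rot).2 hs1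
  have h := ((hs.add hs1).add hs2).sub (hs.mul_left 3)
  rw [show s + s + s - 3 * s = 0 by ring] at h
  refine h.congr_fun fun p => ?_
  simp only [Function.comp, wt_rot, tri_rot_snd, tri_rot_add]
  unfold wt
  push_cast
  ring

/-- The quadratic majorant of the second order variation of a summand. -/
noncomputable def devSq (E b : ℝ) (p : ℤ × ℤ) : ℝ :=
  ((wt p : ℝ) - 3 * tri p.2) ^ 2 * (if 3 * tri p.2 ≤ wt p then b ^ wt p else E ^ wt p)

/-- The indices of weight between `1` and `5`. -/
def smallIndices : Finset (ℤ × ℤ) :=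
  {(1, -1), (-1, 1), (-1, -1),
   (1, -2), (-2, 1), (1, 0), (0, 1), (-2, 0), (0, -2),
   (2, -2), (-2, 2), (2, -1), (-1, 2), (-2, -1), (-1, -2),
   (1, 1), (1, -3), (-3, 1)}

lemma six_le_wt {p : ℤ × ℤ} (hp : p ∉ smallIndices) (h0 : wt p ≠ 0) : 6 ≤ wt p := by
  by_contra! h
  have h2 := wt_int p
  have h3 : (wt p : ℤ) ≤ 5 := by omega
  obtain ⟨k, l⟩ := p
  have hk : k ≤ 3 := by nlinarith [sq_nonneg (k + 2 * l + 1)]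
  have hk' : -4 ≤ k := by nlinarith [sq_nonneg (k + 2 * l + 1)]
  have hl : l ≤ 3 := by nlinarith [sq_nonneg (l + 2 * k + 1)]
  have hl' : -4 ≤ l := by nlinarith [sq_nonneg (l + 2 * k + 1)]
  simp only at h2
  interval_cases k <;> interval_cases l <;>
    first
      | exact absurd (by decide) hp
      | omega

lemma sum_smallIndices (E b : ℝ) : ∑ p ∈ smallIndices, devSq E b p =
    2 * b + 4 * E + 8 * b ^ 2 + 4 * E ^ 2 + 34 * b ^ 4 + 50 * E ^ 4 + 8 * b ^ 5 + 16 * E ^ 5 := by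
  unfold smallIndices
  repeat rw [Finset.sum_insert (by decide)]
  rw [Finset.sum_singleton]
  simp [devSq, wt, tri]
  ring

lemma two_mul_natAbs_le_wt (p : ℤ × ℤ) : 2 * (p.1.natAbs + p.2.natAbs) ≤ wt p + 4 := by
  have h : 2 * (|p.1| + |p.2|) ≤ (wt p : ℤ) + 4 := by
    rw [wt_int]
    obtain ⟨k, l⟩ := p
    dsimp only
    have key : ∀ j i : ℤ, 2 ∣ j - i → 8 * j ≤ j ^ 2 + 3 * i ^ 2 + 4 * i + 16 := fun j i hd => by
      have : 0 ≤ 3 * i ^ 2 + 4 * i + 1 := by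
        rcases le_or_gt 0 i with h | h <;> nlinarith
      by_contra! hc
      have h1 : 3 < j := by nlinarith
      have h2 : j < 5 := by nlinarith
      obtain rfl : j = 4 := by omega
      have h3 : 3 * i ^ 2 + 4 * i < 0 := by linarith
      have : i = -1 := by
        have : -2 < i := by nlinarith
        have : i < 0 := by nlinarith
        omega
      omega
    rcases abs_cases k with ⟨h1, h2⟩ | ⟨h1, h2⟩ <;> rcases abs_cases l with ⟨h3, h4⟩ | ⟨h3, h4⟩ <;>
      rw [h1, h3]
    · nlinarith [mul_nonneg h2 h4, sq_nonneg (k + l - 1)]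
    · nlinarith [key (k - l) (k + l) ⟨-l, by ring⟩]
    · nlinarith [key (l - k) (k + l) ⟨-k, by ring⟩]
    · nlinarith [sq_nonneg (k + l + 2), sq_nonneg (k - l)]
  rw [Int.abs_eq_natAbs, Int.abs_eq_natAbs] at h
  omega

lemma devSq_le_tail {E b : ℝ} (hE : 0 ≤ E) (hEb : E ≤ b) (hb : b ≤ 3 / 40) {p : ℤ × ℤ}
    (hp : 6 ≤ wt p) :
    devSq E b p ≤ 57 / 1000 * b * (9 / 25 : ℝ) ^ (p.1.natAbs + p.2.natAbs) := by
  have hb0 : 0 ≤ b := hE.trans hEb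
  have h1 : devSq E b p ≤ (4 * (wt p : ℝ) ^ 2) * b ^ wt p := by
    unfold devSq
    have ht : (tri p.2 : ℝ) ≤ wt p := by
      have : tri p.2 ≤ wt p := by unfold wt; omega
      exact_mod_cast this
    have ht0 : (0 : ℝ) ≤ tri p.2 := by positivity
    refine mul_le_mul (by nlinarith) ?_ (by split_ifs <;> positivity) (by positivity)
    split_ifs
    · exact le_rfl
    · gcongr
  have h2 : (4 * (wt p : ℝ) ^ 2) * b ^ wt p ≤ 57 / 1000 * b * (3 / 5 : ℝ) ^ (wt p + 4) := by
    obtain ⟨n, hn⟩ := Nat.exists_eq_add_of_le hp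
    rw [hn]
    push_cast
    have h3 : (6 + (n : ℝ)) ^ 2 ≤ 36 * 2 ^ n := by
      clear hn
      induction n with
      | zero => norm_num
      | succ n ih =>
        push_cast
        rw [pow_succ 2]
        nlinarith [(Nat.cast_nonneg n : (0 : ℝ) ≤ n)]
    have h4 : (2 * b) ^ n ≤ (3 / 5 : ℝ) ^ n := by gcongr; linarith
    have h5 : b ^ 5 ≤ (3 / 40 : ℝ) ^ 5 := by gcongr
    calc 4 * (6 + (n : ℝ)) ^ 2 * b ^ (6 + n) ≤ 4 * (36 * 2 ^ n) * b ^ (6 + n) := by gcongr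
      _ = 144 * b ^ 5 * b * (2 * b) ^ n := by rw [mul_pow]; ring
      _ ≤ 144 * (3 / 40 : ℝ) ^ 5 * b * (3 / 5 : ℝ) ^ n := by gcongr
      _ = 144 * (3 / 40 : ℝ) ^ 5 * (b * (3 / 5 : ℝ) ^ n) := by ring
      _ ≤ (57 / 1000 * (3 / 5) ^ 10) * (b * (3 / 5 : ℝ) ^ n) :=
        mul_le_mul_of_nonneg_right (by norm_num) (by positivity)
      _ = _ := by ring
  refine (h1.trans h2).trans ?_
  rw [show (9 / 25 : ℝ) = (3 / 5) ^ 2 by norm_num, ← pow_mul]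
  exact mul_le_mul_of_nonneg_left
    (pow_le_pow_of_le_one (by norm_num) (by norm_num) (two_mul_natAbs_le_wt p)) (by positivity)

lemma summable_devSq_and_tsum_le {E b : ℝ} (hE : 0 ≤ E) (hEb : E ≤ b) (hb : b ≤ 3 / 40) :
    Summable (devSq E b) ∧ ∑' p, devSq E b p ≤
      2 * b + 4 * E + 8 * b ^ 2 + 4 * E ^ 2 + 34 * b ^ 4 + 50 * E ^ 4 + 8 * b ^ 5 + 16 * E ^ 5 +
        26 / 100 * b := by
  have hb0 : 0 ≤ b := hE.trans hEb
  have hnn : ∀ p, 0 ≤ devSq E b p := fun p => by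
    unfold devSq; split_ifs <;> positivity
  have hfin : HasSum (fun p => if p ∈ smallIndices then devSq E b p else 0)
      (∑ p ∈ smallIndices, devSq E b p) := by
    have : HasSum (fun p => if p ∈ smallIndices then devSq E b p else 0)
        (∑ p ∈ smallIndices, if p ∈ smallIndices then devSq E b p else 0) :=
      hasSum_sum_of_ne_finset_zero fun p hp => if_neg hp
    convert this using 1
    exact Finset.sum_congr rfl fun p hp => (if_pos hp).symm
  have htail := (hasSum_pow_natAbs_add (r := 9 / 25) (by norm_num) (by norm_num)).mul_left
    (57 / 1000 * b)
  have hle : ∀ p, devSq E b p ≤ (if p ∈ smallIndices then devSq E b p else 0) +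
      57 / 1000 * b * (9 / 25 : ℝ) ^ (p.1.natAbs + p.2.natAbs) := fun p => by
    by_cases hp : p ∈ smallIndices
    · rw [if_pos hp]
      have : 0 ≤ 57 / 1000 * b * (9 / 25 : ℝ) ^ (p.1.natAbs + p.2.natAbs) := by positivity
      linarith
    · rw [if_neg hp, zero_add]
      by_cases h0 : wt p = 0
      · have ht : tri p.2 = 0 := by
          unfold wt at h0; omega
        have : devSq E b p = 0 := by simp [devSq, h0, ht]
        rw [this]
        positivity
      · exact devSq_le_tail hE hEb hb (six_le_wt hp h0)
  have hsum := hfin.add htail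
  have hS := Summable.of_nonneg_of_le hnn hle hsum.summable
  refine ⟨hS, ?_⟩
  have := hS.tsum_le_tsum hle hsum.summable
  rw [hsum.tsum_eq, sum_smallIndices] at this
  refine this.trans ?_
  have : 57 / 1000 * b * ((1 + 9 / 25) / (1 - 9 / 25)) ^ 2 ≤ 26 / 100 * b := by
    norm_num
    linarith
  linarith

lemma exp_le_of_nonpos {x : ℝ} (hx : x ≤ 0) : Real.exp x ≤ 1 + x + x ^ 2 / 2 := by
  have h := Real.quadratic_le_exp_of_nonneg (neg_nonneg.2 hx)
  have h1 : Real.exp x * Real.exp (-x) = 1 := by rw [← Real.exp_add]; simp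
  have h2 := Real.exp_pos x
  have h3 : Real.exp x * (1 + -x + (-x) ^ 2 / 2) ≤ 1 := by
    exact (mul_le_mul_of_nonneg_left h h2.le).trans_eq h1
  have h4 : 1 ≤ (1 + x + x ^ 2 / 2) * (1 + -x + (-x) ^ 2 / 2) := by nlinarith [sq_nonneg (x ^ 2)]
  have h5 : 0 < 1 + -x + (-x) ^ 2 / 2 := by nlinarith
  exact le_of_mul_le_mul_right (h3.trans h4) h5

lemma exp_le_of_nonneg {x : ℝ} (hx : 0 ≤ x) :
    Real.exp x ≤ 1 + x + x ^ 2 / 2 * Real.exp x := by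
  have hd : ∀ t : ℝ, HasDerivAt (fun t => 1 + t + t ^ 2 / 2 * Real.exp t - Real.exp t)
      (1 + (t * Real.exp t + t ^ 2 / 2 * Real.exp t) - Real.exp t) t := fun t => by
    have h1 : HasDerivAt (fun t : ℝ => t ^ 2 / 2) t t := by
      have := ((hasDerivAt_id t).pow 2).div_const 2
      simpa using this
    exact (((hasDerivAt_id t).const_add 1).add (h1.mul (Real.hasDerivAt_exp t))).sub
      (Real.hasDerivAt_exp t)
  have hm : MonotoneOn (fun t => 1 + t + t ^ 2 / 2 * Real.exp t - Real.exp t) (Set.Ici 0) := by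
    refine monotoneOn_of_deriv_nonneg (convex_Ici 0)
      (fun t _ => (hd t).continuousAt.continuousWithinAt)
      (fun t _ => (hd t).differentiableAt.differentiableWithinAt) fun t ht => ?_
    rw [(hd t).deriv]
    have h1 : Real.exp t * Real.exp (-t) = 1 := by rw [← Real.exp_add]; simp
    have h2 := Real.exp_pos t
    have h3 : Real.exp t * (-t + 1) ≤ 1 := by
      exact (mul_le_mul_of_nonneg_left (Real.add_one_le_exp (-t)) h2.le).trans_eq h1
    have : 0 ≤ t ^ 2 / 2 * Real.exp t := by positivity
    linarith
  have := hm (Set.mem_Ici.2 le_rfl) (Set.mem_Ici.2 hx) hx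
  norm_num at this
  linarith

lemma term_self (a : ℝ) (p : ℤ × ℤ) : term a a p = a ^ wt p := by
  unfold term wt
  rw [← pow_add]
  congr 1
  ring

lemma term_le_second_order {β m m₀ e : ℝ} (hβ : 0 ≤ β) (he : 0 ≤ e) (hm : m₀ ≤ m) (p : ℤ × ℤ) :
    term (Real.exp (-(β * (m + 2 * e)))) (Real.exp (-(β * (m - e)))) p ≤
      Real.exp (-(β * m₀)) ^ wt p +
        β * e * (Real.exp (-(β * m)) ^ wt p * ((wt p : ℝ) - 3 * tri p.2)) +
        (β * e) ^ 2 / 2 * devSq (Real.exp (-(β * m))) (Real.exp (-(β * (m - e)))) p := by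
  set x := β * e * ((wt p : ℝ) - 3 * tri p.2) with hx
  have h1 : term (Real.exp (-(β * (m + 2 * e)))) (Real.exp (-(β * (m - e)))) p =
      Real.exp (-(β * m)) ^ wt p * Real.exp x := by
    unfold term
    rw [← Real.exp_nat_mul, ← Real.exp_nat_mul, ← Real.exp_nat_mul, ← Real.exp_add,
      ← Real.exp_add]
    congr 1
    rw [hx]
    unfold wt
    push_cast
    ring
  have h2 : Real.exp (-(β * m)) ^ wt p ≤ Real.exp (-(β * m₀)) ^ wt p := by gcongr
  have hE : 0 ≤ Real.exp (-(β * m)) ^ wt p := by positivity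
  rw [h1]
  have hβe : 0 ≤ β * e := by positivity
  have key : Real.exp (-(β * m)) ^ wt p * Real.exp x ≤ Real.exp (-(β * m)) ^ wt p +
      Real.exp (-(β * m)) ^ wt p * x +
      (β * e) ^ 2 / 2 * devSq (Real.exp (-(β * m))) (Real.exp (-(β * (m - e)))) p := by
    unfold devSq
    split_ifs with h
    · have h' : (3 * tri p.2 : ℝ) ≤ wt p := by exact_mod_cast h
      have hx0 : 0 ≤ x := mul_nonneg hβe (by linarith)
      have h3 : Real.exp (-(β * m)) ^ wt p * Real.exp x ≤ Real.exp (-(β * (m - e))) ^ wt p := by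
        rw [← Real.exp_nat_mul, ← Real.exp_nat_mul, ← Real.exp_add, hx]
        apply Real.exp_le_exp.2
        nlinarith [mul_nonneg hβe (by positivity : (0 : ℝ) ≤ tri p.2)]
      calc _ ≤ Real.exp (-(β * m)) ^ wt p * (1 + x + x ^ 2 / 2 * Real.exp x) :=
            mul_le_mul_of_nonneg_left (exp_le_of_nonneg hx0) hE
        _ = Real.exp (-(β * m)) ^ wt p + Real.exp (-(β * m)) ^ wt p * x +
            x ^ 2 / 2 * (Real.exp (-(β * m)) ^ wt p * Real.exp x) := by ring
        _ ≤ Real.exp (-(β * m)) ^ wt p + Real.exp (-(β * m)) ^ wt p * x +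
            x ^ 2 / 2 * Real.exp (-(β * (m - e))) ^ wt p := by gcongr
        _ = _ := by rw [hx]; ring
    · have h' : (wt p : ℝ) ≤ 3 * tri p.2 := by exact_mod_cast (not_le.1 h).le
      have hx0 : x ≤ 0 := mul_nonpos_of_nonneg_of_nonpos hβe (by linarith)
      calc _ ≤ Real.exp (-(β * m)) ^ wt p * (1 + x + x ^ 2 / 2) :=
            mul_le_mul_of_nonneg_left (exp_le_of_nonpos hx0) hE
        _ = _ := by rw [hx]; ring
  calc _ ≤ _ := key
    _ ≤ _ := by rw [hx]; linarith

lemma tsum_term_le_second_order {β m m₀ e : ℝ} (hβ : 0 < β) (he : 0 ≤ e) (hm₀ : 0 < m₀)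
    (hm : m₀ ≤ m) (hb : Real.exp (-(β * (m - e))) ≤ 3 / 40) :
    ∑' p, term (Real.exp (-(β * (m + 2 * e)))) (Real.exp (-(β * (m - e)))) p ≤
      ∑' p, term (Real.exp (-(β * m₀))) (Real.exp (-(β * m₀))) p +
        (β * e) ^ 2 / 2 *
          ∑' p, devSq (Real.exp (-(β * m))) (Real.exp (-(β * (m - e)))) p := by
  have hEb : Real.exp (-(β * m)) ≤ Real.exp (-(β * (m - e))) := by
    apply Real.exp_le_exp.2
    nlinarith
  have hab : Real.exp (-(β * (m + 2 * e))) ≤ Real.exp (-(β * m)) := by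
    apply Real.exp_le_exp.2
    nlinarith
  have h0 : Real.exp (-(β * m₀)) < 1 := Real.exp_lt_one_iff.2 (by nlinarith)
  have hs0 := summable_term (Real.exp_pos (-(β * m₀))).le h0 (Real.exp_pos (-(β * m₀))).le h0
  have hz := (hasSum_pow_wt_mul_dev (Real.exp_pos (-(β * m))).le (by linarith)).mul_left (β * e)
  have hD := (summable_devSq_and_tsum_le (Real.exp_pos (-(β * m))).le hEb hb).1
  have hR := (hs0.hasSum.add hz).add (hD.hasSum.mul_left ((β * e) ^ 2 / 2))
  have hL := summable_term (Real.exp_pos (-(β * (m + 2 * e)))).le (by linarith)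
    (Real.exp_pos (-(β * (m - e)))).le (by linarith)
  have := hL.tsum_le_tsum (fun p => ?_) hR.summable
  · rw [hR.tsum_eq, mul_zero, add_zero] at this
    exact this
  · rw [term_self]
    exact term_le_second_order hβ.le he hm p

lemma mul_exp_neg_le {α c : ℝ} (hα : 1 ≤ α) (hc : 1 ≤ c) :
    α * Real.exp (-(c * α)) ≤ Real.exp (-c) := by
  have h1 : α ≤ Real.exp (c * (α - 1)) := by
    have := Real.add_one_le_exp (c * (α - 1))
    nlinarith
  calc α * Real.exp (-(c * α)) ≤ Real.exp (c * (α - 1)) * Real.exp (-(c * α)) := by gcongr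
    _ = Real.exp (-c) := by rw [← Real.exp_add]; congr 1; ring

lemma exp_neg_le_inv_sum {x : ℝ} (hx : 0 ≤ x) (n : ℕ) {q : ℝ} (hq : 0 < q)
    (h : q⁻¹ ≤ ∑ i ∈ Finset.range n, x ^ i / i.factorial) : Real.exp (-x) ≤ q := by
  rw [Real.exp_neg]
  exact inv_le_of_inv_le₀ hq (h.trans (Real.sum_le_exp_of_nonneg hx n))

lemma mul_devSq_bound_le {α b E : ℝ} (hα : 1 ≤ α) (hb0 : 0 ≤ b) (hE0 : 0 ≤ E)
    (hb1 : α * b ≤ 731 / 10000) (hE1 : α * E ≤ 266 / 10000) :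
    α * (2 * b + 4 * E + 8 * b ^ 2 + 4 * E ^ 2 + 34 * b ^ 4 + 50 * E ^ 4 + 8 * b ^ 5 +
      16 * E ^ 5 + 26 / 100 * b) ≤ 32 / 100 := by
  have hb2 : b ≤ 731 / 10000 := by nlinarith
  have hE2 : E ≤ 266 / 10000 := by nlinarith
  have hb : 2 + 8 * b + 34 * b ^ 3 + 8 * b ^ 4 + 26 / 100 ≤ 2 + 8 * (731 / 10000) +
      34 * (731 / 10000) ^ 3 + 8 * (731 / 10000) ^ 4 + 26 / 100 := by gcongr
  have hE : 4 + 4 * E + 50 * E ^ 3 + 16 * E ^ 4 ≤ 4 + 4 * (266 / 10000) +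
      50 * (266 / 10000) ^ 3 + 16 * (266 / 10000) ^ 4 := by gcongr
  have h1 := mul_le_mul hb1 hb (by positivity) (by norm_num)
  have h2 := mul_le_mul hE1 hE (by positivity) (by norm_num)
  norm_num at h1 h2
  linarith

lemma mul_exp_neg_div_le {α y : ℝ} (hα : 1 ≤ α) (hy0 : 0 < y) (hy : y ≤ 6 / 5) :
    α * Real.exp (-(Real.pi * α / y)) ≤ 731 / 10000 := by
  have hπ := Real.pi_gt_d4
  have h1 : Real.exp (-(Real.pi * α / y)) ≤ Real.exp (-(26179 / 10000 * α)) := by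
    apply Real.exp_le_exp.2
    rw [neg_le_neg_iff, le_div_iff₀ hy0]
    nlinarith
  have h2 : Real.exp (-(26179 / 10000)) ≤ 731 / 10000 :=
    exp_neg_le_inv_sum (by norm_num) 12 (by norm_num)
      (by norm_num [Finset.sum_range_succ, Nat.factorial])
  calc _ ≤ α * Real.exp (-(26179 / 10000 * α)) := by gcongr
    _ ≤ _ := (mul_exp_neg_le hα (by norm_num)).trans h2

lemma mul_exp_neg_mul_le {α m : ℝ} (hα : 1 ≤ α) (hm : 57735 / 100000 ≤ m) :
    α * Real.exp (-(2 * Real.pi * α * m)) ≤ 266 / 10000 := by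
  have hπ := Real.pi_gt_d4
  have h1 : Real.exp (-(2 * Real.pi * α * m)) ≤ Real.exp (-(36274 / 10000 * α)) := by
    apply Real.exp_le_exp.2
    rw [neg_le_neg_iff]
    have : 36274 / 10000 ≤ 2 * Real.pi * m := by nlinarith
    nlinarith
  have h2 : Real.exp (-(36274 / 10000)) ≤ 266 / 10000 :=
    exp_neg_le_inv_sum (by norm_num) 15 (by norm_num)
      (by norm_num [Finset.sum_range_succ, Nat.factorial])
  calc _ ≤ α * Real.exp (-(36274 / 10000 * α)) := by gcongr
    _ ≤ _ := (mul_exp_neg_le hα (by norm_num)).trans h2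

lemma seven_tenths_mul_sq_le {m e m₀ : ℝ} (hs : 5 / 12 ≤ m - e) (hm : m ≤ 61 / 100)
    (hm₀ : m₀ ≤ m) (h : m ^ 2 = e ^ 2 + m₀ ^ 2) :
    7 / 10 * e ^ 2 ≤ e ^ 2 * (m - e) / 2 + 2 / 3 * (m - m₀) := by
  have h2 : e ^ 2 ≤ 122 / 100 * (m - m₀) := by
    have h3 : e ^ 2 = (m + m₀) * (m - m₀) := by linarith
    rw [h3]
    exact mul_le_mul_of_nonneg_right (by linarith) (by linarith)
  have := mul_le_mul_of_nonneg_left hs (sq_nonneg e)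
  linarith

lemma radius_eq {y : ℝ} (hy : 0 < y) :
    y / 4 + 1 / (8 * y) + 1 / (64 * y ^ 3) =
      ((y - 3 / (4 * y)) / 3) ^ 2 * ((y + 3 / (4 * y)) / 3 - (y - 3 / (4 * y)) / 3) / 2 +
        2 / 3 * ((y + 3 / (4 * y)) / 3) := by
  field_simp
  ring

lemma radius_ge {y m₀ : ℝ} (hy : 0 < y) (hm₀ : m₀ ^ 2 = 1 / 3) :
    2 * m₀ / 3 ≤ y / 4 + 1 / (8 * y) + 1 / (64 * y ^ 3) := by
  have hm : m₀ ≤ (y + 3 / (4 * y)) / 3 := by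
    apply le_of_sq_le_sq _ (by positivity)
    have : ((y + 3 / (4 * y)) / 3) ^ 2 = ((y - 3 / (4 * y)) / 3) ^ 2 + 1 / 3 := by
      field_simp
      ring
    rw [this, hm₀]
    linarith [sq_nonneg ((y - 3 / (4 * y)) / 3)]
  have hs : (y + 3 / (4 * y)) / 3 - (y - 3 / (4 * y)) / 3 = 1 / (2 * y) := by
    field_simp
    ring
  have : 0 ≤ ((y - 3 / (4 * y)) / 3) ^ 2 * (1 / (2 * y)) / 2 := by positivity
  rw [radius_eq hy, hs]
  linarith

set_option maxHeartbeats 600000 in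
lemma tsum_term_le_of_le {α y m₀ : ℝ} (hα : 1 ≤ α) (hm₀ : 0 < m₀) (hm₀' : m₀ ^ 2 = 1 / 3)
    (hy : 3 / 4 ≤ y ^ 2) (hy0 : 0 < y) (hy' : y ≤ 6 / 5) :
    ∑' p, term (Real.exp (-(2 * Real.pi * α * (y - 1 / (4 * y)))))
        (Real.exp (-(Real.pi * α / y))) p ≤
      ∑' p, term (Real.exp (-(2 * Real.pi * α * m₀))) (Real.exp (-(2 * Real.pi * α * m₀))) p +
        3 * (Real.pi * α * ((y / 4 + 1 / (8 * y) + 1 / (64 * y ^ 3)) - 2 * m₀ / 3)) := by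
  have hπ := Real.pi_gt_d4
  have hπ' := Real.pi_lt_d4
  set m := (y + 3 / (4 * y)) / 3 with hm
  set e := (y - 3 / (4 * y)) / 3 with he
  have hα0 : 0 < α := by linarith
  have he0 : 0 ≤ e := by
    have : 3 / (4 * y) ≤ y := by rw [div_le_iff₀ (by positivity)]; nlinarith
    rw [he]; linarith
  have hmpos : 0 < m := by positivity
  have hme : m ^ 2 = e ^ 2 + 1 / 3 := by rw [hm, he]; field_simp; ring
  have hm0m : m₀ ≤ m := by
    apply le_of_sq_le_sq _ hmpos.le
    nlinarith
  have hm1 : m ≤ 61 / 100 := by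
    rw [hm, div_le_iff₀ (by norm_num), ← le_sub_iff_add_le', div_le_iff₀ (by positivity)]
    have hyl : 1 / 2 ≤ y := by nlinarith
    nlinarith
  have hm₀l : 57735 / 100000 ≤ m₀ := by
    apply le_of_sq_le_sq _ hm₀.le
    rw [hm₀']; norm_num
  have hs : m - e = 1 / (2 * y) := by rw [hm, he]; field_simp; ring
  have hp : m + 2 * e = y - 1 / (4 * y) := by rw [hm, he]; field_simp; ring
  have hR : y / 4 + 1 / (8 * y) + 1 / (64 * y ^ 3) - 2 * m₀ / 3 =
      e ^ 2 * (m - e) / 2 + 2 / 3 * (m - m₀) := by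
    rw [radius_eq hy0]; ring
  have hbexp : Real.exp (-(Real.pi * α / y)) = Real.exp (-(2 * Real.pi * α * (m - e))) := by
    rw [hs]; congr 1; field_simp
  have hb1 : α * Real.exp (-(2 * Real.pi * α * (m - e))) ≤ 731 / 10000 := by
    rw [← hbexp]; exact mul_exp_neg_div_le hα hy0 hy'
  have hE1 := mul_exp_neg_mul_le hα (hm₀l.trans hm0m)
  set b := Real.exp (-(2 * Real.pi * α * (m - e))) with hbdef
  set E := Real.exp (-(2 * Real.pi * α * m)) with hEdef
  have hb0 : 0 < b := Real.exp_pos _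
  have hE0 : 0 < E := Real.exp_pos _
  have hb2 : b ≤ 731 / 10000 := by nlinarith
  have hE2 : E ≤ 266 / 10000 := by nlinarith
  have hEb : E ≤ b := by
    apply Real.exp_le_exp.2
    have : 0 ≤ 2 * Real.pi * α * e := by positivity
    linarith
  have hmain := tsum_term_le_second_order (β := 2 * Real.pi * α) (by positivity) he0 hm₀ hm0m
    (by rw [← hbdef]; linarith)
  rw [hp, ← hbdef, ← hEdef] at hmain
  rw [hbexp, hR]
  refine hmain.trans ?_
  apply add_le_add le_rfl
  have hD := (summable_devSq_and_tsum_le hE0.le hEb (by linarith : b ≤ 3 / 40)).2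
  set D := ∑' p, devSq E b p
  have hαD : α * D ≤ 32 / 100 := by
    exact (mul_le_mul_of_nonneg_left hD hα0.le).trans (mul_devSq_bound_le hα hb0.le hE0.le hb1 hE1)
  have hΔ : 7 / 10 * e ^ 2 ≤ e ^ 2 * (m - e) / 2 + 2 / 3 * (m - m₀) := by
    refine seven_tenths_mul_sq_le ?_ hm1 hm0m (by linarith)
    rw [hs, div_le_div_iff₀ (by norm_num) (by positivity)]
    linarith
  have hπα : 0 < Real.pi * α := by positivity
  calc (2 * Real.pi * α * e) ^ 2 / 2 * D = Real.pi * α * (e ^ 2 * (2 * Real.pi * (α * D))) := by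
        ring
    _ ≤ Real.pi * α * (e ^ 2 * (21 / 10)) := by
        gcongr
        nlinarith
    _ = 3 * (Real.pi * α * (7 / 10 * e ^ 2)) := by ring
    _ ≤ _ := by gcongr

lemma le_tri (n : ℕ) : n ≤ tri n := by
  have := two_mul_tri n
  have h : (n : ℤ) ≤ n ^ 2 := by exact_mod_cast Nat.le_self_pow two_ne_zero n
  zify
  nlinarith

lemma tri_neg_add_one (n : ℤ) : tri (-(n + 1)) = tri n := by
  rw [← tri_neg_sub_one n]
  congr 1
  ring

lemma summable_and_tsum_int_le {f : ℤ → ℝ} (hf : ∀ n, 0 ≤ f n) {u v : ℕ → ℝ} {s t : ℝ}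
    (hu : HasSum u s) (hv : HasSum v t) (hfu : ∀ n : ℕ, f n ≤ u n)
    (hfv : ∀ n : ℕ, f (-(n + 1 : ℤ)) ≤ v n) : Summable f ∧ ∑' n, f n ≤ s + t := by
  have h1 := Summable.of_nonneg_of_le (fun _ => hf _) hfu hu.summable
  have h2 := Summable.of_nonneg_of_le (fun _ => hf _) hfv hv.summable
  have h := HasSum.of_nat_of_neg_add_one h1.hasSum h2.hasSum
  refine ⟨h.summable, ?_⟩
  rw [h.tsum_eq, ← hu.tsum_eq, ← hv.tsum_eq]
  exact add_le_add (h1.tsum_le_tsum hfu hu.summable) (h2.tsum_le_tsum hfv hv.summable)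

lemma tsum_pow_tri_row_zero {b : ℝ} (hb : 0 ≤ b) (hb1 : b < 1) :
    ∑' k : ℤ, b ^ (tri k + tri (k + 0)) ≤ 2 / (1 - b ^ 2) := by
  have h := hasSum_geometric_of_lt_one (sq_nonneg b) (by nlinarith : b ^ 2 < 1)
  refine (summable_and_tsum_int_le (fun _ => by positivity) h h (fun n => ?_)
    fun n => ?_).2.trans_eq (by ring)
  · rw [← pow_mul, add_zero]
    exact pow_le_pow_of_le_one hb hb1.le (by linarith [le_tri n])
  · rw [← pow_mul, add_zero, tri_neg_add_one]
    exact pow_le_pow_of_le_one hb hb1.le (by linarith [le_tri n])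

lemma tsum_pow_tri_row_neg_one {b : ℝ} (hb : 0 ≤ b) (hb1 : b < 1) :
    ∑' k : ℤ, b ^ (tri k + tri (k + -1)) ≤ (1 + b) / (1 - b) := by
  have h := hasSum_geometric_of_lt_one hb hb1
  refine (summable_and_tsum_int_le (fun _ => by positivity) h (h.mul_left b) (fun n => ?_)
    fun n => ?_).2.trans_eq (by ring)
  · exact pow_le_pow_of_le_one hb hb1.le (by linarith [le_tri n])
  · rw [← pow_succ']
    refine pow_le_pow_of_le_one hb hb1.le ?_
    have : tri (-(n + 1 : ℤ) + -1) = tri ((n + 1 : ℕ) : ℤ) := by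
      rw [← tri_neg_add_one ((n + 1 : ℕ) : ℤ)]
      congr 1
    linarith [le_tri (n + 1)]

lemma tsum_pow_tri_row_le {b : ℝ} (hb : 0 ≤ b) (hb1 : b < 1) (l : ℤ) :
    ∑' k : ℤ, b ^ (tri k + tri (k + l)) ≤ 2 / (1 - b) := by
  have h := hasSum_geometric_of_lt_one hb hb1
  refine (summable_and_tsum_int_le (fun _ => by positivity) h h (fun n => ?_)
    fun n => ?_).2.trans_eq (by ring)
  · exact pow_le_pow_of_le_one hb hb1.le (by linarith [le_tri n])
  · rw [tri_neg_add_one]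
    exact pow_le_pow_of_le_one hb hb1.le (by linarith [le_tri n])

lemma tsum_term_le_rows {b : ℝ} (hb : 0 ≤ b) (hb1 : b < 1) {a : ℝ}
    (ha : 0 ≤ a) (ha1 : a < 1) :
    ∑' p, term a b p ≤ 2 / (1 - b ^ 2) + (1 + b) / (1 - b) + 4 * a / ((1 - a) * (1 - b)) := by
  have hS := summable_term ha ha1 hb hb1
  have hS' := (Equiv.prodComm ℤ ℤ).summable_iff.2 hS
  have hrow : ∀ l : ℤ, ∑' k : ℤ, term a b (k, l) =
      a ^ tri l * ∑' k : ℤ, b ^ (tri k + tri (k + l)) := fun l => by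
    rw [← tsum_mul_left]
    rfl
  have hG : ∑' p, term a b p = ∑' l : ℤ, a ^ tri l * ∑' k : ℤ, b ^ (tri k + tri (k + l)) := by
    exact ((Equiv.prodComm ℤ ℤ).tsum_eq _).symm.trans
      (hS'.tsum_prod.trans (tsum_congr hrow))
  have hC : 0 ≤ 2 / (1 - b) := div_nonneg zero_le_two (by linarith)
  have hnn : ∀ l : ℤ, 0 ≤ ∑' k : ℤ, b ^ (tri k + tri (k + l)) := fun l =>
    tsum_nonneg fun _ => by positivity
  have hgen : ∀ (n : ℕ) (l : ℤ), a ^ tri n * ∑' k : ℤ, b ^ (tri k + tri (k + l)) ≤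
      a ^ n * (2 / (1 - b)) := fun n l =>
    mul_le_mul (pow_le_pow_of_le_one ha ha1.le (le_tri n)) (tsum_pow_tri_row_le hb hb1 l)
      (hnn l) (by positivity)
  have hgeo := (hasSum_geometric_of_lt_one ha ha1).mul_right (2 / (1 - b))
  rw [hG]
  refine (summable_and_tsum_int_le (fun l => mul_nonneg (by positivity) (hnn l))
    (hgeo.add (hasSum_ite_eq 0 (2 / (1 - b ^ 2) - 2 / (1 - b))))
    (hgeo.add (hasSum_ite_eq 0 ((1 + b) / (1 - b) - 2 / (1 - b))))
    (fun n => ?_) fun n => ?_).2.trans_eq ?_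
  · rcases eq_or_ne n 0 with rfl | hn
    · have h0 : tri (0 : ℤ) = 0 := rfl
      have := tsum_pow_tri_row_zero hb hb1
      simpa [h0] using this
    · rw [if_neg hn, add_zero]
      exact hgen n n
  · rw [tri_neg_add_one]
    rcases eq_or_ne n 0 with rfl | hn
    · have h0 : tri (0 : ℤ) = 0 := rfl
      have := tsum_pow_tri_row_neg_one hb hb1
      simpa [h0] using this
    · rw [if_neg hn, add_zero]
      exact hgen n _
  · have h1 : 1 - a ≠ 0 := by linarith
    have h2 : 1 - b ≠ 0 := by linarith
    have h3 : (1 - a)⁻¹ * (2 / (1 - b)) = 2 / (1 - b) + 2 * a / ((1 - a) * (1 - b)) := by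
      field_simp
      ring
    rw [h3]
    ring

lemma inv_one_sub_exp_neg_le {x c : ℝ} (hx : 0 < x) (hc : c * x < 1)
    (h : 1 ≤ (1 - c * x) * (1 + x / 2 + x ^ 2 / 6 + x ^ 3 / 24)) :
    1 / (1 - Real.exp (-x)) ≤ 1 + 1 / x - c := by
  have h1 : 1 + x * (1 + x / 2 + x ^ 2 / 6 + x ^ 3 / 24) ≤ Real.exp x := by
    have := Real.sum_le_exp_of_nonneg hx.le 5
    norm_num [Finset.sum_range_succ, Nat.factorial] at this
    linarith
  have h2 : Real.exp x * Real.exp (-x) = 1 := by rw [← Real.exp_add]; simp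
  have h3 : Real.exp (-x) < 1 := Real.exp_lt_one_iff.2 (by linarith)
  have h4 := Real.exp_pos (-x)
  have h5 : x ≤ (1 - c * x) * (Real.exp x - 1) := by nlinarith
  have h6 : x * Real.exp (-x) ≤ (1 - c * x) * (1 - Real.exp (-x)) := by
    calc x * Real.exp (-x) ≤ (1 - c * x) * (Real.exp x - 1) * Real.exp (-x) := by gcongr
      _ = (1 - c * x) * (Real.exp x * Real.exp (-x) - Real.exp (-x)) := by ring
      _ = _ := by rw [h2]
  rw [div_le_iff₀ (by linarith)]
  have h7 : (1 + 1 / x - c) * (1 - Real.exp (-x)) =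
      (x * (1 - Real.exp (-x)) + (1 - c * x) * (1 - Real.exp (-x))) / x := by
    field_simp
    ring
  rw [h7, le_div_iff₀ hx]
  linarith

lemma radius_ge_tangent {y : ℝ} (hy : 6 / 5 ≤ y) :
    2445 / 10000 + 1405 / 10000 * y ≤ y / 4 + 1 / (8 * y) + 1 / (64 * y ^ 3) := by
  obtain ⟨z, hz, rfl⟩ : ∃ z : ℝ, 0 ≤ z ∧ y = 6 / 5 + z := ⟨y - 6 / 5, by linarith, by ring⟩
  have h : (6 / 5 + z) / 4 + 1 / (8 * (6 / 5 + z)) + 1 / (64 * (6 / 5 + z) ^ 3) =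
      (16 * (6 / 5 + z) ^ 4 + 8 * (6 / 5 + z) ^ 2 + 1) / (64 * (6 / 5 + z) ^ 3) := by
    field_simp
    ring
  rw [h, le_div_iff₀ (by positivity), ← sub_nonneg]
  ring_nf
  positivity

lemma tsum_term_le_of_ge {α y m₀ : ℝ} (hα : 1 ≤ α) (hm₀ : m₀ ^ 2 = 1 / 3)
    (hy : 6 / 5 ≤ y) :
    ∑' p, term (Real.exp (-(2 * Real.pi * α * (y - 1 / (4 * y)))))
        (Real.exp (-(Real.pi * α / y))) p ≤
      3 + 3 * (Real.pi * α * ((y / 4 + 1 / (8 * y) + 1 / (64 * y ^ 3)) - 2 * m₀ / 3)) := by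
  have hπ := Real.pi_gt_d4
  have hπ' := Real.pi_lt_d4
  have hy0 : 0 < y := by linarith
  set a := Real.exp (-(2 * Real.pi * α * (y - 1 / (4 * y)))) with ha
  set b := Real.exp (-(Real.pi * α / y)) with hb
  have ha0 : 0 < a := Real.exp_pos _
  have hb0 : 0 < b := Real.exp_pos _
  have hx0 : 0 < Real.pi / y := by positivity
  have hx1 : Real.pi / y ≤ 2618 / 1000 := by
    rw [div_le_iff₀ hy0]; linarith
  have hbx : b ≤ Real.exp (-(Real.pi / y)) := by
    apply Real.exp_le_exp.2
    rw [neg_le_neg_iff]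
    gcongr
    nlinarith
  have hbx2 : b ^ 2 ≤ Real.exp (-(2 * (Real.pi / y))) := by
    calc b ^ 2 ≤ Real.exp (-(Real.pi / y)) ^ 2 := by gcongr
      _ = _ := by rw [← Real.exp_nat_mul]; congr 1; push_cast; ring
  have ha1 : a ≤ 1 / 500 := by
    have h2 : Real.exp (-(622 / 100)) ≤ 1 / 500 :=
      exp_neg_le_inv_sum (by norm_num) 22 (by norm_num)
        (by norm_num [Finset.sum_range_succ, Nat.factorial])
    refine le_trans (Real.exp_le_exp.2 ?_) h2
    rw [neg_le_neg_iff]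
    have h3 : 1 / (4 * y) ≤ 5 / 24 := by
      rw [div_le_div_iff₀ (by positivity) (by norm_num)]; linarith
    have h4 : 119 / 120 ≤ y - 1 / (4 * y) := by linarith
    have h5 : 31415 / 10000 ≤ Real.pi * α := by nlinarith
    have h6 := mul_le_mul h5 h4 (by norm_num) (by positivity)
    linarith
  have hinv : y / Real.pi ≤ 31832 / 100000 * y := by
    rw [div_le_iff₀ Real.pi_pos]
    nlinarith
  have h1 : 1 / (1 - b) ≤ 1 + 31832 / 100000 * y - 28 / 100 := by
    have hlt : Real.exp (-(Real.pi / y)) < 1 := Real.exp_lt_one_iff.2 (by linarith)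
    calc 1 / (1 - b) ≤ 1 / (1 - Real.exp (-(Real.pi / y))) :=
          one_div_le_one_div_of_le (by linarith) (by linarith)
      _ ≤ 1 + 1 / (Real.pi / y) - 28 / 100 := by
          refine inv_one_sub_exp_neg_le hx0 (by linarith) ?_
          generalize Real.pi / y = x at hx0 hx1
          have : 0 ≤ x * (22 / 100 + 2 / 75 * x - 1 / 200 * x ^ 2 - 7 / 600 * x ^ 3) := by
            apply mul_nonneg hx0.le
            nlinarith [mul_nonneg hx0.le (sub_nonneg.2 hx1),
              mul_nonneg (sq_nonneg x) (sub_nonneg.2 hx1)]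
          linarith
      _ ≤ _ := by rw [one_div_div]; linarith
  have h2 : 1 / (1 - b ^ 2) ≤ 1 + 15916 / 100000 * y - 17 / 100 := by
    have hlt : Real.exp (-(2 * (Real.pi / y))) < 1 := Real.exp_lt_one_iff.2 (by linarith)
    calc 1 / (1 - b ^ 2) ≤ 1 / (1 - Real.exp (-(2 * (Real.pi / y)))) :=
          one_div_le_one_div_of_le (by linarith) (by linarith)
      _ ≤ 1 + 1 / (2 * (Real.pi / y)) - 17 / 100 := by
          refine inv_one_sub_exp_neg_le (by linarith) (by linarith) ?_
          generalize Real.pi / y = x at hx0 hx1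
          have : 0 ≤ 2 * x * (33 / 100 + 49 / 600 * (2 * x) + 1 / 75 * (2 * x) ^ 2 -
              17 / 2400 * (2 * x) ^ 3) := by
            apply mul_nonneg (by linarith)
            nlinarith [mul_nonneg hx0.le (sub_nonneg.2 hx1),
              mul_nonneg (sq_nonneg x) (sub_nonneg.2 hx1)]
          linarith
      _ ≤ _ := by
          have : 1 / (2 * (Real.pi / y)) = y / Real.pi / 2 := by field_simp
          rw [this]; linarith
  have hb1 : b < 1 := hbx.trans_lt (Real.exp_lt_one_iff.2 (by linarith))
  have h3 : 4 * a / ((1 - a) * (1 - b)) ≤ 81 / 10000 * (1 + 31832 / 100000 * y - 28 / 100) := by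
    have : 4 * a / ((1 - a) * (1 - b)) = 4 * a / (1 - a) * (1 / (1 - b)) := by
      rw [div_mul_div_comm, mul_one]
    rw [this]
    have h4 : 4 * a / (1 - a) ≤ 81 / 10000 := by
      rw [div_le_iff₀ (by linarith)]; linarith
    exact mul_le_mul h4 h1 (one_div_nonneg.2 (by linarith)) (by norm_num)
  have hrows := tsum_term_le_rows hb0.le hb1 ha0.le (by linarith : a < 1)
  have h4 : 2 / (1 - b ^ 2) = 2 * (1 / (1 - b ^ 2)) := by ring
  have h5 : (1 + b) / (1 - b) = 2 * (1 / (1 - b)) - 1 := by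
    have : 1 - b ≠ 0 := by linarith
    field_simp
    ring
  rw [h4, h5] at hrows
  have hm1 : m₀ ≤ 57736 / 100000 := by
    apply le_of_sq_le_sq _ (by norm_num)
    rw [hm₀]; norm_num
  have hR := radius_ge_tangent hy
  set R := y / 4 + 1 / (8 * y) + 1 / (64 * y ^ 3)
  have hR' : 1405 / 10000 * y - 14041 / 100000 ≤ R - 2 * m₀ / 3 := by linarith
  have hπα : 31415 / 10000 ≤ Real.pi * α := by nlinarith
  have h6 : 31415 / 10000 * (1405 / 10000 * y - 14041 / 100000) ≤
      Real.pi * α * (R - 2 * m₀ / 3) :=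
    mul_le_mul hπα hR' (by linarith) (by positivity)
  linarith

/-- For every `α ≥ 1`, `f_α` attains its maximum over `[√3/2, ∞)` at `y = √3/2`. -/
theorem fTheta_max (α : ℝ) (hα : 1 ≤ α) (y : ℝ) (hy : Real.sqrt 3 / 2 ≤ y) :
    fTheta α y ≤ fTheta α (Real.sqrt 3 / 2) := by
  have hs : Real.sqrt 3 ^ 2 = 3 := Real.sq_sqrt (by norm_num)
  have hs0 : 0 < Real.sqrt 3 := by positivity
  have hy0 : 0 < y := by linarith
  set s := Real.sqrt 3
  have hπα : 0 < Real.pi * α := by positivity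
  have e1 : s / 2 - 1 / (4 * (s / 2)) = s / 3 := by
    field_simp
    linarith
  have e2 : Real.pi * α / (s / 2) = 2 * Real.pi * α * (s / 3) := by
    field_simp
    linarith
  have e3 : s / 2 / 4 + 1 / (8 * (s / 2)) + 1 / (64 * (s / 2) ^ 3) = 2 * (s / 3) / 3 := by
    have : s ^ 4 = 9 := by rw [show s ^ 4 = (s ^ 2) ^ 2 by ring, hs]; norm_num
    field_simp
    nlinarith
  have hm₀' : (s / 3) ^ 2 = 1 / 3 := by rw [div_pow, hs]; norm_num
  rw [fTheta_eq α y hy0, fTheta_eq α (s / 2) (by positivity), e1, e2, e3]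
  set E := Real.exp (-(2 * Real.pi * α * (s / 3)))
  set R := y / 4 + 1 / (8 * y) + 1 / (64 * y ^ 3) with hR
  have hE1 : E < 1 := Real.exp_lt_one_iff.2 (by
    have : 0 < 2 * Real.pi * α * (s / 3) := by positivity
    linarith)
  have hE0 : 0 < E := Real.exp_pos _
  have h3 : 3 ≤ ∑' p, term E E p := by
    have h := (summable_term hE0.le hE1 hE0.le hE1).sum_le_tsum {(0, 0), (-1, 0), (0, -1)}
      (fun p _ => by unfold term; positivity)
    refine le_trans (le_of_eq ?_) h
    rw [Finset.sum_insert (by decide), Finset.sum_insert (by decide), Finset.sum_singleton]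
    norm_num [term, tri]
  have hR0 : 2 * (s / 3) / 3 ≤ R := radius_ge hy0 hm₀'
  have hΔ : 0 ≤ Real.pi * α * (R - 2 * (s / 3) / 3) := mul_nonneg hπα.le (by linarith)
  have hle : ∑' p, term (Real.exp (-(2 * Real.pi * α * (y - 1 / (4 * y)))))
      (Real.exp (-(Real.pi * α / y))) p ≤
      ∑' p, term E E p + 3 * (Real.pi * α * (R - 2 * (s / 3) / 3)) := by
    rcases le_total y (6 / 5) with h | h
    · exact tsum_term_le_of_le hα (by positivity) hm₀' (by nlinarith) hy0 h
    · exact (tsum_term_le_of_ge hα hm₀' h).trans (add_le_add h3 le_rfl)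
  set G := ∑' p, term E E p
  calc _ ≤ Real.exp (-(Real.pi * α * R)) * (G + 3 * (Real.pi * α * (R - 2 * (s / 3) / 3))) := by
        gcongr
    _ ≤ Real.exp (-(Real.pi * α * R)) *
        (G * Real.exp (Real.pi * α * (R - 2 * (s / 3) / 3))) := by
        have := Real.add_one_le_exp (Real.pi * α * (R - 2 * (s / 3) / 3))
        gcongr
        nlinarith
    _ = Real.exp (-(Real.pi * α * (2 * (s / 3) / 3))) * G := by
        rw [mul_left_comm, ← Real.exp_add, mul_comm G]
        congr 2
        ring
end
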